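/- Let W : ℝ → ℝ be C² and suppose there are positive numbers μ₁ < μ₂ < ⋯ < μ_m (m ≥ 2) such that W(μ₁) > W(μ₂) > ⋯ > W(μ_m), W'(0) ≤ 0, W'(μᵢ) = 0 for each i, and W(t) > W(μᵢ) for all t ∈ [0, μᵢ) and each i. For each i let 𝐔ᵢ be the unique C² solution of 𝐔ᵢ'' = W'(𝐔ᵢ) on (0,∞) with 𝐔ᵢ(0) = 0 and 𝐔ᵢ(s) → μᵢ as s → ∞. Fix ε ∈ (0, min_{1≤i≤m}(μᵢ − μ_{i−1})) (with μ₀ = 0) and Dᵢ > Dᵢ' where 𝐔ᵢ(Dᵢ') = μᵢ − ε. Then there exist Rᵢ' > Dᵢ, depending only on ε, Dᵢ, W and n, such that if a domain Ω with nonempty C² boundary contains a closed ball of radius R'' = max_i Rᵢ', the problem Δu = W'(u) in Ω, u = 0 on ∂Ω, has at least m stable solutions u₁, …, u_m with u₁(x) < u₂(x) < ⋯ < u_m(x) for all x ∈ Ω, satisfying 0 < uᵢ(x) < μᵢ in Ω and uᵢ(x) > μᵢ − ε for all x ∈ Ω_{Rᵢ'} + B_{Rᵢ'−Dᵢ}, for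 each i = 1, …, m. -/

import Mathlib

open Metric Set Filter Pointwise

noncomputable section

/-- The Laplacian of `u : ℝⁿ → ℝ`: the sum of the second partial derivatives. -/
def lap {n : ℕ} (u : EuclideanSpace ℝ (Fin n) → ℝ) (x : EuclideanSpace ℝ (Fin n)) : ℝ :=
  ∑ i : Fin n, fderiv ℝ (fun y => fderiv ℝ u y (EuclideanSpace.single i 1)) x
    (EuclideanSpace.single i 1)

/-- Condition (a'): `W` is `C²`, `μ > 0`, `W μ = 0`, `W > 0` on `[0, μ)`, `W ≥ 0` everywhere,
and either `W(-t) ≥ W(t)` on `[0, μ]` or `W' < 0` on `(-∞, 0)`. -/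
def CondA' (W : ℝ → ℝ) (μ : ℝ) : Prop :=
  ContDiff ℝ 2 W ∧ 0 < μ ∧ W μ = 0 ∧ (∀ t ∈ Set.Ico (0:ℝ) μ, 0 < W t) ∧
    (∀ t : ℝ, 0 ≤ W t) ∧
    ((∀ t ∈ Set.Icc (0:ℝ) μ, W t ≤ W (-t)) ∨ (∀ t < (0:ℝ), deriv W t < 0))

/-- `U` is the heteroclinic profile: `U'' = W'(U)` on `(0, ∞)`, `U 0 = 0`, `U → μ` at `∞`. -/
def IsHetero (W : ℝ → ℝ) (μ : ℝ) (U : ℝ → ℝ) : Prop :=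
  ContDiffOn ℝ 2 U (Set.Ici 0) ∧ U 0 = 0 ∧
    (∀ s > (0:ℝ), deriv (deriv U) s = deriv W (U s)) ∧
    Filter.Tendsto U Filter.atTop (nhds μ)

/-- `Ω` has boundary of class `C²`, via local `C²` defining functions. -/
def HasC2Boundary {n : ℕ} (Ω : Set (EuclideanSpace ℝ (Fin n))) : Prop :=
  ∀ x ∈ frontier Ω, ∃ (V : Set (EuclideanSpace ℝ (Fin n))) (f : EuclideanSpace ℝ (Fin n) → ℝ),
    IsOpen V ∧ x ∈ V ∧ ContDiffOn ℝ 2 f V ∧ (∀ y ∈ V, fderiv ℝ f y ≠ 0) ∧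
    Ω ∩ V = {y ∈ V | f y < 0} ∧ frontier Ω ∩ V = {y ∈ V | f y = 0}

/-- A solution `u` of `Δu = W'(u)` in `Ω` is stable:
`∫_Ω (|∇φ|² + W''(u) φ²) ≥ 0` for every test function `φ ∈ C_c^∞(Ω)`. -/
def IsStable {n : ℕ} (W : ℝ → ℝ) (Ω : Set (EuclideanSpace ℝ (Fin n)))
    (u : EuclideanSpace ℝ (Fin n) → ℝ) : Prop :=
  ∀ φ : EuclideanSpace ℝ (Fin n) → ℝ, ContDiff ℝ (⊤ : ℕ∞) φ → HasCompactSupport φ →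
    tsupport φ ⊆ Ω →
    0 ≤ ∫ x in Ω, (‖fderiv ℝ φ x‖^2 + deriv (deriv W) (u x) * (φ x)^2)

section Helpers

open MeasureTheory Topology
open scoped ContDiff

section Inner
variable {E : Type} [NormedAddCommGroup E] [InnerProductSpace ℝ E] [FiniteDimensional ℝ E]
  [MeasurableSpace E] [BorelSpace E]
  {F : Type} [NormedAddCommGroup F] [NormedSpace ℝ F]

theorem inner_eq_conv (v : E → ℝ) (κ : E → F) {s : ℝ} (hs : 0 < s) (x : E) :
    ∫ y, v (x + s • y) • κ y =
      (convolution v (fun z => (s ^ Module.finrank ℝ E)⁻¹ • κ (-(s⁻¹ • z)))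
        (ContinuousLinearMap.lsmul ℝ ℝ) volume) x := by
  unfold convolution
  have h1 := Measure.integral_comp_smul (volume : Measure E)
    (fun z => v (x + z) • κ (s⁻¹ • z)) s
  simp only [smul_smul, inv_mul_cancel₀ hs.ne', one_smul] at h1
  rw [h1, ← integral_add_left_eq_self (fun t => (ContinuousLinearMap.lsmul ℝ ℝ) (v t)
    ((s ^ Module.finrank ℝ E)⁻¹ • κ (-(s⁻¹ • (x - t))))) x, ← integral_smul]
  congr 1; ext z
  simp only [ContinuousLinearMap.lsmul_apply, sub_add_cancel_left, smul_neg, neg_neg]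
  rw [abs_of_pos (by positivity), smul_comm]

theorem inner_hasFDerivAt [CompleteSpace F] (v : E → ℝ) (hv : Measurable v) {M : ℝ} (hM : ∀ x, |v x| ≤ M)
    (κ : E → F) (hκ : ContDiff ℝ 1 κ) (hc : HasCompactSupport κ) {s : ℝ} (hs : 0 < s) (x : E) :
    HasFDerivAt (fun x => ∫ y, v (x + s • y) • κ y)
      (-s⁻¹ • ∫ y, v (x + s • y) • fderiv ℝ κ y) x := by
  have hv' : LocallyIntegrable v (volume : Measure E) := by
    refine (locallyIntegrable_const M).mono hv.aestronglyMeasurable (Eventually.of_forall fun x => ?_)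
    simpa using (hM x).trans (le_abs_self M)
  set g : E → F := fun z => (s ^ Module.finrank ℝ E)⁻¹ • κ (-(s⁻¹ • z)) with hg
  have hgc : ContDiff ℝ 1 g := by fun_prop
  have hgs : HasCompactSupport g := by
    have h2 : HasCompactSupport (fun z => κ ((-s⁻¹) • z)) :=
      hc.comp_smul (c := -s⁻¹) (by simpa using hs.ne')
    refine (h2.mono ?_)
    intro z hz
    simp only [hg, Function.mem_support] at hz ⊢
    intro h; apply hz; rw [neg_smul] at h; rw [h, smul_zero]
  have key := hgs.hasFDerivAt_convolution_right (ContinuousLinearMap.lsmul ℝ ℝ) hv' hgc x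
  have e1 : (fun x => ∫ y, v (x + s • y) • κ y) = convolution v g (ContinuousLinearMap.lsmul ℝ ℝ) volume := by
    ext x; exact inner_eq_conv v κ hs x
  rw [e1]
  convert! key using 1
  rw [inner_eq_conv v (fderiv ℝ κ) hs x]
  unfold convolution
  rw [← integral_smul]
  congr 1; ext1 z
  have hd : fderiv ℝ g (x - z) = (s ^ Module.finrank ℝ E)⁻¹ • (-s⁻¹ • fderiv ℝ κ (-(s⁻¹ • (x - z)))) := by
    have h3 : HasFDerivAt (fun z : E => -(s⁻¹ • z)) (-(s⁻¹ • ContinuousLinearMap.id ℝ E)) (x - z) :=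
      ((hasFDerivAt_id _).const_smul s⁻¹).neg
    have h4 := (((hκ.differentiable one_ne_zero) (-(s⁻¹ • (x - z)))).hasFDerivAt.comp (x - z) h3).const_smul
      ((s ^ Module.finrank ℝ E)⁻¹)
    rw [show g = fun z => (s ^ Module.finrank ℝ E)⁻¹ • κ (-(s⁻¹ • z)) from rfl]
    refine h4.fderiv.trans ?_
    ext e; simp
  ext e
  rw [hd]
  simp [ContinuousLinearMap.precompR_apply]
  simp only [smul_smul]; congr 1; ring

set_option maxHeartbeats 1000000 in
/-- Averaged kernel operator: differentiability for bounded measurable functions. -/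
theorem outer_contDiff [CompleteSpace F] (v : E → ℝ) (hv : Measurable v) {M : ℝ} (hM : ∀ x, |v x| ≤ M)
    (κ : E → F) (hκ : ContDiff ℝ 2 κ) (hc : HasCompactSupport κ) {t : ℝ} (ht : 0 < t)
    (a : ℝ → ℝ) (ha : Continuous a) {A : ℝ} (hA : ∀ r ∈ Ioo (0:ℝ) 1, |a r| ≤ A) :
    ContDiff ℝ 1 (fun x => ∫ r in Ioo (0:ℝ) 1, (r * a r) • ∫ y, v (x + (t * r) • y) • κ y) := by
  have hM0 : 0 ≤ M := (abs_nonneg _).trans (hM 0)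
  have hA0 : 0 ≤ A := (abs_nonneg _).trans (hA (1/2) (by norm_num))
  have hκ1 : ContDiff ℝ 1 κ := hκ.of_le (by norm_num)
  have hκ' : ContDiff ℝ 1 (fderiv ℝ κ) := hκ.fderiv_right (by norm_num)
  have hc' : HasCompactSupport (fderiv ℝ κ) := hc.fderiv ℝ
  -- bound and measurability in r
  have gen : ∀ {G : Type} [NormedAddCommGroup G] [NormedSpace ℝ G] [CompleteSpace G]
      (k : E → G), ContDiff ℝ 1 k → HasCompactSupport k →
      (∀ x r, ‖∫ y, v (x + (t * r) • y) • k y‖ ≤ M * ∫ y, ‖k y‖) ∧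
      (∀ x, StronglyMeasurable (fun r : ℝ => ∫ y, v (x + (t * r) • y) • k y)) := by
    intro G _ _ _ k hk hkc
    have hki : Integrable k := hk.continuous.integrable_of_hasCompactSupport hkc
    refine ⟨fun x r => ?_, fun x => ?_⟩
    · rw [← integral_const_mul]
      refine norm_integral_le_of_norm_le (hki.norm.const_mul M) (Eventually.of_forall fun y => ?_)
      rw [norm_smul]
      exact mul_le_mul_of_nonneg_right (hM _) (norm_nonneg _)
    · have : StronglyMeasurable (fun p : ℝ × E => v (x + (t * p.1) • p.2) • k p.2) := by
        refine StronglyMeasurable.smul ?_ ?_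
        · exact (hv.comp (by fun_prop)).stronglyMeasurable
        · exact hk.continuous.stronglyMeasurable.comp_measurable measurable_snd
      exact this.integral_prod_right
  obtain ⟨gb, gm⟩ := gen κ hκ1 hc
  obtain ⟨gb', gm'⟩ := gen (fderiv ℝ κ) hκ' hc'
  set I : ℝ := ∫ y, ‖κ y‖
  set I' : ℝ := ∫ y, ‖fderiv ℝ κ y‖
  have hI' : 0 ≤ I' := integral_nonneg fun _ => norm_nonneg _
  have hI : 0 ≤ I := integral_nonneg fun _ => norm_nonneg _
  let F' : E → ℝ → (E →L[ℝ] F) := fun x r => (-(t⁻¹ * a r)) • ∫ y, v (x + (t * r) • y) • fderiv ℝ κ y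
  have hF'm : ∀ x, AEStronglyMeasurable (F' x) (volume.restrict (Ioo (0:ℝ) 1)) := fun x =>
    (StronglyMeasurable.smul (f := fun r => -(t⁻¹ * a r)) (Continuous.stronglyMeasurable (by fun_prop)) (gm' x)).aestronglyMeasurable
  have hFm : ∀ x, AEStronglyMeasurable (fun r : ℝ => (r * a r) • ∫ y, v (x + (t * r) • y) • κ y)
      (volume.restrict (Ioo (0:ℝ) 1)) := fun x =>
    (StronglyMeasurable.smul (f := fun r => r * a r) (Continuous.stronglyMeasurable (by fun_prop)) (gm x)).aestronglyMeasurable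
  have hF'b : ∀ x, ∀ r ∈ Ioo (0:ℝ) 1, ‖F' x r‖ ≤ t⁻¹ * A * (M * I') := by
    intro x r hr
    rw [norm_smul, norm_neg, norm_mul, Real.norm_eq_abs, Real.norm_eq_abs, abs_of_pos (inv_pos.2 ht)]
    exact mul_le_mul (mul_le_mul_of_nonneg_left (hA r hr) (inv_pos.2 ht).le) (gb' x r)
      (norm_nonneg _) (by positivity)
  rw [contDiff_one_iff_hasFDerivAt]
  refine ⟨fun x => ∫ r in Ioo (0:ℝ) 1, F' x r, ?_, fun x => ?_⟩
  · refine continuous_of_dominated (bound := fun _ => t⁻¹ * A * (M * I')) hF'm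
      (fun x => (ae_restrict_iff' measurableSet_Ioo).2 (Eventually.of_forall (hF'b x))) ?_ ?_
    · exact integrable_const _
    · refine (ae_restrict_iff' measurableSet_Ioo).2 (Eventually.of_forall fun r hr => ?_)
      refine Continuous.const_smul (g := fun x => ∫ y, v (x + (t * r) • y) • fderiv ℝ κ y) ?_ (-(t⁻¹ * a r))
      exact continuous_iff_continuousAt.2 fun x =>
        (inner_hasFDerivAt v hv hM _ hκ' hc' (mul_pos ht hr.1) x).continuousAt
  · refine hasFDerivAt_integral_of_dominated_of_fderiv_le (s := univ) (F' := F')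
      (bound := fun _ => t⁻¹ * A * (M * I')) univ_mem
      (Eventually.of_forall hFm) ?_ (hF'm x) ?_ (integrable_const _) ?_
    · refine Integrable.mono' (g := fun _ => A * (M * I)) (integrable_const _) (hFm x) ?_
      refine (ae_restrict_iff' measurableSet_Ioo).2 (Eventually.of_forall fun r hr => ?_)
      rw [norm_smul, norm_mul, Real.norm_eq_abs, Real.norm_eq_abs]
      refine mul_le_mul ?_ (gb x r) (norm_nonneg _) hA0
      have h1 : |r| ≤ 1 := by rw [abs_of_pos hr.1]; exact hr.2.le
      calc |r| * |a r| ≤ 1 * A := mul_le_mul h1 (hA r hr) (abs_nonneg _) zero_le_one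
        _ = A := one_mul _
    · exact (ae_restrict_iff' measurableSet_Ioo).2 (Eventually.of_forall fun r hr x _ => hF'b x r hr)
    · refine (ae_restrict_iff' measurableSet_Ioo).2 (Eventually.of_forall fun r hr x _ => ?_)
      have := (inner_hasFDerivAt v hv hM _ hκ1 hc (mul_pos ht hr.1) x).const_smul (r * a r)
      convert! this using 1
      simp only [F', smul_smul]
      congr 1
      field_simp [hr.1.ne']
end Inner

set_option linter.unusedSectionVars false
set_option linter.unusedVariables false
set_option linter.style.haveILetI false

section Mk
variable {E : Type} [NormedAddCommGroup E] [InnerProductSpace ℝ E] [FiniteDimensional ℝ E]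
  [MeasurableSpace E] [BorelSpace E]

/-- base measure on `(0,1) × E` -/
def mkBase (a : ℝ → ℝ) (κ : E → ℝ) : Measure (ℝ × E) :=
  ((volume.restrict (Ioo (0:ℝ) 1)).prod volume).withDensity
    (fun p => ENNReal.ofReal (p.1 * a p.1 * κ p.2))

def mkM (a : ℝ → ℝ) (κ : E → ℝ) : Measure E :=
  Measure.map (fun p : ℝ × E => p.1 • p.2) (mkBase a κ)

structure Adm (a : ℝ → ℝ) (κ : E → ℝ) : Prop where
  ca : Continuous a
  a0 : ∀ r ∈ Ioo (0:ℝ) 1, 0 ≤ a r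
  a2 : ∀ r ∈ Ioo (0:ℝ) 1, a r ≤ 2
  cκ : ContDiff ℝ 2 κ
  κ0 : ∀ y, 0 ≤ κ y
  κs : ∀ y, 1 ≤ ‖y‖ → κ y = 0

variable {a : ℝ → ℝ} {κ : E → ℝ}

theorem Adm.comp (h : Adm a κ) : HasCompactSupport κ :=
  HasCompactSupport.intro (isCompact_closedBall (0:E) 1) (fun y hy => h.κs y (by
    simp at hy; exact hy.le))

theorem Adm.meas (h : Adm a κ) : Measurable (fun p : ℝ × E => p.1 * a p.1 * κ p.2) := by
  have := h.ca; have := h.cκ.continuous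
  exact Continuous.measurable (by fun_prop)

theorem Adm.dens_nonneg (h : Adm a κ) : ∀ᵐ p ∂((volume.restrict (Ioo (0:ℝ) 1)).prod (volume : Measure E)),
    p.1 ∈ Ioo (0:ℝ) 1 := by
  have : ∀ᵐ r ∂(volume.restrict (Ioo (0:ℝ) 1)), r ∈ Ioo (0:ℝ) 1 := ae_restrict_mem measurableSet_Ioo
  exact (Measure.quasiMeasurePreserving_fst).ae this

theorem Adm.bint (h : Adm a κ) {C : ℝ} (g : ℝ × E → ℝ) (hg : Measurable g) (hC : ∀ p, |g p| ≤ C) :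
    Integrable (fun p : ℝ × E => (p.1 * a p.1) * (g p * κ p.2))
      ((volume.restrict (Ioo (0:ℝ) 1)).prod (volume : Measure E)) := by
  have hκi : Integrable κ := h.cκ.continuous.integrable_of_hasCompactSupport h.comp
  have h1 : Integrable (fun p : ℝ × E => (2 * C) * (1 * κ p.2))
      ((volume.restrict (Ioo (0:ℝ) 1)).prod (volume : Measure E)) :=
    ((integrable_const (1:ℝ)).mul_prod hκi).const_mul _
  have hC0 : 0 ≤ C := (abs_nonneg _).trans (hC 0)
  refine h1.mono' ?_ ?_
  · have := h.ca; have := h.cκ.continuous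
    refine Measurable.aestronglyMeasurable ?_
    exact (Continuous.measurable (by fun_prop)).mul (hg.mul (Continuous.measurable (by fun_prop)))
  · filter_upwards [h.dens_nonneg] with p hp
    rw [Real.norm_eq_abs, abs_mul, abs_mul, abs_mul, abs_of_nonneg (h.κ0 _), one_mul, mul_assoc 2]
    rw [← mul_assoc]
    have h0 := h.a0 _ hp; have h2 := h.a2 _ hp
    rw [abs_of_nonneg h0, abs_of_pos hp.1]
    have : p.1 * a p.1 ≤ 2 := by nlinarith [hp.1, hp.2]
    rw [mul_assoc]
    exact mul_le_mul this (mul_le_mul_of_nonneg_right (hC _) (h.κ0 _)) (mul_nonneg (abs_nonneg _) (h.κ0 _)) (by norm_num)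

theorem Adm.integral_base (h : Adm a κ) {C : ℝ} (g : ℝ × E → ℝ) (hg : Measurable g) (hC : ∀ p, |g p| ≤ C) :
    ∫ p, g p ∂(mkBase a κ) = ∫ r in Ioo (0:ℝ) 1, (r * a r) • ∫ y, g (r, y) • κ y := by
  unfold mkBase
  rw [integral_withDensity_eq_integral_toReal_smul h.meas.ennreal_ofReal
    (Eventually.of_forall fun _ => ENNReal.ofReal_lt_top)]
  have h1 := integral_prod _ (h.bint g hg hC)
  refine Eq.trans (integral_congr_ae ?_) (h1.trans ?_)
  · filter_upwards [h.dens_nonneg] with p hp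
    rw [ENNReal.toReal_ofReal (mul_nonneg (mul_nonneg hp.1.le (h.a0 _ hp)) (h.κ0 _))]
    simp only [smul_eq_mul]; ring
  · simp only [smul_eq_mul, integral_const_mul]

theorem Adm.integral (h : Adm a κ) {C : ℝ} (g : E → ℝ) (hg : Measurable g) (hC : ∀ p, |g p| ≤ C) :
    ∫ p, g p ∂(mkM a κ) = ∫ r in Ioo (0:ℝ) 1, (r * a r) • ∫ y, g (r • y) • κ y := by
  unfold mkM
  have hm : Measurable (fun p : ℝ × E => p.1 • p.2) := by fun_prop
  rw [integral_map hm.aemeasurable hg.aestronglyMeasurable]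
  exact h.integral_base (fun p => g (p.1 • p.2)) (hg.comp hm) (fun _ => hC _)

theorem Adm.finite (h : Adm a κ) : IsFiniteMeasure (mkM a κ) := by
  unfold mkM mkBase
  have := h.bint (fun _ => 1) measurable_const (C := 1) (by simp)
  simp only [one_mul] at this
  have := isFiniteMeasure_withDensity_ofReal this.2
  infer_instance

theorem Adm.ae_base (h : Adm a κ) : ∀ᵐ p ∂(mkBase a κ), p.1 ∈ Ioo (0:ℝ) 1 ∧ ‖p.2‖ < 1 := by
  unfold mkBase
  rw [ae_withDensity_iff h.meas.ennreal_ofReal]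
  filter_upwards [h.dens_nonneg] with p hp hne
  refine ⟨hp, ?_⟩
  by_contra hcon
  apply hne
  rw [h.κs _ (not_lt.1 hcon)]; simp

theorem Adm.ae_norm (h : Adm a κ) : ∀ᵐ y ∂(mkM a κ), ‖y‖ ≤ 1 := by
  unfold mkM
  have hm : Measurable (fun p : ℝ × E => p.1 • p.2) := by fun_prop
  rw [ae_map_iff hm.aemeasurable (measurableSet_le measurable_norm measurable_const)]
  filter_upwards [h.ae_base] with p hp
  rw [norm_smul, Real.norm_eq_abs, abs_of_pos hp.1.1]
  nlinarith [hp.1.1, hp.1.2, hp.2, norm_nonneg p.2]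

theorem Adm.ac (h : Adm a κ) : mkM a κ ≪ volume := by
  refine Measure.AbsolutelyContinuous.mk fun s hs h0 => ?_
  unfold mkM
  have hm : Measurable (fun p : ℝ × E => p.1 • p.2) := by fun_prop
  rw [Measure.map_apply hm hs]
  refine withDensity_absolutelyContinuous _ _ ?_
  rw [Measure.measure_prod_null (hm hs)]
  filter_upwards [ae_restrict_mem measurableSet_Ioo] with r hr
  have : Prod.mk r ⁻¹' ((fun p : ℝ × E => p.1 • p.2) ⁻¹' s) = (fun y : E => r • y) ⁻¹' s := rfl
  rw [this, Measure.addHaar_preimage_smul _ hr.1.ne', h0]; simp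

theorem Adm.open_pos (h : Adm a κ) (ha : ∀ r ∈ Ioo (0:ℝ) 1, 0 < a r) (hk : ∀ y, ‖y‖ < 1 → 0 < κ y)
    (O : Set E) (hO : IsOpen O) (z : E) (hz : z ∈ O) (hz1 : ‖z‖ < 1) : 0 < mkM a κ O := by
  unfold mkM mkBase
  have hmc : Continuous (fun p : ℝ × E => p.1 • p.2) := by fun_prop
  have hm := hmc.measurable
  rw [Measure.map_apply hm hO.measurableSet, pos_iff_ne_zero]
  intro h0
  rw [withDensity_apply_eq_zero h.meas.ennreal_ofReal] at h0
  set S : Set (ℝ × E) := (Ioo (0:ℝ) 1 ×ˢ ball (0:E) 1) ∩ (fun p : ℝ × E => p.1 • p.2) ⁻¹' O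
  have hS : IsOpen S := (isOpen_Ioo.prod isOpen_ball).inter (hO.preimage hmc)
  have hSn : S.Nonempty := by
    obtain ⟨r, hr1, hr2⟩ := exists_between hz1
    have hr0 : 0 < r := (norm_nonneg z).trans_lt hr1
    refine ⟨(r, r⁻¹ • z), ⟨⟨⟨hr0, hr2⟩, ?_⟩, ?_⟩⟩
    · simp [norm_smul, abs_of_pos hr0]
      rw [inv_mul_lt_iff₀ hr0]; simpa using hr1
    · simp [smul_smul, hr0.ne', hz]
  have hpos : 0 < (volume.prod (volume : Measure E)) S := hS.measure_pos _ hSn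
  have h1 : ((volume.restrict (Ioo (0:ℝ) 1)).prod (volume : Measure E)) S = 0 := by
    refine measure_mono_null ?_ h0
    rintro p ⟨hp1, hp2⟩
    refine ⟨?_, hp2⟩
    simp only [mem_ofPred_eq, ne_eq, ENNReal.ofReal_eq_zero, not_le]
    exact mul_pos (mul_pos hp1.1.1 (ha _ hp1.1)) (hk _ (by simpa using hp1.2))
  have h2 : (volume.restrict (Ioo (0:ℝ) 1)).prod (volume : Measure E) = (volume.prod volume).restrict (Ioo (0:ℝ) 1 ×ˢ univ) := by
    rw [← Measure.prod_restrict, Measure.restrict_univ]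
  rw [h2, Measure.restrict_apply hS.measurableSet, inter_eq_left.2] at h1
  · exact hpos.ne' h1
  · rintro p ⟨hp1, hp2⟩; exact ⟨hp1.1, trivial⟩

theorem Adm.contDiff_avg (h : Adm a κ) (v : E → ℝ) (hv : Measurable v) {M : ℝ} (hM : ∀ x, |v x| ≤ M)
    {t : ℝ} (ht : 0 < t) : ContDiff ℝ 1 (fun x => ∫ y, v (x + t • y) ∂(mkM a κ)) := by
  have := outer_contDiff v hv hM κ h.cκ h.comp ht a h.ca (A := 2) (fun r hr => by
    rw [abs_of_nonneg (h.a0 r hr)]; exact h.a2 r hr)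
  convert! this using 2 with x
  rw [h.integral (fun y => v (x + t • y)) (hv.comp (by fun_prop)) (fun _ => hM _)]
  simp only [smul_smul]

theorem Adm.contDiff_avg2 (h : Adm a κ) (v : E → ℝ) (hv : ContDiff ℝ 1 v) (hvc : HasCompactSupport v)
    {t : ℝ} (ht : 0 < t) : ContDiff ℝ 2 (fun x => ∫ y, v (x + t • y) ∂(mkM a κ)) := by
  haveI := h.finite
  have hvcont := hv.continuous
  obtain ⟨M, hM⟩ := hvc.exists_bound_of_continuous hvcont
  have hd : Continuous (fderiv ℝ v) := hv.continuous_fderiv one_ne_zero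
  obtain ⟨M', hM'⟩ := (hvc.fderiv ℝ).exists_bound_of_continuous hd
  have key : ∀ x, HasFDerivAt (fun x => ∫ y, v (x + t • y) ∂(mkM a κ))
      (∫ y, fderiv ℝ v (x + t • y) ∂(mkM a κ)) x := by
    intro x
    refine hasFDerivAt_integral_of_dominated_of_fderiv_le (s := univ)
      (F' := fun x y => fderiv ℝ v (x + t • y))
      (bound := fun _ => M') univ_mem
      (Eventually.of_forall fun x => ?_) ?_ ?_ ?_ (integrable_const _) ?_
    · exact Continuous.aestronglyMeasurable (by fun_prop)
    · refine Integrable.mono' (g := fun _ => M) (integrable_const _) (Continuous.aestronglyMeasurable (by fun_prop)) ?_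
      exact Eventually.of_forall fun y => hM _
    · exact Continuous.aestronglyMeasurable (by fun_prop)
    · exact Eventually.of_forall fun y x _ => hM' _
    · refine Eventually.of_forall fun y x _ => ?_
      have h1 := ((hv.differentiable one_ne_zero) (x + t • y)).hasFDerivAt
      have h2 : HasFDerivAt (fun x : E => x + t • y) (ContinuousLinearMap.id ℝ E) x :=
        (hasFDerivAt_id x).add_const _
      simpa [Function.comp_def] using h1.comp x h2
  rw [show (2 : WithTop ℕ∞) = 1 + 1 from by norm_num, contDiff_succ_iff_fderiv]
  refine ⟨fun x => (key x).differentiableAt, by simp, ?_⟩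
  rw [contDiff_clm_apply_iff]
  intro e
  have : (fun x => fderiv ℝ (fun x => ∫ y, v (x + t • y) ∂(mkM a κ)) x e) =
      fun x => ∫ y, fderiv ℝ v (x + t • y) e ∂(mkM a κ) := by
    ext x
    rw [(key x).fderiv, ContinuousLinearMap.integral_apply]
    refine Integrable.mono' (g := fun _ => M') (integrable_const _) (Continuous.aestronglyMeasurable (by fun_prop)) ?_
    exact Eventually.of_forall fun y => hM' _
  rw [this]
  refine h.contDiff_avg (fun x => fderiv ℝ v x e) (Continuous.measurable (by fun_prop)) (M := M' * ‖e‖) (fun x => ?_) ht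
  exact ((fderiv ℝ v x).le_opNorm e).trans (mul_le_mul_of_nonneg_right (hM' x) (norm_nonneg _))
end Mk

abbrev En (n : ℕ) := EuclideanSpace ℝ (Fin n)

theorem lap_congr {n : ℕ} {u v : En n → ℝ} {x : En n} (h : u =ᶠ[𝓝 x] v) : lap u x = lap v x := by
  unfold lap
  refine Finset.sum_congr rfl fun i _ => ?_
  have : (fun y => fderiv ℝ u y (EuclideanSpace.single i 1)) =ᶠ[𝓝 x]
      (fun y => fderiv ℝ v y (EuclideanSpace.single i 1)) := by
    filter_upwards [h.eventuallyEq_nhds] with y hy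
    rw [hy.fderiv_eq]
  rw [this.fderiv_eq]

theorem cut_contDiff {n : ℕ} {k : WithTop ℕ∞} {φ ψ : En n → ℝ} {O : Set (En n)} (hO : IsOpen O)
    (hφ : ContDiffOn ℝ k φ O) (hψ : ContDiff ℝ k ψ) (hs : tsupport ψ ⊆ O) :
    ContDiff ℝ k (fun x => ψ x * φ x) := by
  rw [contDiff_iff_contDiffAt]
  intro x
  by_cases hx : x ∈ tsupport ψ
  · exact hψ.contDiffAt.mul (hφ.contDiffAt (hO.mem_nhds (hs hx)))
  · have : (fun x => ψ x * φ x) =ᶠ[𝓝 x] fun _ => 0 := by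
      filter_upwards [(isClosed_tsupport ψ).isOpen_compl.mem_nhds hx] with y hy
      rw [image_eq_zero_of_notMem_tsupport hy, zero_mul]
    exact contDiffAt_const.congr_of_eventuallyEq this

theorem exists_room {n : ℕ} {O : Set (En n)} (hO : IsOpen O) {x : En n} {t : ℝ} (ht : 0 ≤ t)
    (h : closedBall x t ⊆ O) : ∃ δ > 0, closedBall x (t + δ) ⊆ O := by
  obtain ⟨δ, hδ, h1⟩ := (isCompact_closedBall x t).exists_cthickening_subset_open hO h
  refine ⟨δ, hδ, ?_⟩
  rwa [cthickening_closedBall hδ.le ht, add_comm] at h1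

theorem exists_cut {n : ℕ} {O : Set (En n)} (hO : IsOpen O) {x : En n} {t : ℝ} (ht : 0 ≤ t)
    (h : closedBall x t ⊆ O) :
    ∃ ψ : En n → ℝ, ∃ t' > t, ContDiff ℝ ∞ ψ ∧ HasCompactSupport ψ ∧ tsupport ψ ⊆ O ∧
      (∀ y ∈ ball x t', ψ y = 1) ∧ ∀ y, 0 ≤ ψ y ∧ ψ y ≤ 1 := by
  obtain ⟨δ, hδ, h1⟩ := exists_room hO ht h
  let f : ContDiffBump x := ⟨t + δ/2, t + δ, by positivity, by linarith⟩
  refine ⟨f, t + δ/2, by linarith, f.contDiff, f.hasCompactSupport, ?_, fun y hy => ?_, fun y => ⟨f.nonneg, f.le_one⟩⟩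
  · rw [f.tsupport_eq]; exact h1
  · exact f.one_of_mem_closedBall (ball_subset_closedBall hy)

def gG (q : ℝ) : ℝ := (q⁻¹) ^ 2 * expNegInvGlue q

theorem gG_contDiff : ContDiff ℝ ∞ gG := by
  have := expNegInvGlue.contDiff_polynomial_eval_inv_mul (n := ⊤) (Polynomial.X ^ 2)
  have e : gG = fun x => Polynomial.eval x⁻¹ (Polynomial.X ^ 2) * expNegInvGlue x := by
    ext x; simp [gG]
  rw [e]; exact this

theorem two_le_infty : (2 : WithTop ℕ∞) ≤ ∞ := ENat.LEInfty.out

theorem N_deriv (q : ℝ) : HasDerivAt expNegInvGlue (gG q) q := by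
  have := expNegInvGlue.hasDerivAt_polynomial_eval_inv_mul 1 q
  simpa [gG] using! this

theorem gG_nonneg (q : ℝ) : 0 ≤ gG q := mul_nonneg (sq_nonneg _) (expNegInvGlue.nonneg q)

theorem gG_pos {q : ℝ} (h : 0 < q) : 0 < gG q :=
  mul_pos (by positivity) (expNegInvGlue.pos_of_pos h)

theorem N_le_gG {q : ℝ} (h : q ≤ 1) : expNegInvGlue q ≤ gG q := by
  rcases le_or_gt q 0 with h0 | h0
  · rw [expNegInvGlue.zero_of_nonpos h0]; exact gG_nonneg q
  · have : 1 ≤ q⁻¹ := (one_le_inv₀ h0).2 h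
    have h2 : 1 ≤ q⁻¹ ^ 2 := by nlinarith
    have := expNegInvGlue.nonneg q
    unfold gG; nlinarith

variable {n : ℕ}

def cN (n : ℕ) : ℝ := (∫ y : En n, gG (1 - ‖y‖ ^ 2))⁻¹
def rhoK (n : ℕ) (y : En n) : ℝ := cN n * gG (1 - ‖y‖ ^ 2)
def sigK (n : ℕ) (y : En n) : ℝ := cN n / 2 * expNegInvGlue (1 - ‖y‖ ^ 2)

theorem q_contDiff {k : WithTop ℕ∞} : ContDiff ℝ k (fun y : En n => 1 - ‖y‖ ^ 2) :=
  contDiff_const.sub (contDiff_norm_sq ℝ)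

theorem g_int : Integrable (fun y : En n => gG (1 - ‖y‖ ^ 2)) := by
  refine (gG_contDiff.continuous.comp (q_contDiff (k := 0)).continuous).integrable_of_hasCompactSupport ?_
  refine HasCompactSupport.intro (isCompact_closedBall (0:En n) 1) (fun y hy => ?_)
  simp at hy
  simp [gG, expNegInvGlue.zero_of_nonpos (show 1 - ‖y‖^2 ≤ 0 by nlinarith)]

theorem cN_pos : 0 < cN n := by
  unfold cN
  rw [inv_pos]
  refine (integral_pos_iff_support_of_nonneg (fun y => gG_nonneg _) g_int).2 ?_
  have : IsOpen (Function.support fun y : En n => gG (1 - ‖y‖ ^ 2)) :=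
    (gG_contDiff.continuous.comp (q_contDiff (k := 0)).continuous).isOpen_support
  refine this.measure_pos _ ⟨0, ?_⟩
  simp only [Function.mem_support]
  exact (gG_pos (by simp)).ne'

theorem rho_int_one : ∫ y, rhoK n y = 1 := by
  unfold rhoK
  rw [integral_const_mul]
  have := cN_pos (n := n)
  unfold cN at this ⊢
  exact inv_mul_cancel₀ (inv_pos.1 this).ne'

theorem rho_contDiff : ContDiff ℝ 2 (rhoK n) :=
  contDiff_const.mul ((gG_contDiff.of_le two_le_infty).comp q_contDiff)

theorem sig_contDiff : ContDiff ℝ 2 (sigK n) :=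
  contDiff_const.mul (expNegInvGlue.contDiff.comp q_contDiff)

theorem admA : Adm (fun _ => (2:ℝ)) (rhoK n) where
  ca := continuous_const
  a0 := fun _ _ => by norm_num
  a2 := fun _ _ => le_rfl
  cκ := rho_contDiff
  κ0 := fun y => mul_nonneg cN_pos.le (gG_nonneg _)
  κs := fun y hy => by
    simp [rhoK, gG, expNegInvGlue.zero_of_nonpos (show 1 - ‖y‖^2 ≤ 0 by nlinarith)]

theorem admB : Adm (fun r => (1:ℝ) - r ^ 2) (sigK n) where
  ca := by fun_prop
  a0 := fun r hr => by nlinarith [hr.1, hr.2]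
  a2 := fun _ _ => by nlinarith
  cκ := sig_contDiff
  κ0 := fun y => mul_nonneg (by linarith [cN_pos (n := n)]) (expNegInvGlue.nonneg _)
  κs := fun y hy => by
    simp [sigK, expNegInvGlue.zero_of_nonpos (show 1 - ‖y‖^2 ≤ 0 by nlinarith)]

theorem sig_le (y : En n) : sigK n y ≤ rhoK n y / 2 := by
  unfold sigK rhoK
  have := N_le_gG (q := 1 - ‖y‖ ^ 2) (by nlinarith [norm_nonneg y])
  have := cN_pos (n := n)
  nlinarith

theorem sig_fderiv (y e : En n) : fderiv ℝ (sigK n) y e = - (inner ℝ y e * rhoK n y) := by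
  have h1 : HasFDerivAt (fun y : En n => 1 - ‖y‖ ^ 2) (-(2 • innerSL ℝ y)) y := by
    have := ((hasStrictFDerivAt_norm_sq y).hasFDerivAt).const_sub 1
    exact this
  have h2 := ((N_deriv (1 - ‖y‖^2)).comp_hasFDerivAt y h1).const_mul (cN n / 2)
  have h3 : fderiv ℝ (sigK n) y = _ := h2.fderiv
  rw [h3]
  simp [rhoK]; ring

def kA (n : ℕ) : Measure (En n) := mkM (fun _ => (2:ℝ)) (rhoK n)
def kB (n : ℕ) : Measure (En n) := mkM (fun r => (1:ℝ) - r ^ 2) (sigK n)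

theorem kB_le_kA (s : Set (En n)) : 4 * kB n s ≤ kA n s := by
  have : (4 : ENNReal) • kB n ≤ kA n := by
    unfold kB kA mkM
    rw [← Measure.map_smul]
    refine Measure.map_mono ?_ (by fun_prop)
    unfold mkBase
    rw [← withDensity_smul _ admB.meas.ennreal_ofReal]
    refine withDensity_mono ?_
    filter_upwards [(admA (n := n)).dens_nonneg] with p hp
    simp only [Pi.smul_apply, smul_eq_mul]
    rw [show (4:ENNReal) = ENNReal.ofReal 4 by norm_num, ← ENNReal.ofReal_mul (by norm_num)]
    refine ENNReal.ofReal_le_ofReal ?_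
    have h1 := sig_le p.2
    have h2 := (admB (n := n)).κ0 p.2
    have h3 : p.1 * (1 - p.1 ^ 2) ≤ p.1 := by nlinarith [hp.1, hp.2, mul_pos hp.1 (pow_pos hp.1 2)]
    have h4 : p.1 * (1 - p.1 ^ 2) * sigK n p.2 ≤ p.1 * (rhoK n p.2 / 2) :=
      mul_le_mul h3 h1 h2 hp.1.le
    linarith
  simpa using this s

theorem A3_key (φ : En n → ℝ) (hφ : ContDiff ℝ 2 φ) (hc : HasCompactSupport φ) (x : En n) (t r : ℝ) :
    HasDerivAt (fun r : ℝ => ∫ y, φ (x + (t * r) • y) * rhoK n y)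
      (t ^ 2 * r * ∫ y, lap φ (x + (t * r) • y) * sigK n y) r := by
  have hφd : Differentiable ℝ φ := hφ.differentiable two_ne_zero
  have hdc : ContDiff ℝ 1 (fderiv ℝ φ) := hφ.fderiv_right (by norm_num)
  have hdcont : Continuous (fderiv ℝ φ) := hdc.continuous
  have hφcont : Continuous φ := hφ.continuous
  obtain ⟨M', hM'⟩ := (hc.fderiv ℝ).exists_bound_of_continuous hdcont
  have hρc : Continuous (rhoK n) := rho_contDiff.continuous
  have hσc : Continuous (sigK n) := sig_contDiff.continuous
  have hρs := (admA (n := n)).comp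
  have hσs := (admB (n := n)).comp
  have hM0 : 0 ≤ M' := (norm_nonneg _).trans (hM' 0)
  have key := (hasDerivAt_integral_of_dominated_loc_of_deriv_le (μ := (volume : Measure (En n)))
    (F := fun (r : ℝ) y => φ (x + (t * r) • y) * rhoK n y) (x₀ := r) (s := univ)
    (F' := fun (r : ℝ) y => fderiv ℝ φ (x + (t * r) • y) (t • y) * rhoK n y)
    (bound := fun y => M' * ‖t • y‖ * rhoK n y) univ_mem
    (Eventually.of_forall fun r => Continuous.aestronglyMeasurable (by fun_prop)) ?_
    (Continuous.aestronglyMeasurable (by fun_prop)) ?_ ?_ ?_).2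
  · refine key.congr_deriv ?_
    -- integration by parts
    have hp : ∀ i : Fin n, ∫ y : En n, fderiv ℝ φ (x + (t * r) • y) (EuclideanSpace.single i 1) *
        (y i * rhoK n y) = (t * r) * ∫ y : En n, fderiv ℝ (fun z => fderiv ℝ φ z (EuclideanSpace.single i 1))
          (x + (t * r) • y) (EuclideanSpace.single i 1) * sigK n y := by
      intro i
      set e : En n := EuclideanSpace.single i 1
      have hψ : ContDiff ℝ 1 (fun z => fderiv ℝ φ z e) := hdc.clm_apply contDiff_const
      have hψc : Continuous (fun z => fderiv ℝ φ z e) := hψ.continuous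
      have hψd : Continuous (fderiv ℝ (fun z => fderiv ℝ φ z e)) := hψ.continuous_fderiv one_ne_zero
      have hcomp : ∀ y, HasFDerivAt (fun y : En n => fderiv ℝ φ (x + (t * r) • y) e)
          ((t * r) • fderiv ℝ (fun z => fderiv ℝ φ z e) (x + (t * r) • y)) y := by
        intro y
        have h1 := ((hψ.differentiable one_ne_zero) (x + (t*r) • y)).hasFDerivAt
        have h2 : HasFDerivAt (fun y : En n => x + (t * r) • y) ((t * r) • ContinuousLinearMap.id ℝ (En n)) y :=
          ((hasFDerivAt_id y).const_smul (t*r)).const_add x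
        have h3 := h1.comp y h2
        refine h3.congr_fderiv ?_
        ext e; simp
      have hσd : Continuous (fderiv ℝ (sigK n)) := sig_contDiff.continuous_fderiv two_ne_zero
      have ibp := integral_mul_fderiv_eq_neg_fderiv_mul_of_integrable
        (μ := (volume : Measure (En n))) (v := e)
        (f := fun y : En n => fderiv ℝ φ (x + (t * r) • y) e) (g := sigK n) ?_ ?_ ?_
        (fun y _ => (hcomp y).differentiableAt) (fun y _ => sig_contDiff.differentiable two_ne_zero y)
      · have e1 : ∀ y : En n, fderiv ℝ φ (x + (t * r) • y) e * (y i * rhoK n y) =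
            - (fderiv ℝ φ (x + (t * r) • y) e * fderiv ℝ (sigK n) y e) := by
          intro y; rw [sig_fderiv]; simp [e, EuclideanSpace.inner_single_right]
        simp_rw [e1]
        rw [integral_neg, ibp, neg_neg, ← integral_const_mul]
        congr 1; ext y
        rw [(hcomp y).fderiv]; simp; ring
      · refine Continuous.integrable_of_hasCompactSupport ?_ hσs.mul_left
        have : (fun y => fderiv ℝ (fun y : En n => fderiv ℝ φ (x + (t * r) • y) e) y e) =
          fun y => ((t * r) • fderiv ℝ (fun z => fderiv ℝ φ z e) (x + (t * r) • y)) e := by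
          ext y; rw [(hcomp y).fderiv]
        refine Continuous.mul (this ▸ ?_) hσc
        fun_prop
      · refine Continuous.integrable_of_hasCompactSupport (by fun_prop) ?_
        exact HasCompactSupport.mul_left (hσs.fderiv_apply ℝ e)
      · exact Continuous.integrable_of_hasCompactSupport (by fun_prop) hσs.mul_left
    have e2 : ∀ y : En n, fderiv ℝ φ (x + (t * r) • y) (t • y) * rhoK n y =
        t * ∑ i, fderiv ℝ φ (x + (t * r) • y) (EuclideanSpace.single i 1) * (y i * rhoK n y) := by
      intro y
      have hy : y = ∑ i, y i • (EuclideanSpace.single i (1:ℝ) : En n) := by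
        ext j; simp [Finset.sum_apply, Pi.single_apply]
      conv_lhs => rw [map_smul]; arg 1; arg 2; arg 2; rw [hy]
      rw [map_sum, smul_eq_mul, mul_assoc, Finset.sum_mul]
      congr 1
      refine Finset.sum_congr rfl fun i _ => ?_
      rw [map_smul, smul_eq_mul]; ring
    simp_rw [e2]
    rw [integral_const_mul, integral_finsetSum, Finset.sum_congr rfl (fun i _ => hp i), ← Finset.mul_sum]
    · unfold lap
      simp_rw [Finset.sum_mul]
      rw [integral_finsetSum]
      · ring
      · intro i _
        have hψ : ContDiff ℝ 1 (fun z => fderiv ℝ φ z (EuclideanSpace.single i 1)) := hdc.clm_apply contDiff_const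
        have hψd := hψ.continuous_fderiv one_ne_zero
        exact Continuous.integrable_of_hasCompactSupport (by fun_prop) hσs.mul_left
    · intro i _
      refine Continuous.integrable_of_hasCompactSupport (by fun_prop) ?_
      exact HasCompactSupport.mul_left (HasCompactSupport.mul_left hρs)
  · exact Continuous.integrable_of_hasCompactSupport (by fun_prop) hρs.mul_left
  · refine Eventually.of_forall fun y r _ => ?_
    rw [norm_mul, Real.norm_of_nonneg (admA.κ0 y)]
    refine mul_le_mul_of_nonneg_right ?_ (admA.κ0 y)
    exact (ContinuousLinearMap.le_opNorm _ _).trans (mul_le_mul_of_nonneg_right (hM' _) (norm_nonneg _))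
  · exact Continuous.integrable_of_hasCompactSupport (by fun_prop) hρs.mul_left
  · refine Eventually.of_forall fun y r _ => ?_
    have h1 := (hφd (x + (t*r) • y)).hasFDerivAt
    have h2 : HasDerivAt (fun r : ℝ => x + (t * r) • y) (t • y) r := by
      have := (((hasDerivAt_id r).const_mul t).smul_const y).const_add x
      simpa using this
    exact (h1.comp_hasDerivAt r h2).mul_const _

theorem lap_continuous (φ : En n → ℝ) (hφ : ContDiff ℝ 2 φ) : Continuous (lap φ) := by
  unfold lap
  refine continuous_finsetSum _ fun i _ => ?_
  have hψ : ContDiff ℝ 1 (fun z => fderiv ℝ φ z (EuclideanSpace.single i 1)) :=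
    (hφ.fderiv_right (by norm_num)).clm_apply contDiff_const
  have := hψ.continuous_fderiv one_ne_zero
  fun_prop

theorem lap_bdd (φ : En n → ℝ) (hφ : ContDiff ℝ 2 φ) (hc : HasCompactSupport φ) : ∃ C, ∀ x, |lap φ x| ≤ C := by
  have : HasCompactSupport (lap φ) := by
    refine HasCompactSupport.intro hc.isCompact fun x hx => ?_
    have : φ =ᶠ[𝓝 x] fun _ => 0 := notMem_tsupport_iff_eventuallyEq.1 hx
    rw [lap_congr this]; simp [lap]
  exact this.exists_bound_of_continuous (lap_continuous φ hφ)

theorem A3_global (φ : En n → ℝ) (hφ : ContDiff ℝ 2 φ) (hc : HasCompactSupport φ) (x : En n) (t : ℝ) :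
    ∫ y, φ (x + t • y) ∂(kA n) = φ x + t ^ 2 * ∫ y, lap φ (x + t • y) ∂(kB n) := by
  have hφc := hφ.continuous
  have hl := lap_continuous φ hφ
  obtain ⟨M, hM⟩ := hc.exists_bound_of_continuous hφc
  obtain ⟨L, hL⟩ := lap_bdd φ hφ hc
  unfold kA kB
  rw [admA.integral (fun y => φ (x + t • y)) (Continuous.measurable (by fun_prop)) (fun _ => hM _),
    admB.integral (fun y => lap φ (x + t • y)) (Continuous.measurable (by fun_prop)) (fun _ => hL _)]
  simp only [smul_smul, smul_eq_mul]
  set g : ℝ → ℝ := fun r => ∫ y, φ (x + (t * r) • y) * rhoK n y with hg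
  set g' : ℝ → ℝ := fun r => t ^ 2 * r * ∫ y, lap φ (x + (t * r) • y) * sigK n y with hg'
  have hgd : ∀ r, HasDerivAt g (g' r) r := A3_key φ hφ hc x t
  have hσc : Continuous (sigK n) := sig_contDiff.continuous
  have hg'c : Continuous g' := by
    refine Continuous.mul (by fun_prop) ?_
    refine continuous_of_dominated (bound := fun y => L * sigK n y)
      (fun r => Continuous.aestronglyMeasurable (by fun_prop)) (fun r => Eventually.of_forall fun y => ?_) ?_ ?_
    · rw [norm_mul, Real.norm_of_nonneg (admB.κ0 y)]
      exact mul_le_mul_of_nonneg_right (hL _) (admB.κ0 y)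
    · exact (hσc.integrable_of_hasCompactSupport admB.comp).const_mul _
    · exact Eventually.of_forall fun y => by fun_prop
  have ibp := intervalIntegral.integral_mul_deriv_eq_deriv_mul (a := 0) (b := 1)
    (u := fun r : ℝ => 1 - r ^ 2) (u' := fun r : ℝ => -(2 * r)) (v := g) (v' := g')
    (fun r _ => by simpa using (hasDerivAt_pow 2 r).const_sub 1) (fun r _ => hgd r)
    (Continuous.intervalIntegrable (by fun_prop) _ _) (hg'c.intervalIntegrable _ _)
  have hg0 : g 0 = φ x := by simp [hg, integral_const_mul, rho_int_one]
  rw [← integral_Ioc_eq_integral_Ioo, ← integral_Ioc_eq_integral_Ioo,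
    ← intervalIntegral.integral_of_le zero_le_one, ← intervalIntegral.integral_of_le zero_le_one,
    ← intervalIntegral.integral_const_mul]
  have e1 : ∫ r in (0:ℝ)..1, t ^ 2 * (r * (1 - r ^ 2) * ∫ y, lap φ (x + (t * r) • y) * sigK n y)
      = ∫ r in (0:ℝ)..1, (1 - r ^ 2) * g' r := by
    congr 1; ext r; simp only [hg']; ring
  have e2 : ∫ r in (0:ℝ)..1, (r * 2 * ∫ y, φ (x + (t * r) • y) * rhoK n y)
      = - ∫ r in (0:ℝ)..1, -(2 * r) * g r := by
    rw [← intervalIntegral.integral_neg]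
    congr 1; ext r; simp only [hg]; ring
  rw [e1, e2, ibp, hg0]; ring

theorem A3 {φ : En n → ℝ} {O : Set (En n)} (hO : IsOpen O) (hφ : ContDiffOn ℝ 2 φ O) {x : En n} {t : ℝ}
    (ht : 0 ≤ t) (hx : closedBall x t ⊆ O) :
    ∫ y, φ (x + t • y) ∂(kA n) = φ x + t ^ 2 * ∫ y, lap φ (x + t • y) ∂(kB n) := by
  obtain ⟨ψ, t', ht', h1, h2, h3, h4, h5⟩ := exists_cut hO ht hx
  have hψ : ContDiff ℝ 2 (fun x => ψ x * φ x) := cut_contDiff hO hφ (h1.of_le two_le_infty) h3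
  have key := A3_global _ hψ h2.mul_right x t
  have hmem : ∀ y : En n, ‖y‖ ≤ 1 → x + t • y ∈ ball x t' := by
    intro y hy
    rw [mem_ball, dist_eq_norm, add_sub_cancel_left, norm_smul, Real.norm_of_nonneg ht]
    nlinarith [norm_nonneg y]
  have e1 : ∫ y, ψ (x + t • y) * φ (x + t • y) ∂(kA n) = ∫ y, φ (x + t • y) ∂(kA n) := by
    refine integral_congr_ae ?_
    filter_upwards [(admA (n := n)).ae_norm] with y hy
    rw [h4 _ (hmem y hy), one_mul]
  have e2 : ∫ y, lap (fun x => ψ x * φ x) (x + t • y) ∂(kB n) = ∫ y, lap φ (x + t • y) ∂(kB n) := by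
    refine integral_congr_ae ?_
    filter_upwards [(admB (n := n)).ae_norm] with y hy
    refine lap_congr ?_
    filter_upwards [isOpen_ball.mem_nhds (hmem y hy)] with z hz
    rw [h4 z hz, one_mul]
  rw [e1, e2] at key
  rw [key, h4 x (mem_ball_self (by linarith)), one_mul]

instance : IsFiniteMeasure (kA n) := admA.finite
instance : IsFiniteMeasure (kB n) := admB.finite

theorem kA_prob : kA n univ = 1 := by
  have h := A3 (n := n) (φ := fun _ => 1) (x := 0) (t := 1) isOpen_univ contDiffOn_const zero_le_one (subset_univ _)
  simp [lap, measureReal_def] at h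
  rw [← ENNReal.toReal_eq_one_iff]; exact h

instance : IsProbabilityMeasure (kA n) := ⟨kA_prob⟩

theorem kB_open_pos (O : Set (En n)) (hO : IsOpen O) (z : En n) (hz : z ∈ O) (hz1 : ‖z‖ < 1) : 0 < kB n O :=
  admB.open_pos (fun r hr => by nlinarith [hr.1, hr.2]) (fun y hy => mul_pos (by linarith [cN_pos (n := n)])
    (expNegInvGlue.pos_of_pos (by nlinarith [norm_nonneg y]))) O hO z hz hz1

theorem kA_open_pos (O : Set (En n)) (hO : IsOpen O) (z : En n) (hz : z ∈ O) (hz1 : ‖z‖ < 1) : 0 < kA n O :=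
  admA.open_pos (fun r hr => by norm_num) (fun y hy => mul_pos (cN_pos (n := n))
    (gG_pos (by nlinarith [norm_nonneg y]))) O hO z hz hz1

/-- total mass of `kB` -/
def BB (n : ℕ) : ℝ := (kB n).real univ

theorem BB_pos : 0 < BB n := by
  unfold BB
  have := kB_open_pos (n := n) univ isOpen_univ 0 trivial (by simp)
  exact ENNReal.toReal_pos this.ne' (measure_ne_top _ _)

theorem kA_norm : ∀ᵐ y ∂(kA n), ‖y‖ ≤ 1 := admA.ae_norm
theorem kB_norm : ∀ᵐ y ∂(kB n), ‖y‖ ≤ 1 := admB.ae_norm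
theorem kA_ac : kA n ≪ volume := admA.ac
theorem kB_ac : kB n ≪ volume := admB.ac

/-- average -/
def Av (m : Measure (En n)) (t : ℝ) (v : En n → ℝ) (x : En n) : ℝ := ∫ y, v (x + t • y) ∂m

/-- bounded measurable -/
def BM (v : En n → ℝ) : Prop := Measurable v ∧ ∃ C, ∀ x, |v x| ≤ C

theorem BM.sub {v w : En n → ℝ} (hv : BM v) (hw : BM w) : BM (fun x => v x - w x) := by
  obtain ⟨h1, C, hC⟩ := hv; obtain ⟨h2, C', hC'⟩ := hw
  exact ⟨h1.sub h2, C + C', fun x => (abs_sub _ _).trans (add_le_add (hC x) (hC' x))⟩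

theorem BM.add {v w : En n → ℝ} (hv : BM v) (hw : BM w) : BM (fun x => v x + w x) := by
  obtain ⟨h1, C, hC⟩ := hv; obtain ⟨h2, C', hC'⟩ := hw
  exact ⟨h1.add h2, C + C', fun x => (abs_add_le _ _).trans (add_le_add (hC x) (hC' x))⟩

theorem BM.const_mul {v : En n → ℝ} (hv : BM v) (c : ℝ) : BM (fun x => c * v x) := by
  obtain ⟨h1, C, hC⟩ := hv
  exact ⟨h1.const_mul c, |c| * C, fun x => by rw [abs_mul]; exact mul_le_mul_of_nonneg_left (hC x) (abs_nonneg _)⟩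

theorem BM.const (c : ℝ) : BM (fun _ : En n => c) := ⟨measurable_const, |c|, fun _ => le_rfl⟩

theorem BM.int {v : En n → ℝ} (hv : BM v) (m : Measure (En n)) [IsFiniteMeasure m] (x : En n) (t : ℝ) :
    Integrable (fun y => v (x + t • y)) m := by
  obtain ⟨h1, C, hC⟩ := hv
  exact Integrable.mono' (g := fun _ => C) (integrable_const _) (h1.comp (by fun_prop)).aestronglyMeasurable
    (Eventually.of_forall fun y => hC _)

theorem BM.av {v : En n → ℝ} (hv : BM v) (m : Measure (En n)) [IsFiniteMeasure m] (t : ℝ) : BM (Av m t v) := by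
  obtain ⟨h1, C, hC⟩ := hv
  refine ⟨?_, m.real univ * C, fun x => ?_⟩
  · have : StronglyMeasurable (fun p : En n × En n => v (p.1 + t • p.2)) :=
      (h1.comp (by fun_prop)).stronglyMeasurable
    exact this.integral_prod_right.measurable
  · have := norm_integral_le_of_norm_le_const (μ := m) (f := fun y => v (x + t • y)) (C := C)
      (Eventually.of_forall fun y => hC _)
    rw [mul_comm]; exact this

theorem av_sub {v w : En n → ℝ} (hv : BM v) (hw : BM w) (m : Measure (En n)) [IsFiniteMeasure m] (t : ℝ) (x : En n) :
    Av m t (fun x => v x - w x) x = Av m t v x - Av m t w x :=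
  integral_sub (hv.int m x t) (hw.int m x t)

theorem av_add {v w : En n → ℝ} (hv : BM v) (hw : BM w) (m : Measure (En n)) [IsFiniteMeasure m] (t : ℝ) (x : En n) :
    Av m t (fun x => v x + w x) x = Av m t v x + Av m t w x :=
  integral_add (hv.int m x t) (hw.int m x t)

theorem av_mul {v : En n → ℝ} (c : ℝ) (m : Measure (En n)) (t : ℝ) (x : En n) :
    Av m t (fun x => c * v x) x = c * Av m t v x := integral_const_mul _ _

theorem av_const (c : ℝ) (m : Measure (En n)) (t : ℝ) (x : En n) :
    Av m t (fun x => c) x = m.real univ * c := by simp [Av]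

theorem av_mono {v w : En n → ℝ} (hv : BM v) (hw : BM w) (h : ∀ x, v x ≤ w x) (m : Measure (En n)) [IsFiniteMeasure m] (t : ℝ) (x : En n) :
    Av m t v x ≤ Av m t w x :=
  integral_mono (hv.int m x t) (hw.int m x t) (fun y => h _)

theorem av_mono_ball {v w : En n → ℝ} (hv : BM v) (hw : BM w) {m : Measure (En n)} [IsFiniteMeasure m]
    (hm : ∀ᵐ y ∂m, ‖y‖ ≤ 1) {t : ℝ} (ht : 0 ≤ t) {x : En n} (h : ∀ y ∈ closedBall x t, v y ≤ w y) :
    Av m t v x ≤ Av m t w x := by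
  refine integral_mono_ae (hv.int m x t) (hw.int m x t) ?_
  filter_upwards [hm] with y hy
  refine h _ ?_
  rw [mem_closedBall, dist_eq_norm, add_sub_cancel_left, norm_smul, Real.norm_of_nonneg ht]
  nlinarith [norm_nonneg y]

theorem av_congr_ball {v w : En n → ℝ} {m : Measure (En n)}
    (hm : ∀ᵐ y ∂m, ‖y‖ ≤ 1) {t : ℝ} (ht : 0 ≤ t) {x : En n} (h : ∀ y ∈ closedBall x t, v y = w y) :
    Av m t v x = Av m t w x := by
  refine integral_congr_ae ?_
  filter_upwards [hm] with y hy
  refine h _ ?_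
  rw [mem_closedBall, dist_eq_norm, add_sub_cancel_left, norm_smul, Real.norm_of_nonneg ht]
  nlinarith [norm_nonneg y]

theorem avA_const (c t : ℝ) (x : En n) : Av (kA n) t (fun _ => c) x = c := by
  rw [av_const]; simp
theorem avB_const (c t : ℝ) (x : En n) : Av (kB n) t (fun _ => c) x = BB n * c := av_const _ _ _ _

theorem av_comm {v : En n → ℝ} (hv : BM v) (m m' : Measure (En n)) [IsFiniteMeasure m] [IsFiniteMeasure m']
    (s t : ℝ) (x : En n) : Av m s (Av m' t v) x = Av m' t (Av m s v) x := by
  unfold Av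
  obtain ⟨h1, C, hC⟩ := hv
  have := integral_integral_swap (μ := m) (ν := m') (f := fun a b => v (x + s • a + t • b)) ?_
  · rw [this]
    congr 1; ext y; congr 1; ext z; rw [add_right_comm]
  · refine Integrable.mono' (g := fun _ => C) (integrable_const _) ?_ (Eventually.of_forall fun y => hC _)
    exact (h1.comp (by fun_prop)).aestronglyMeasurable

theorem avA_ge_avB {v : En n → ℝ} (hv : BM v) (h0 : ∀ x, 0 ≤ v x) (t : ℝ) (x : En n) :
    4 * Av (kB n) t v x ≤ Av (kA n) t v x := by
  have h1 : (4 : ENNReal) • kB n ≤ kA n := by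
    refine Measure.le_iff'.2 fun s => ?_
    simpa using kB_le_kA s
  have := integral_mono_measure h1 (f := fun y => v (x + t • y)) (Eventually.of_forall fun y => h0 _) (hv.int _ x t)
  rw [integral_smul_measure] at this
  simpa [Av] using! this

theorem av_contDiff1A {v : En n → ℝ} (hv : BM v) {t : ℝ} (ht : 0 < t) : ContDiff ℝ 1 (Av (kA n) t v) := by
  obtain ⟨h1, C, hC⟩ := hv
  exact admA.contDiff_avg v h1 hC ht
theorem av_contDiff1B {v : En n → ℝ} (hv : BM v) {t : ℝ} (ht : 0 < t) : ContDiff ℝ 1 (Av (kB n) t v) := by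
  obtain ⟨h1, C, hC⟩ := hv
  exact admB.contDiff_avg v h1 hC ht
theorem av_contDiff2A {v : En n → ℝ} (hv : ContDiff ℝ 1 v) (hc : HasCompactSupport v) {t : ℝ} (ht : 0 < t) : ContDiff ℝ 2 (Av (kA n) t v) :=
  admA.contDiff_avg2 v hv hc ht
theorem av_contDiff2B {v : En n → ℝ} (hv : ContDiff ℝ 1 v) (hc : HasCompactSupport v) {t : ℝ} (ht : 0 < t) : ContDiff ℝ 2 (Av (kB n) t v) :=
  admB.contDiff_avg2 v hv hc ht

theorem lap_ridge (f f' f'' : ℝ → ℝ) (h1 : ∀ s, HasDerivAt f (f' s) s) (h2 : ∀ s, HasDerivAt f' (f'' s) s)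
    (ξ x : En n) : lap (fun x => f (inner ℝ x ξ)) x = ‖ξ‖ ^ 2 * f'' (inner ℝ x ξ) := by
  have hi : ∀ x : En n, HasFDerivAt (fun x : En n => inner ℝ x ξ) (innerSL ℝ ξ) x := by
    intro x
    have := (innerSL ℝ ξ).hasFDerivAt (x := x)
    refine this.congr_of_eventuallyEq (Eventually.of_forall fun y => ?_)
    simp [real_inner_comm]
  have e1 : ∀ y : En n, fderiv ℝ (fun x : En n => f (inner ℝ x ξ)) y = f' (inner ℝ y ξ) • innerSL ℝ ξ :=
    fun y => ((h1 _).comp_hasFDerivAt y (hi y)).fderiv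
  unfold lap
  have e2 : ∀ i : Fin n, fderiv ℝ (fun y => fderiv ℝ (fun x : En n => f (inner ℝ x ξ)) y (EuclideanSpace.single i 1)) x
     (EuclideanSpace.single i 1) = ξ i ^ 2 * f'' (inner ℝ x ξ) := by
    intro i
    simp_rw [e1]
    have := (((h2 _).comp_hasFDerivAt x (hi x)).mul_const (innerSL ℝ ξ (EuclideanSpace.single i 1))).fderiv
    simp only [_root_.smul_apply, smul_eq_mul]
    refine (congrArg (fun L => L (EuclideanSpace.single i 1)) this).trans ?_
    simp [EuclideanSpace.inner_single_right]; ring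
  rw [Finset.sum_congr rfl fun i _ => e2 i, ← Finset.sum_mul, EuclideanSpace.norm_sq_eq]
  simp

theorem charFun_rel (ξ : En n) : charFun (kA n) ξ = 1 - (‖ξ‖ ^ 2 : ℝ) * charFun (kB n) ξ := by
  have hc : ∀ (m : Measure (En n)) [IsFiniteMeasure m], charFun m ξ =
      ((∫ y, Real.cos (inner ℝ y ξ) ∂m : ℝ) : ℂ) + ((∫ y, Real.sin (inner ℝ y ξ) ∂m : ℝ) : ℂ) * Complex.I := by
    intro m _
    have b1 : Integrable (fun y : En n => Real.cos (inner ℝ y ξ)) m :=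
      Integrable.mono' (g := fun _ => 1) (integrable_const _) (Continuous.aestronglyMeasurable (by fun_prop))
        (Eventually.of_forall fun y => Real.abs_cos_le_one _)
    have b2 : Integrable (fun y : En n => Real.sin (inner ℝ y ξ)) m :=
      Integrable.mono' (g := fun _ => 1) (integrable_const _) (Continuous.aestronglyMeasurable (by fun_prop))
        (Eventually.of_forall fun y => Real.abs_sin_le_one _)
    rw [charFun_apply, ← integral_complex_ofReal, ← integral_complex_ofReal, ← integral_mul_const, ← integral_add]
    · congr 1; ext y
      rw [Complex.exp_mul_I]; push_cast; rfl
    · exact b1.ofReal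
    · exact b2.ofReal.mul_const _
  have h1 := A3 (n := n) (φ := fun x => Real.cos (inner ℝ x ξ)) (x := 0) (t := 1) isOpen_univ
    (Real.contDiff_cos.comp (contDiff_id.inner ℝ contDiff_const)).contDiffOn zero_le_one (subset_univ _)
  have h2 := A3 (n := n) (φ := fun x => Real.sin (inner ℝ x ξ)) (x := 0) (t := 1) isOpen_univ
    (Real.contDiff_sin.comp (contDiff_id.inner ℝ contDiff_const)).contDiffOn zero_le_one (subset_univ _)
  have l1 := fun x => lap_ridge Real.cos (fun s => - Real.sin s) (fun s => - Real.cos s) Real.hasDerivAt_cos (fun s => (Real.hasDerivAt_sin s).neg) ξ x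
  have l2 := fun x => lap_ridge Real.sin Real.cos (fun s => - Real.sin s) Real.hasDerivAt_sin (fun s => (Real.hasDerivAt_cos s)) ξ x
  simp only [l1, l2] at h1 h2
  simp only [mul_neg, integral_neg, integral_const_mul, zero_add, one_smul, inner_zero_left, Real.cos_zero, Real.sin_zero, one_pow, one_mul] at h1 h2
  rw [hc, hc, h1, h2]
  push_cast; ring

theorem A6 {h : En n → ℝ} (hh : BM h) (s t : ℝ) (x : En n) :
    s ^ 2 * Av (kB n) s h x + t ^ 2 * Av (kB n) t (Av (kA n) s h) x =
    t ^ 2 * Av (kB n) t h x + s ^ 2 * Av (kB n) s (Av (kA n) t h) x := by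
  obtain ⟨h1, C, hC⟩ := hh
  let D : Measure (En n) → ℝ → Measure (En n) := fun m s => m.map (fun y => s • y)
  have hm : ∀ s : ℝ, Measurable (fun y : En n => s • y) := fun s => by fun_prop
  have hcD : ∀ (m : Measure (En n)) (s : ℝ) (ξ : En n), charFun (D m s) ξ = charFun m (s • ξ) :=
    fun m s ξ => charFun_map_smul s ξ
  haveI : ∀ (m : Measure (En n)) [IsFiniteMeasure m] (s : ℝ), IsFiniteMeasure (D m s) := fun m _ s => by
    dsimp [D]; infer_instance
  let S : ℝ → ℝ → Measure (En n) := fun s t =>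
    (s ^ 2).toNNReal • D (kB n) s + (t ^ 2).toNNReal • (Measure.conv (D (kB n) t) (D (kA n) s))
  have hS : S s t = S t s := by
    refine Measure.ext_of_charFun ?_
    ext ξ
    have hadd : ∀ s t, charFun (S s t) ξ = (s ^ 2 : ℝ) * charFun (kB n) (s • ξ) +
        (t ^ 2 : ℝ) * (charFun (kB n) (t • ξ) * charFun (kA n) (s • ξ)) := by
      intro s t
      have hint : ∀ (m : Measure (En n)) [IsFiniteMeasure m], Integrable (fun x : En n => Complex.exp ((inner ℝ x ξ : ℝ) * Complex.I)) m := by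
        intro m _
        refine Integrable.mono' (g := fun _ => 1) (integrable_const _) (Continuous.aestronglyMeasurable (by fun_prop)) (Eventually.of_forall fun y => ?_)
        rw [Complex.norm_exp_ofReal_mul_I]
      rw [charFun_apply]
      rw [integral_add_measure (hint _) (hint _), integral_smul_nnreal_measure, integral_smul_nnreal_measure, ← charFun_apply, ← charFun_apply, charFun_conv, hcD, hcD, hcD]
      simp [NNReal.smul_def, Real.coe_toNNReal _ (sq_nonneg _)]
    rw [hadd, hadd, charFun_rel, charFun_rel]
    simp only [norm_smul, mul_pow]
    push_cast
    simp only [Real.norm_eq_abs, ← Complex.ofReal_pow, sq_abs]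
    ring
  have hI : ∀ s t, ∫ y, h (x + y) ∂(S s t) = s ^ 2 * Av (kB n) s h x + t ^ 2 * Av (kB n) t (Av (kA n) s h) x := by
    intro s t
    have hg : Measurable (fun y => h (x + y)) := h1.comp (by fun_prop)
    have hint : ∀ (m : Measure (En n)) [IsFiniteMeasure m], Integrable (fun y : En n => h (x + y)) m := by
      intro m _
      exact Integrable.mono' (g := fun _ => C) (integrable_const _) hg.aestronglyMeasurable (Eventually.of_forall fun y => hC _)
    rw [integral_add_measure (hint _) (hint _), integral_smul_nnreal_measure, integral_smul_nnreal_measure, integral_conv (hint _)]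
    simp only [NNReal.smul_def, Real.coe_toNNReal _ (sq_nonneg _), smul_eq_mul]
    congr 1
    · rw [integral_map (hm s).aemeasurable hg.aestronglyMeasurable]; rfl
    · congr 1
      have hm2 : StronglyMeasurable (fun b => ∫ a, h (x + (b + a)) ∂(D (kA n) s)) := by
        have : StronglyMeasurable (fun p : En n × En n => h (x + (p.1 + p.2))) :=
          (h1.comp (by fun_prop)).stronglyMeasurable
        exact this.integral_prod_right
      rw [integral_map (hm t).aemeasurable hm2.aestronglyMeasurable]
      unfold Av
      congr 1; ext b
      rw [integral_map (f := fun a => h (x + (t • b + a))) (hm s).aemeasurable (h1.comp (by fun_prop)).aestronglyMeasurable]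
      simp only [add_assoc]
  rw [← hI, ← hI, hS]

theorem BB_le : 4 * BB n ≤ 1 := by
  have := avA_ge_avB (BM.const (n := n) 1) (fun _ => zero_le_one) 1 0
  rwa [avA_const, avB_const, mul_one] at this

/-- linear operator -/
def Lop (l τ : ℝ) (z : En n → ℝ) (x : En n) : ℝ := Av (kA n) τ z x - τ ^ 2 * (l * Av (kB n) τ z x)

theorem Lop_nonneg {l τ : ℝ} (hl : 0 ≤ l) (hlt : l * τ ^ 2 ≤ 4) {z : En n → ℝ} (hz : BM z)
    (h0 : ∀ x, 0 ≤ z x) (x : En n) : 0 ≤ Lop l τ z x := by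
  unfold Lop
  have h1 := avA_ge_avB hz h0 τ x
  have h2 : 0 ≤ Av (kB n) τ z x := integral_nonneg fun y => h0 _
  nlinarith

theorem Lop_sub (l τ : ℝ) {z w : En n → ℝ} (hz : BM z) (hw : BM w) (x : En n) :
    Lop l τ (fun x => z x - w x) x = Lop l τ z x - Lop l τ w x := by
  unfold Lop
  rw [av_sub hz hw, av_sub hz hw]; ring

theorem Lop_const (l τ c : ℝ) (x : En n) : Lop l τ (fun _ => c) x = (1 - l * τ ^ 2 * BB n) * c := by
  unfold Lop
  rw [avA_const, avB_const]; ring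

theorem Lop_mono {l τ : ℝ} (hl : 0 ≤ l) (hlt : l * τ ^ 2 ≤ 4) {z w : En n → ℝ} (hz : BM z) (hw : BM w)
    (h : ∀ x, z x ≤ w x) (x : En n) : Lop l τ z x ≤ Lop l τ w x := by
  have := Lop_nonneg hl hlt (hw.sub hz) (fun x => sub_nonneg.2 (h x)) x
  rw [Lop_sub l τ hw hz] at this; linarith

theorem Lop_comparison {l τ : ℝ} (hl : 0 < l) (hτ : 0 < τ) (hlt : l * τ ^ 2 ≤ 4) {z : En n → ℝ} (hz : BM z)
    (h : ∀ x, z x ≤ Lop l τ z x) (x : En n) : z x ≤ 0 := by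
  obtain ⟨hz1, C, hC⟩ := id hz
  have hbdd : BddAbove (range z) := ⟨C, by rintro _ ⟨y, rfl⟩; exact (le_abs_self _).trans (hC y)⟩
  by_contra hx
  push Not at hx
  set s := ⨆ y, z y
  have hs : 0 < s := hx.trans_le (le_ciSup hbdd x)
  have h1 : ∀ y, z y ≤ (1 - l * τ ^ 2 * BB n) * s := fun y => by
    refine (h y).trans ?_
    rw [← Lop_const l τ s y]
    exact Lop_mono hl.le hlt hz (BM.const s) (fun y => le_ciSup hbdd y) y
  have h2 : s ≤ (1 - l * τ ^ 2 * BB n) * s := ciSup_le h1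
  have h3 : 0 < l * τ ^ 2 * BB n := by have := BB_pos (n := n); positivity
  nlinarith

theorem BM.of_bcf (f : BoundedContinuousFunction (En n) ℝ) : BM f :=
  ⟨f.continuous.measurable, ‖f‖, fun x => f.norm_coe_le_norm x⟩

theorem resolv_exists {l : ℝ} (hl : 0 < l) {g : En n → ℝ} (hg : BM g) :
    ∃ w : En n → ℝ, BM w ∧ Continuous w ∧ ∀ τ > 0, ∀ x,
      w x = Lop l τ w x + τ ^ 2 * Av (kB n) τ g x := by
  obtain ⟨τ0, hτ0, hlt⟩ : ∃ τ0 : ℝ, 0 < τ0 ∧ l * τ0 ^ 2 ≤ 4 := by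
    refine ⟨Real.sqrt (4 / l), Real.sqrt_pos.2 (by positivity), ?_⟩
    rw [Real.sq_sqrt (by positivity)]; field_simp; rfl
  let P : ℝ → (En n → ℝ) → En n → ℝ := fun τ w x => Lop l τ w x + τ ^ 2 * Av (kB n) τ g x
  have PBM : ∀ τ w, BM w → BM (P τ w) := fun τ w hw =>
    (((hw.av (kA n) τ)).sub (((hw.av (kB n) τ).const_mul l).const_mul (τ^2))).add ((hg.av (kB n) τ).const_mul _)
  have Pc : ∀ τ w, 0 < τ → BM w → Continuous (P τ w) := fun τ w hτ hw => by
    have h1 := (av_contDiff1A hw hτ).continuous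
    have h2 := (av_contDiff1B hw hτ).continuous
    have h3 := (av_contDiff1B hg hτ).continuous
    simp only [P, Lop]; fun_prop
  let Q : BoundedContinuousFunction (En n) ℝ → BoundedContinuousFunction (En n) ℝ := fun f =>
    BoundedContinuousFunction.ofNormedAddCommGroup (P τ0 f) (Pc τ0 f hτ0 (BM.of_bcf f))
      (PBM τ0 f (BM.of_bcf f)).2.choose (PBM τ0 f (BM.of_bcf f)).2.choose_spec
  set K : ℝ := 1 - l * τ0 ^ 2 * BB n with hK
  have hB := BB_pos (n := n)
  have hB4 := BB_le (n := n)
  have hK0 : 0 ≤ K := by rw [hK]; nlinarith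
  have hK1 : K < 1 := by
    have : 0 < l * τ0 ^ 2 * BB n := by positivity
    rw [hK]; linarith
  have hQ : ContractingWith (NNReal.mk K hK0) Q := by
    refine ⟨by exact_mod_cast hK1, LipschitzWith.of_dist_le_mul fun f f' => ?_⟩
    refine (BoundedContinuousFunction.dist_le (C := K * dist f f') (mul_nonneg hK0 dist_nonneg)).2 ?_
    intro x
    have e : dist (Q f x) (Q f' x) = |Lop l τ0 (fun x => f x - f' x) x| := by
      rw [Lop_sub l τ0 (BM.of_bcf f) (BM.of_bcf f'), Real.dist_eq]
      change |P τ0 f x - P τ0 f' x| = _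
      simp only [P]; congr 1; ring
    rw [e, abs_le]
    have hd : ∀ y, |f y - f' y| ≤ dist f f' := fun y => by
      rw [← Real.dist_eq]; exact BoundedContinuousFunction.dist_coe_le_dist (f := f) (g := f') y
    have hbm := (BM.of_bcf f).sub (BM.of_bcf f')
    constructor
    · have := Lop_mono hl.le hlt (BM.const (n := n) (-dist f f')) hbm (fun y => (abs_le.1 (hd y)).1) x
      rw [Lop_const] at this
      linarith
    · have := Lop_mono hl.le hlt hbm (BM.const (n := n) (dist f f')) (fun y => (abs_le.1 (hd y)).2) x
      rw [Lop_const] at this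
      exact this
  set w := hQ.fixedPoint Q
  have hw : ∀ x, P τ0 w x = w x := fun x => by
    have h1 : Q w = w := hQ.fixedPoint_isFixedPt
    exact congrArg (fun f : BoundedContinuousFunction (En n) ℝ => f x) h1
  have hwb : BM w := BM.of_bcf w
  have hwe : P τ0 w = w := funext hw
  refine ⟨w, hwb, w.continuous, fun τ hτ => ?_⟩
  set z := P τ w with hz
  have hzb : BM z := PBM τ w hwb
  -- commutation
  have hfix : ∀ x, z x = P τ0 z x := by
    intro x
    have expand : ∀ s t x, P t (P s w) x =
       Av (kA n) t (Av (kA n) s w) x - s^2 * (l * Av (kA n) t (Av (kB n) s w) x) + s^2 * Av (kA n) t (Av (kB n) s g) x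
       - t ^ 2 * (l * (Av (kB n) t (Av (kA n) s w) x - s^2 * (l * Av (kB n) t (Av (kB n) s w) x) + s^2 * Av (kB n) t (Av (kB n) s g) x))
       + t ^ 2 * Av (kB n) t g x := by
      intro s t x
      have b1 : BM (fun x => Av (kA n) s w x - s^2 * (l * Av (kB n) s w x)) :=
        (hwb.av _ s).sub (((hwb.av _ s).const_mul l).const_mul (s^2))
      have b2 : BM (fun x => s^2 * Av (kB n) s g x) := (hg.av _ s).const_mul _
      have b3 : BM (fun x => s^2 * (l * Av (kB n) s w x)) := ((hwb.av _ s).const_mul l).const_mul (s^2)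
      have q : ∀ (m : Measure (En n)) [IsFiniteMeasure m], Av m t (P s w) x = Av m t (Av (kA n) s w) x - s^2 * (l * Av m t (Av (kB n) s w) x) + s^2 * Av m t (Av (kB n) s g) x := by
        intro m _
        refine (av_add b1 b2 m t x).trans ?_
        rw [av_sub (hwb.av _ s) b3, av_mul, av_mul, av_mul]
      change Av (kA n) t (P s w) x - t ^ 2 * (l * Av (kB n) t (P s w) x) + t ^ 2 * Av (kB n) t g x = _
      rw [q, q]
    have h1 := expand τ τ0 x
    have h2 := expand τ0 τ x
    rw [hwe] at h2
    rw [h1]; refine h2.trans ?_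
    have c1 := av_comm hwb (kA n) (kA n) τ τ0 x
    have c2 := av_comm hwb (kA n) (kB n) τ τ0 x
    have c3 := av_comm hwb (kB n) (kA n) τ τ0 x
    have c4 := av_comm hwb (kB n) (kB n) τ τ0 x
    have c5 := av_comm hg (kB n) (kB n) τ τ0 x
    have c6 := av_comm hg (kA n) (kB n) τ τ0 x
    have c7 := av_comm hg (kA n) (kB n) τ0 τ x
    have c8 := A6 hg τ τ0 x
    rw [c1, c2, c3, c4, c5, c6, c7]
    linear_combination c8
  have cmp : ∀ x, z x = w x := by
    intro x
    have h1 := Lop_comparison hl hτ0 hlt (hzb.sub hwb) (fun y => by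
      rw [Lop_sub l τ0 hzb hwb]
      have a := hfix y; have b := hw y
      simp only [P] at a b; linarith) x
    have h2 := Lop_comparison hl hτ0 hlt (hwb.sub hzb) (fun y => by
      rw [Lop_sub l τ0 hwb hzb]
      have a := hfix y; have b := hw y
      simp only [P] at a b; linarith) x
    linarith
  intro x
  exact (cmp x).symm

structure Nonl (F : En n → ℝ → ℝ) (M l : ℝ) : Prop where
  meas : Measurable (Function.uncurry F)
  M0 : 0 ≤ M
  l0 : 0 < l
  mono : ∀ x, ∀ s ∈ Icc 0 M, ∀ s' ∈ Icc 0 M, s ≤ s' → F x s' - F x s ≤ l * (s' - s)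
  bdd : ∃ K, ∀ x, ∀ s ∈ Icc 0 M, |F x s| ≤ K
  zero : ∀ x, F x 0 ≤ 0
  top : ∀ x, 0 ≤ F x M

/-- nonlinear averaging operator -/
def TT (F : En n → ℝ → ℝ) (τ : ℝ) (v : En n → ℝ) (x : En n) : ℝ :=
  Av (kA n) τ v x - τ ^ 2 * Av (kB n) τ (fun y => F y (v y)) x

structure IsSub (F : En n → ℝ → ℝ) (M τ : ℝ) (v : En n → ℝ) : Prop where
  lsc : LowerSemicontinuous v
  mem : ∀ x, v x ∈ Icc 0 M
  le : ∀ x, v x ≤ TT F τ v x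

theorem BM.of_Icc {v : En n → ℝ} {M : ℝ} (h : Measurable v) (h2 : ∀ x, v x ∈ Icc 0 M) : BM v :=
  ⟨h, M, fun x => by rw [abs_of_nonneg (h2 x).1]; exact (h2 x).2⟩

theorem Nonl.BM {F : En n → ℝ → ℝ} {M l : ℝ} (hF : Nonl F M l) {v : En n → ℝ} (h : Measurable v)
    (h2 : ∀ x, v x ∈ Icc 0 M) : BM (fun y => F y (v y)) := by
  obtain ⟨K, hK⟩ := hF.bdd
  exact ⟨hF.meas.comp (measurable_id.prodMk h), K, fun x => hK x _ (h2 x)⟩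

theorem TT_mono {F : En n → ℝ → ℝ} {M l τ : ℝ} (hF : Nonl F M l) (hlt : l * τ ^ 2 ≤ 4) {v w : En n → ℝ}
    (hv : Measurable v) (hw : Measurable w) (hvM : ∀ x, v x ∈ Icc 0 M) (hwM : ∀ x, w x ∈ Icc 0 M)
    (h : ∀ x, v x ≤ w x) (x : En n) : TT F τ v x ≤ TT F τ w x := by
  have bv := BM.of_Icc hv hvM
  have bw := BM.of_Icc hw hwM
  have bFv := hF.BM hv hvM
  have bFw := hF.BM hw hwM
  have h1 := Lop_nonneg hF.l0.le hlt (bw.sub bv) (fun x => sub_nonneg.2 (h x)) x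
  rw [Lop_sub l τ bw bv] at h1
  have h2 := av_mono (bFw.sub bFv) ((bw.sub bv).const_mul l) (fun x => hF.mono x _ (hvM x) _ (hwM x) (h x)) (kB n) τ x
  rw [av_sub bFw bFv, av_mul, av_sub bw bv] at h2
  unfold Lop at h1; unfold TT
  nlinarith [sq_nonneg τ, mul_le_mul_of_nonneg_left h2 (sq_nonneg τ)]

theorem solve_max {F : En n → ℝ → ℝ} {M l τ : ℝ} (hF : Nonl F M l) (hτ : 0 < τ) (hlt : l * τ ^ 2 ≤ 4) :
    ∃ u : En n → ℝ, Continuous u ∧ (∀ x, u x ∈ Icc 0 M) ∧ (∀ t > 0, ∀ x, u x = TT F t u x) ∧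
      ∀ v, IsSub F M τ v → ∀ x, v x ≤ u x := by
  let S := {v : En n → ℝ // IsSub F M τ v}
  have h0 : IsSub F M τ (fun _ => 0) := by
    refine ⟨lowerSemicontinuous_const, fun x => ⟨le_rfl, hF.M0⟩, fun x => ?_⟩
    unfold TT
    rw [avA_const]
    have := av_mono (hF.BM measurable_const (fun x => ⟨le_rfl, hF.M0⟩)) (BM.const 0) (fun x => hF.zero x) (kB n) τ x
    rw [avB_const] at this
    nlinarith [sq_nonneg τ, mul_le_mul_of_nonneg_left this (sq_nonneg τ)]
  haveI : Nonempty S := ⟨⟨_, h0⟩⟩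
  have hbdd : ∀ x, BddAbove (range fun v : S => v.1 x) := fun x => ⟨M, by rintro _ ⟨v, rfl⟩; exact (v.2.mem x).2⟩
  set u : En n → ℝ := fun x => ⨆ v : S, v.1 x
  have hle : ∀ v : S, ∀ x, v.1 x ≤ u x := fun v x => le_ciSup (hbdd x) v
  have hlsc : LowerSemicontinuous u := lowerSemicontinuous_ciSup hbdd (fun v => v.2.lsc)
  have hum : Measurable u := hlsc.measurable
  have huM : ∀ x, u x ∈ Icc 0 M := fun x => ⟨hle ⟨_, h0⟩ x, ciSup_le fun v => (v.2.mem x).2⟩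
  have hsub : ∀ x, u x ≤ TT F τ u x := fun x => ciSup_le fun v =>
    (v.2.le x).trans (TT_mono hF hlt v.2.lsc.measurable hum v.2.mem huM (hle v) x)
  have bu := BM.of_Icc hum huM
  have bFu := hF.BM hum huM
  have bg : BM (fun x => l * u x - F x (u x)) := (bu.const_mul l).sub bFu
  obtain ⟨w, hwb, hwc, hw⟩ := resolv_exists hF.l0 bg
  have hav : ∀ t x, Av (kB n) t (fun x => l * u x - F x (u x)) x = l * Av (kB n) t u x - Av (kB n) t (fun x => F x (u x)) x := by
    intro t x
    rw [av_sub (bu.const_mul l) bFu, av_mul]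
  have huw : ∀ x, u x ≤ w x := by
    intro x
    have := Lop_comparison hF.l0 hτ hlt (bu.sub hwb) (fun y => by
      rw [Lop_sub l τ bu hwb]
      have a := hsub y; have b := hw τ hτ y
      rw [hav] at b
      unfold TT at a; unfold Lop at b ⊢; nlinarith) x
    linarith
  have hwM : ∀ x, w x ≤ M := by
    intro x
    have := Lop_comparison hF.l0 hτ hlt (hwb.sub (BM.const M)) (fun y => by
      rw [Lop_sub l τ hwb (BM.const M)]
      have b := hw τ hτ y
      have h1 := av_mono bg (BM.const (l * M)) (fun z => by
        have := hF.mono z _ (huM z) M ⟨hF.M0, le_rfl⟩ (huM z).2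
        have := hF.top z
        linarith) (kB n) τ y
      rw [avB_const] at h1
      rw [Lop_const]
      nlinarith [mul_le_mul_of_nonneg_left h1 (sq_nonneg τ)]) x
    linarith
  have hwI : ∀ x, w x ∈ Icc 0 M := fun x => ⟨(huM x).1.trans (huw x), hwM x⟩
  have hwS : IsSub F M τ w := by
    refine ⟨hwc.lowerSemicontinuous, hwI, fun x => ?_⟩
    have b := hw τ hτ x
    have bFw := hF.BM hwc.measurable hwI
    have h1 := av_mono (bFw.sub bFu) ((hwb.sub bu).const_mul l) (fun x => hF.mono x _ (huM x) _ (hwI x) (huw x)) (kB n) τ x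
    rw [av_sub bFw bFu, av_mul, av_sub hwb bu] at h1
    rw [hav] at b
    unfold Lop at b; unfold TT
    nlinarith [mul_le_mul_of_nonneg_left h1 (sq_nonneg τ)]
  have hwu : w = u := funext fun x => le_antisymm (hle ⟨w, hwS⟩ x) (huw x)
  refine ⟨u, hwu ▸ hwc, huM, fun t ht x => ?_, fun v hv x => hle ⟨v, hv⟩ x⟩
  have b := hw t ht x
  rw [hav, hwu] at b
  unfold Lop at b; unfold TT
  rw [b]; ring_nf

theorem avB_ge_of_eventually {G : En n → ℝ} (hG : BM G) {x : En n} {c : ℝ} (h : ∀ᶠ y in 𝓝 x, c ≤ G y) :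
    ∀ᶠ t in 𝓝[>] (0:ℝ), BB n * c ≤ Av (kB n) t G x := by
  obtain ⟨δ, hδ, hb⟩ := Metric.eventually_nhds_iff_ball.1 h
  filter_upwards [Ioo_mem_nhdsGT hδ] with t ht
  rw [← avB_const c t x]
  refine av_mono_ball (BM.const c) hG kB_norm ht.1.le fun y hy => hb y ?_
  exact closedBall_subset_ball ht.2 hy

theorem avB_le_of_eventually {G : En n → ℝ} (hG : BM G) {x : En n} {c : ℝ} (h : ∀ᶠ y in 𝓝 x, G y ≤ c) :
    ∀ᶠ t in 𝓝[>] (0:ℝ), Av (kB n) t G x ≤ BB n * c := by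
  obtain ⟨δ, hδ, hb⟩ := Metric.eventually_nhds_iff_ball.1 h
  filter_upwards [Ioo_mem_nhdsGT hδ] with t ht
  rw [← avB_const c t x]
  refine av_mono_ball hG (BM.const c) kB_norm ht.1.le fun y hy => hb y ?_
  exact closedBall_subset_ball ht.2 hy

theorem avB_tendsto {G : En n → ℝ} (hG : BM G) {x : En n} (h : ContinuousAt G x) :
    Tendsto (fun t => Av (kB n) t G x) (𝓝[>] (0:ℝ)) (𝓝 (BB n * G x)) := by
  have hB := BB_pos (n := n)
  rw [tendsto_order]
  constructor
  · intro a ha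
    have h1 : a / BB n < G x := by rw [div_lt_iff₀ hB]; linarith
    obtain ⟨c, hc1, hc2⟩ := exists_between h1
    filter_upwards [avB_ge_of_eventually hG ((h.eventually (lt_mem_nhds hc2)).mono fun _ => le_of_lt)] with t ht
    rw [div_lt_iff₀ hB] at hc1; linarith
  · intro a ha
    have h1 : G x < a / BB n := by rw [lt_div_iff₀ hB]; linarith
    obtain ⟨c, hc1, hc2⟩ := exists_between h1
    filter_upwards [avB_le_of_eventually hG ((h.eventually (gt_mem_nhds hc1)).mono fun _ => le_of_lt)] with t ht
    rw [lt_div_iff₀ hB] at hc2; linarith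

theorem closedBall_sub_two {x0 x : En n} {t : ℝ} (h : x ∈ ball x0 t) : closedBall x t ⊆ closedBall x0 (2 * t) := by
  intro y hy
  rw [mem_closedBall] at *
  have := dist_triangle y x x0
  rw [mem_ball] at h; linarith

theorem BM.comp_cont {f : ℝ → ℝ} (hf : Continuous f) {u : En n → ℝ} {M : ℝ} (hu : Measurable u)
    (huM : ∀ x, u x ∈ Icc 0 M) : BM (fun x => f (u x)) := by
  obtain ⟨C, hC⟩ := (isCompact_Icc (a := (0:ℝ)) (b := M)).exists_bound_of_continuousOn hf.continuousOn
  exact ⟨hf.measurable.comp hu, C, fun x => hC _ (huM x)⟩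

theorem exists_small_ball {Ω : Set (En n)} (hΩ : IsOpen Ω) {x : En n} (hx : x ∈ Ω) :
    ∃ t > 0, closedBall x (2 * t) ⊆ Ω := by
  obtain ⟨δ, hδ, h⟩ := Metric.isOpen_iff.1 hΩ x hx
  exact ⟨δ / 4, by positivity, (closedBall_subset_ball (by linarith)).trans h⟩

theorem regularity {f : ℝ → ℝ} (hf : ContDiff ℝ 1 f) {u : En n → ℝ} {M : ℝ} (hu : Measurable u)
    (huM : ∀ x, u x ∈ Icc 0 M) {Ω : Set (En n)} (hΩ : IsOpen Ω)
    (h : ∀ x, ∀ t > 0, closedBall x t ⊆ Ω → u x = Av (kA n) t u x - t ^ 2 * Av (kB n) t (fun y => f (u y)) x) :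
    ContDiffOn ℝ 2 u Ω ∧ ∀ x ∈ Ω, lap u x = f (u x) := by
  have bu := BM.of_Icc hu huM
  have bf := BM.comp_cont hf.continuous hu huM
  have h1 : ContDiffOn ℝ 1 u Ω := by
    intro x0 hx0
    obtain ⟨t, ht, hb⟩ := exists_small_ball hΩ hx0
    refine ContDiffAt.contDiffWithinAt ?_
    have : ContDiff ℝ 1 (fun x => Av (kA n) t u x - t ^ 2 * Av (kB n) t (fun y => f (u y)) x) :=
      (av_contDiff1A bu ht).sub (contDiff_const.mul (av_contDiff1B bf ht))
    refine this.contDiffAt.congr_of_eventuallyEq ?_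
    filter_upwards [ball_mem_nhds x0 ht] with x hx
    exact h x t ht ((closedBall_sub_two hx).trans hb)
  have h2 : ContDiffOn ℝ 2 u Ω := by
    intro x0 hx0
    obtain ⟨t, ht, hb⟩ := exists_small_ball hΩ hx0
    refine ContDiffAt.contDiffWithinAt ?_
    obtain ⟨ψ, t', ht', c1, c2, c3, c4, c5⟩ := exists_cut hΩ (by positivity) hb
    have d1 : ContDiff ℝ 1 (fun x => ψ x * u x) := cut_contDiff hΩ h1 (c1.of_le (by simp)) c3
    have d2 : ContDiff ℝ 1 (fun x => ψ x * f (u x)) := cut_contDiff hΩ (hf.comp_contDiffOn h1) (c1.of_le (by simp)) c3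
    have : ContDiff ℝ 2 (fun x => Av (kA n) t (fun x => ψ x * u x) x - t ^ 2 * Av (kB n) t (fun y => ψ y * f (u y)) x) :=
      (av_contDiff2A d1 c2.mul_right ht).sub (contDiff_const.mul (av_contDiff2B d2 c2.mul_right ht))
    refine this.contDiffAt.congr_of_eventuallyEq ?_
    filter_upwards [ball_mem_nhds x0 ht] with x hx
    have hs := closedBall_sub_two hx
    rw [h x t ht (hs.trans hb)]
    have e1 : ∀ y ∈ closedBall x t, ψ y = 1 := fun y hy => c4 y (closedBall_subset_ball ht' (hs hy))
    rw [av_congr_ball kA_norm ht.le (w := fun x => ψ x * u x) (fun y hy => by rw [e1 y hy, one_mul]),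
      av_congr_ball kB_norm ht.le (w := fun x => ψ x * f (u x)) (fun y hy => by rw [e1 y hy, one_mul])]
  refine ⟨h2, fun x0 hx0 => ?_⟩
  obtain ⟨t, ht, hb⟩ := exists_small_ball hΩ hx0
  obtain ⟨ψ, t', ht', c1, c2, c3, c4, c5⟩ := exists_cut hΩ (by positivity) hb
  have d1 : ContDiff ℝ 2 (fun x => ψ x * u x) := cut_contDiff hΩ h2 (c1.of_le two_le_infty) c3
  have d2 : ContDiff ℝ 1 (fun x => ψ x * f (u x)) := cut_contDiff hΩ (hf.comp_contDiffOn h1) (c1.of_le (by simp)) c3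
  have lb : BM (lap (fun x => ψ x * u x)) := ⟨(lap_continuous _ d1).measurable, lap_bdd _ d1 c2.mul_right⟩
  have fb : BM (fun x => ψ x * f (u x)) :=
    ⟨d2.continuous.measurable, (HasCompactSupport.mul_right c2).exists_bound_of_continuous d2.continuous⟩
  have hG := lb.sub fb
  have hGc : ContinuousAt (fun x => lap (fun x => ψ x * u x) x - ψ x * f (u x)) x0 :=
    ((lap_continuous _ d1).sub d2.continuous).continuousAt
  have hT := avB_tendsto hG hGc
  have e0 : ∀ y ∈ ball x0 t', ψ y = 1 := c4
  have hz : ∀ᶠ s in 𝓝[>] (0:ℝ), Av (kB n) s (fun x => lap (fun x => ψ x * u x) x - ψ x * f (u x)) x0 = 0 := by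
    filter_upwards [Ioo_mem_nhdsGT (show 0 < 2 * t by positivity)] with s hs
    have hsb : closedBall x0 s ⊆ closedBall x0 (2*t) := closedBall_subset_closedBall hs.2.le
    have k1 := A3_global _ d1 c2.mul_right x0 s
    change Av (kA n) s (fun x => ψ x * u x) x0 = _ + _ * Av (kB n) s (lap fun x => ψ x * u x) x0 at k1
    have k2 := h x0 s hs.1 (hsb.trans hb)
    have e1 : ∀ y ∈ closedBall x0 s, ψ y = 1 := fun y hy => c4 y (closedBall_subset_ball ht' (hsb hy))
    rw [av_congr_ball kA_norm hs.1.le (w := fun x => ψ x * u x) (fun y hy => by rw [e1 y hy, one_mul]),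
      av_congr_ball kB_norm hs.1.le (w := fun x => ψ x * f (u x)) (fun y hy => by rw [e1 y hy, one_mul])] at k2
    rw [av_sub lb fb]
    rw [c4 x0 (mem_ball_self (by linarith)), one_mul] at k1
    have hs2 : 0 < s ^ 2 := by have := hs.1; positivity
    have : s ^ 2 * (Av (kB n) s (lap fun x => ψ x * u x) x0 - Av (kB n) s (fun x => ψ x * f (u x)) x0) = 0 := by linarith
    exact (mul_eq_zero.1 this).resolve_left hs2.ne'
  have h3 := tendsto_nhds_unique hT ((tendsto_congr' hz).2 tendsto_const_nhds)
  have h4 : lap (fun x => ψ x * u x) x0 - ψ x0 * f (u x0) = 0 := (mul_eq_zero.1 h3).resolve_left BB_pos.ne'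
  have h5 : lap (fun x => ψ x * u x) x0 = lap u x0 := by
    refine lap_congr ?_
    filter_upwards [isOpen_ball.mem_nhds (mem_ball_self (show 0 < t' by linarith))] with z hz
    rw [c4 z hz, one_mul]
  rw [h5, c4 x0 (mem_ball_self (by linarith)), one_mul] at h4
  linarith

open Classical in
/-- penalized nonlinearity -/
def Fk (f : ℝ → ℝ) (Ω : Set (En n)) (k : ℕ) (x : En n) (s : ℝ) : ℝ := f s + (if x ∈ Ω then 0 else k * s)

structure Fam (f : ℝ → ℝ) (M l : ℝ) (Ω : Set (En n)) (U : ℕ → En n → ℝ) (u : En n → ℝ) : Prop where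
  cont : ∀ k, Continuous (U k)
  mem : ∀ k x, U k x ∈ Icc 0 M
  eq : ∀ k, ∀ t > 0, ∀ x, U k x = TT (Fk f Ω k) t (U k) x
  max : ∀ k v, LowerSemicontinuous v → (∀ x, v x ∈ Icc 0 M) → (∀ t > 0, ∀ x, v x ≤ TT (Fk f Ω k) t v x) →
    ∀ x, v x ≤ U k x
  meas : Measurable u
  memu : ∀ x, u x ∈ Icc 0 M
  le : ∀ k x, u x ≤ U k x
  tend : ∀ x, Tendsto (fun k => U k x) atTop (𝓝 (u x))

theorem Fk_nonl {f : ℝ → ℝ} (hf : Continuous f) {M l : ℝ} (hM : 0 < M) (hl : 0 < l)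
    (hL : ∀ s ∈ Icc 0 M, ∀ s' ∈ Icc 0 M, |f s - f s'| ≤ l * |s - s'|) (f0 : f 0 ≤ 0) (fM : f M = 0)
    {Ω : Set (En n)} (hΩ : IsOpen Ω) (k : ℕ) : Nonl (Fk f Ω k) M (l + k) := by
  classical
  obtain ⟨C, hC⟩ := (isCompact_Icc (a := (0:ℝ)) (b := M)).exists_bound_of_continuousOn hf.continuousOn
  refine ⟨?_, hM.le, by positivity, ?_, ⟨C + k * M, ?_⟩, ?_, ?_⟩
  · unfold Function.uncurry Fk
    refine (hf.measurable.comp measurable_snd).add ?_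
    refine Measurable.ite (hΩ.measurableSet.preimage measurable_fst) measurable_const ?_
    exact measurable_snd.const_mul _
  · intro x s hs s' hs' h
    have h1 := (abs_le.1 (hL s' hs' s hs)).2
    rw [abs_of_nonneg (sub_nonneg.2 h)] at h1
    have h2 : 0 ≤ (k:ℝ) * (s' - s) := mul_nonneg (Nat.cast_nonneg k) (sub_nonneg.2 h)
    unfold Fk; split_ifs <;> nlinarith
  · intro x s hs
    have h1 := hC s hs
    rw [Real.norm_eq_abs] at h1
    have h2 : (k:ℝ) * s ≤ k * M := mul_le_mul_of_nonneg_left hs.2 (Nat.cast_nonneg k)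
    have h3 : 0 ≤ (k:ℝ) * s := mul_nonneg (Nat.cast_nonneg k) hs.1
    rw [abs_le] at h1 ⊢
    unfold Fk; split_ifs <;> constructor <;> linarith [h1.1, h1.2]
  · intro x; unfold Fk; split_ifs <;> simpa using f0
  · intro x; unfold Fk; rw [fM]
    have : 0 ≤ (k:ℝ) * M := by positivity
    split_ifs <;> simp [this]

theorem exists_fam {f : ℝ → ℝ} (hf : Continuous f) {M l : ℝ} (hM : 0 < M) (hl : 0 < l)
    (hL : ∀ s ∈ Icc 0 M, ∀ s' ∈ Icc 0 M, |f s - f s'| ≤ l * |s - s'|) (f0 : f 0 ≤ 0) (fM : f M = 0)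
    {Ω : Set (En n)} (hΩ : IsOpen Ω) : ∃ U u, Fam f M l Ω U u := by
  have key : ∀ k : ℕ, ∃ τ > 0, ∃ u : En n → ℝ, Continuous u ∧ (∀ x, u x ∈ Icc 0 M) ∧ (∀ t > 0, ∀ x, u x = TT (Fk f Ω k) t u x) ∧
      ∀ v, IsSub (Fk f Ω k) M τ v → ∀ x, v x ≤ u x := by
    intro k
    have hlk : 0 < l + k := by positivity
    refine ⟨Real.sqrt (4 / (l + k)), Real.sqrt_pos.2 (by positivity), ?_⟩
    refine solve_max (Fk_nonl hf hM hl hL f0 fM hΩ k) (Real.sqrt_pos.2 (by positivity)) ?_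
    rw [Real.sq_sqrt (by positivity)]; field_simp; rfl
  choose τ hτ U h1 h2 h3 h4 using key
  have hmax : ∀ k v, LowerSemicontinuous v → (∀ x, v x ∈ Icc 0 M) → (∀ t > 0, ∀ x, v x ≤ TT (Fk f Ω k) t v x) →
    ∀ x, v x ≤ U k x := fun k v hv hvM hle => h4 k v ⟨hv, hvM, hle _ (hτ k)⟩
  have hanti : ∀ x, Antitone (fun k => U k x) := by
    intro x
    refine antitone_nat_of_succ_le fun k => ?_
    refine hmax k _ (h1 (k+1)).lowerSemicontinuous (h2 (k+1)) (fun t ht x => ?_) x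
    refine (h3 (k+1) t ht x).le.trans ?_
    unfold TT
    have := av_mono ((Fk_nonl hf hM hl hL f0 fM hΩ k).BM (h1 (k+1)).measurable (h2 (k+1)))
      ((Fk_nonl hf hM hl hL f0 fM hΩ (k+1)).BM (h1 (k+1)).measurable (h2 (k+1))) (fun x => by
        unfold Fk
        have := (h2 (k+1) x).1
        push_cast
        split_ifs <;> nlinarith) (kB n) t x
    nlinarith [mul_le_mul_of_nonneg_left this (sq_nonneg t)]
  have hbdd : ∀ x, BddBelow (range fun k => U k x) := fun x => ⟨0, by rintro _ ⟨k, rfl⟩; exact (h2 k x).1⟩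
  have htend : ∀ x, Tendsto (fun k => U k x) atTop (𝓝 (⨅ k, U k x)) := fun x =>
    tendsto_atTop_ciInf (hanti x) (hbdd x)
  refine ⟨U, fun x => ⨅ k, U k x, h1, h2, h3, hmax, ?_, ?_, fun k x => ciInf_le (hbdd x) k, htend⟩
  · exact measurable_of_tendsto_metrizable (fun k => (h1 k).measurable) (tendsto_pi_nhds.2 htend)
  · intro x
    exact ⟨le_ciInf fun k => (h2 k x).1, (ciInf_le (hbdd x) 0).trans (h2 0 x).2⟩

theorem Fam.eqU {f : ℝ → ℝ} {M l : ℝ} {Ω : Set (En n)} {U : ℕ → En n → ℝ} {u : En n → ℝ} (h : Fam f M l Ω U u)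
    (k : ℕ) (x : En n) (t : ℝ) (ht : 0 < t) (hb : closedBall x t ⊆ Ω) :
    U k x = Av (kA n) t (U k) x - t ^ 2 * Av (kB n) t (fun y => f (U k y)) x := by
  refine (h.eq k t ht x).trans ?_
  unfold TT
  rw [av_congr_ball kB_norm ht.le (fun y hy => by unfold Fk; rw [if_pos (hb hy), add_zero])]

theorem Fam.equ {f : ℝ → ℝ} (hf : Continuous f) {M l : ℝ} {Ω : Set (En n)} {U : ℕ → En n → ℝ} {u : En n → ℝ} (h : Fam f M l Ω U u)
    (x : En n) (t : ℝ) (ht : 0 < t) (hb : closedBall x t ⊆ Ω) :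
    u x = Av (kA n) t u x - t ^ 2 * Av (kB n) t (fun y => f (u y)) x := by
  obtain ⟨C, hC⟩ := (isCompact_Icc (a := (0:ℝ)) (b := M)).exists_bound_of_continuousOn hf.continuousOn
  have t1 : Tendsto (fun k => Av (kA n) t (U k) x) atTop (𝓝 (Av (kA n) t u x)) := by
    refine tendsto_integral_of_dominated_convergence (fun _ => M) (fun k => ((h.cont k).comp (by fun_prop)).aestronglyMeasurable) (integrable_const _) (fun k => Eventually.of_forall fun y => ?_) (Eventually.of_forall fun y => h.tend _)
    rw [Real.norm_of_nonneg (h.mem k _).1]; exact (h.mem k _).2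
  have t2 : Tendsto (fun k => Av (kB n) t (fun y => f (U k y)) x) atTop (𝓝 (Av (kB n) t (fun y => f (u y)) x)) := by
    refine tendsto_integral_of_dominated_convergence (fun _ => C) (fun k => (hf.comp ((h.cont k).comp (by fun_prop))).aestronglyMeasurable) (integrable_const _) (fun k => Eventually.of_forall fun y => ?_) (Eventually.of_forall fun y => (hf.tendsto _).comp (h.tend _))
    exact hC _ (h.mem k _)
  have t3 := t1.sub (t2.const_mul (t ^ 2))
  refine tendsto_nhds_unique (h.tend x) (t3.congr fun k => ?_)
  exact (h.eqU k x t ht hb).symm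

theorem lap_radial {g g1 : ℝ → ℝ} {g2 : ℝ} {x y0 : En n}
    (h1 : ∀ᶠ s in 𝓝 (‖x - y0‖ ^ 2), HasDerivAt g (g1 s) s) (h2 : HasDerivAt g1 g2 (‖x - y0‖ ^ 2)) :
    lap (fun y => g (‖y - y0‖ ^ 2)) x = 4 * ‖x - y0‖ ^ 2 * g2 + 2 * n * g1 (‖x - y0‖ ^ 2) := by
  have hs : ∀ y : En n, HasFDerivAt (fun y : En n => ‖y - y0‖ ^ 2) (2 • (innerSL ℝ (y - y0))) y := by
    intro y
    have := ((hasStrictFDerivAt_norm_sq (y - y0)).hasFDerivAt).comp y ((hasFDerivAt_id y).sub_const y0)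
    simpa using! this
  have hc : ContinuousAt (fun y : En n => ‖y - y0‖ ^ 2) x := by fun_prop
  have e1 : ∀ i : Fin n, (fun y => fderiv ℝ (fun y : En n => g (‖y - y0‖ ^ 2)) y (EuclideanSpace.single i 1)) =ᶠ[𝓝 x]
      fun y => g1 (‖y - y0‖ ^ 2) * (2 * (y i - y0 i)) := by
    intro i
    filter_upwards [hc.eventually h1] with y hy
    have := hy.comp_hasFDerivAt y (hs y)
    have h3 := this.fderiv
    unfold Function.comp at h3
    rw [h3]
    simp [innerSL_apply_apply, EuclideanSpace.inner_single_right]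
  unfold lap
  have e2 : ∀ i : Fin n, fderiv ℝ (fun y => fderiv ℝ (fun y : En n => g (‖y - y0‖ ^ 2)) y (EuclideanSpace.single i 1)) x
      (EuclideanSpace.single i 1) = 4 * (x i - y0 i) ^ 2 * g2 + 2 * g1 (‖x - y0‖ ^ 2) := by
    intro i
    rw [(e1 i).fderiv_eq]
    have d1 : HasFDerivAt (fun y : En n => g1 (‖y - y0‖ ^ 2)) _ x := h2.comp_hasFDerivAt x (hs x)
    have d2 : HasFDerivAt (fun y : En n => 2 * (y i - y0 i)) ((2:ℝ) • (EuclideanSpace.proj (𝕜 := ℝ) i : En n →L[ℝ] ℝ)) x := by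
      have := (((EuclideanSpace.proj (𝕜 := ℝ) i : En n →L[ℝ] ℝ).hasFDerivAt (x := x)).sub_const (y0 i)).const_mul 2
      simpa using! this
    rw [(d1.fun_mul d2).fderiv]
    simp [innerSL_apply_apply, EuclideanSpace.inner_single_right]
    ring
  rw [Finset.sum_congr rfl fun i _ => e2 i, Finset.sum_add_distrib, ← Finset.sum_mul, ← Finset.mul_sum]
  rw [EuclideanSpace.real_norm_sq_eq (x - y0)]
  simp
  ring

theorem touch {w G b : En n → ℝ} {x : En n} (bw : BM w) (hG : BM G) (hGc : ContinuousAt G x) {O : Set (En n)} (hO : IsOpen O) (hx : x ∈ O)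
    (hb : ContDiffOn ℝ 2 b O) (hmax : ∀ᶠ y in 𝓝 x, w y - b y ≤ w x - b x)
    (hle : ∀ᶠ t in 𝓝[>] (0:ℝ), w x ≤ Av (kA n) t w x - t ^ 2 * Av (kB n) t G x) : G x ≤ lap b x := by
  obtain ⟨ψ, t', ht', hψ, hψc, hψs, hψ1, -⟩ := exists_cut hO (t := 0) (x := x) le_rfl (by simpa using hx)
  set b' : En n → ℝ := fun x => ψ x * b x
  have hb' : ContDiff ℝ 2 b' := cut_contDiff hO hb (hψ.of_le two_le_infty) hψs
  have hbc : HasCompactSupport b' := hψc.mul_right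
  have heq : b' =ᶠ[𝓝 x] b := by
    filter_upwards [ball_mem_nhds x ht'] with y hy
    simp [b', hψ1 y hy]
  rw [← lap_congr heq]
  have bmb : BM b' := by
    obtain ⟨C, hC⟩ := hbc.exists_bound_of_continuous hb'.continuous
    exact ⟨hb'.continuous.measurable, C, hC⟩
  have bml : BM (lap b') := by
    obtain ⟨C, hC⟩ := lap_bdd b' hb' hbc
    exact ⟨(lap_continuous b' hb').measurable, C, hC⟩
  have hmax' : ∀ᶠ y in 𝓝 x, w y - b' y ≤ w x - b' x := by
    filter_upwards [hmax, heq] with y h1 h2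
    rw [h2, heq.self_of_nhds]; exact h1
  obtain ⟨δ, hδ, hm⟩ := Metric.eventually_nhds_iff_ball.1 hmax'
  have l1 := avB_tendsto hG hGc
  have l2 := avB_tendsto bml (lap_continuous b' hb').continuousAt (x := x)
  have h3 : ∀ᶠ t in 𝓝[>] (0:ℝ), Av (kB n) t G x ≤ Av (kB n) t (lap b') x := by
    filter_upwards [hle, Ioo_mem_nhdsGT hδ] with t h4 ht
    have h5 : b' x + t ^ 2 * Av (kB n) t (lap b') x = Av (kA n) t b' x := (A3_global b' hb' hbc x t).symm
    have h6 : Av (kA n) t (fun y => w y - b' y) x ≤ w x - b' x := by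
      rw [← avA_const (w x - b' x) t x]
      refine av_mono_ball (bw.sub bmb) (BM.const _) kA_norm ht.1.le fun y hy => hm y ?_
      exact closedBall_subset_ball ht.2 hy
    rw [av_sub bw bmb] at h6
    have ht2 : 0 < t ^ 2 := pow_pos ht.1 2
    have : t ^ 2 * Av (kB n) t G x ≤ t ^ 2 * Av (kB n) t (lap b') x := by linarith
    exact le_of_mul_le_mul_left this ht2
  have := le_of_tendsto_of_tendsto l1 l2 h3
  exact le_of_mul_le_mul_left this BB_pos

theorem ext_ball {Ω : Set (En n)} (hΩ : IsOpen Ω) (hC : HasC2Boundary Ω) {x0 : En n} (hx0 : x0 ∈ frontier Ω) :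
    ∃ y0, ∃ R > 0, dist x0 y0 = R ∧ ∀ x ∈ ball y0 R, x ∉ Ω := by
  obtain ⟨V, f, hV, hxV, hf, hf', h1, h2⟩ := hC x0 hx0
  have f0 : f x0 = 0 := by
    have : x0 ∈ frontier Ω ∩ V := ⟨hx0, hxV⟩
    rw [h2] at this; exact this.2
  have hfat : ContDiffAt ℝ 2 f x0 := hf.contDiffAt (hV.mem_nhds hxV)
  have hfd : ContDiffAt ℝ 1 (fderiv ℝ f) x0 := hfat.fderiv_right (by norm_num)
  obtain ⟨C, s, hs, hL⟩ := hfd.exists_lipschitzOnWith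
  obtain ⟨δ, hδ, hb⟩ := Metric.mem_nhds_iff.1 (inter_mem hs (hV.mem_nhds hxV))
  have quad : ∀ y ∈ ball x0 δ, |f y - fderiv ℝ f x0 (y - x0)| ≤ C * ‖y - x0‖ ^ 2 := by
    intro y hy
    have hsub : closedBall x0 ‖y - x0‖ ⊆ ball x0 δ := closedBall_subset_ball (by rwa [← dist_eq_norm])
    have := (convex_closedBall x0 ‖y - x0‖).norm_image_sub_le_of_norm_hasFDerivWithin_le' (f := f) (f' := fderiv ℝ f) (φ := fderiv ℝ f x0)
      (C := C * ‖y - x0‖) (x := x0) (y := y) (fun z hz => ?_) (fun z hz => ?_) (mem_closedBall_self (norm_nonneg _)) (by rw [mem_closedBall, dist_eq_norm])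
    · rw [f0, sub_zero] at this
      rw [Real.norm_eq_abs] at this; calc _ ≤ _ := this
        _ = _ := by ring
    · have : ContDiffAt ℝ 2 f z := hf.contDiffAt (hV.mem_nhds (hb (hsub hz)).2)
      exact (this.differentiableAt (by norm_num)).hasFDerivAt.hasFDerivWithinAt
    · have := hL.dist_le_mul z (hb (hsub hz)).1 x0 (mem_of_mem_nhds hs)
      rw [dist_eq_norm] at this
      exact this.trans (mul_le_mul_of_nonneg_left hz C.2)
  set a : En n := (InnerProductSpace.toDual ℝ (En n)).symm (fderiv ℝ f x0)
  have ha : ∀ y, fderiv ℝ f x0 y = inner ℝ a y := fun y => by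
    rw [InnerProductSpace.toDual_symm_apply]
  have ha0 : 0 < ‖a‖ := by
    rw [norm_pos_iff]; intro h
    apply hf' x0 hxV
    ext y; rw [ha y, h]; simp
  set R : ℝ := min (δ / 2) (‖a‖ / (2 * (C + 1)))
  have hR : 0 < R := by
    apply lt_min (by positivity); positivity
  refine ⟨x0 + (R / ‖a‖) • a, R, hR, ?_, ?_⟩
  · rw [dist_eq_norm]; simp only [sub_add_cancel_left, norm_neg, norm_smul, norm_div, norm_norm]
    rw [div_mul_cancel₀ _ ha0.ne', Real.norm_of_nonneg hR.le]
  · intro x hx hxΩ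
    rw [mem_ball, dist_eq_norm] at hx
    set y := x - x0 with hy
    have hxy : x - (x0 + (R / ‖a‖) • a) = y - (R / ‖a‖) • a := by rw [hy]; abel
    rw [hxy] at hx
    have hnn : ‖(R / ‖a‖) • a‖ = R := by
      rw [norm_smul, norm_div, norm_norm, div_mul_cancel₀ _ ha0.ne', Real.norm_of_nonneg hR.le]
    have hsq : ‖y‖ ^ 2 < 2 * (R / ‖a‖) * inner ℝ a y := by
      have e := norm_sub_sq_real y ((R / ‖a‖) • a)
      rw [hnn, inner_smul_right, real_inner_comm] at e
      have := pow_lt_pow_left₀ hx (norm_nonneg _) two_ne_zero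
      linarith
    have hyδ : x ∈ ball x0 δ := by
      rw [mem_ball, dist_eq_norm]
      have := norm_sub_norm_le y ((R / ‖a‖) • a)
      rw [hnn] at this
      have h3 : R ≤ δ / 2 := min_le_left _ _
      linarith
    have hq := quad x hyδ
    rw [ha, ← hy] at hq
    have hneg : f x < 0 := by
      have : x ∈ Ω ∩ V := ⟨hxΩ, (hb hyδ).2⟩
      rw [h1] at this; exact this.2
    have h4 := (abs_le.1 hq).1
    have h5 : R * (2 * (C + 1)) ≤ ‖a‖ := by
      rw [← le_div_iff₀ (by positivity)]; exact min_le_right _ _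
    have h6 : ‖a‖ * ‖y‖ ^ 2 < 2 * R * inner ℝ a y := by
      have := mul_lt_mul_of_pos_left hsq ha0
      calc _ < _ := this
        _ = _ := by field_simp
    have h7 : inner ℝ a y < C * ‖y‖ ^ 2 := by linarith
    have h8 : 2 * R * inner ℝ a y ≤ 2 * R * (C * ‖y‖ ^ 2) := mul_le_mul_of_nonneg_left h7.le (by positivity)
    have h9 : R * (2 * (C + 1)) * ‖y‖ ^ 2 ≤ ‖a‖ * ‖y‖ ^ 2 := mul_le_mul_of_nonneg_right h5 (by positivity)
    nlinarith [mul_nonneg hR.le (sq_nonneg ‖y‖)]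

theorem Fam.ext_bound {f : ℝ → ℝ} (hf : Continuous f) {M l C : ℝ} {Ω : Set (En n)} {U : ℕ → En n → ℝ} {u : En n → ℝ} (h : Fam f M l Ω U u)
    (hN : ∀ k, Nonl (Fk f Ω k) M (l + k)) (hM : 0 < M)
    (hC0 : 0 ≤ C) (hC : ∀ s ∈ Icc 0 M, -C ≤ f s) {y : En n} {r : ℝ} (hr : 0 < r) (hb : ∀ x ∈ ball y r, x ∉ Ω) (k : ℕ) (hk : 0 < k) :
    U k y ≤ (C + 2 * n * M / r ^ 2) / k := by
  have hk' : (0:ℝ) < k := by exact_mod_cast hk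
  set z0 : ℝ := (C + 2 * n * M / r ^ 2) / k with hz0
  have z0n : 0 ≤ z0 := by positivity
  set z : En n → ℝ := fun x => (fun s => z0 + M / r ^ 2 * s) (‖x - y‖ ^ 2) with hz
  have hzc : ContDiff ℝ 2 z := by
    simp only [hz]
    exact contDiff_const.add (contDiff_const.mul ((contDiff_id.sub contDiff_const).norm_sq ℝ))
  obtain ⟨x, hxK, hx⟩ := (isCompact_closedBall y r).exists_isMaxOn ⟨y, mem_closedBall_self hr.le⟩ (f := fun x => U k x - z x)
    ((h.cont k).sub hzc.continuous).continuousOn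
  have hzy : z y = z0 := by simp [hz]
  have hy : U k y - z y ≤ U k x - z x := hx (mem_closedBall_self hr.le)
  rw [hzy] at hy
  have hzx : z0 ≤ z x := by
    simp only [hz]; have : 0 ≤ M / r ^ 2 * ‖x - y‖ ^ 2 := by positivity
    linarith
  by_contra hcon
  push Not at hcon
  have hlt : dist x y < r := by
    refine lt_of_le_of_ne hxK fun he => ?_
    have : z x = z0 + M := by
      simp only [hz]; rw [← dist_eq_norm, he]; field_simp
    have := (h.mem k x).2
    linarith
  have hlap : lap z x = 2 * n * (M / r ^ 2) := by
    have := lap_radial (g := fun s => z0 + M / r ^ 2 * s) (g1 := fun s => M / r ^ 2) (g2 := 0) (x := x) (y0 := y)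
      (Eventually.of_forall fun s => by simpa using ((hasDerivAt_id s).const_mul (M / r ^ 2)).const_add z0) (hasDerivAt_const _ _)
    rw [this]; ring
  have hG : BM (fun y => Fk f Ω k y (U k y)) := (hN k).BM ((h.cont k).measurable) (h.mem k)
  have hev : ∀ᶠ x' in 𝓝 x, x' ∈ ball y r := isOpen_ball.mem_nhds hlt
  have ht := touch (w := U k) (G := fun y => Fk f Ω k y (U k y)) (b := z) (x := x) (O := univ) (BM.of_Icc (h.cont k).measurable (h.mem k)) hG ?_ isOpen_univ (mem_univ _)
    hzc.contDiffOn ?_ ?_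
  · rw [hlap] at ht
    unfold Fk at ht
    rw [if_neg (hb x hlt)] at ht
    have h1 := hC _ (h.mem k x)
    have h2 : U k x * k ≤ C + 2 * n * M / r ^ 2 := by
      have : 2 * n * (M / r ^ 2) = 2 * n * M / r ^ 2 := by ring
      rw [← this]; linarith
    have h3 : U k x ≤ z0 := by rw [hz0, le_div_iff₀ hk']; exact h2
    linarith
  · have : (fun y => Fk f Ω k y (U k y)) =ᶠ[𝓝 x] fun y => f (U k y) + k * U k y := by
      filter_upwards [hev] with x' hx'
      unfold Fk; rw [if_neg (hb x' hx')]
    refine ContinuousAt.congr ?_ this.symm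
    exact ((hf.comp (h.cont k)).add (continuous_const.mul (h.cont k))).continuousAt
  · filter_upwards [hev] with x' hx'
    exact hx (ball_subset_closedBall hx')
  · filter_upwards [self_mem_nhdsWithin] with t ht
    exact (h.eq k t ht x).le

theorem Fam.subC {f : ℝ → ℝ} {M l C : ℝ} {Ω : Set (En n)} {U : ℕ → En n → ℝ} {u : En n → ℝ} (h : Fam f M l Ω U u)
    (hN : ∀ k, Nonl (Fk f Ω k) M (l + k))
    (hC : ∀ s ∈ Icc 0 M, -C ≤ f s) (k : ℕ) (x : En n) (t : ℝ) (ht : 0 < t) :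
    U k x ≤ Av (kA n) t (U k) x - t ^ 2 * Av (kB n) t (fun _ => -C) x := by
  refine (h.eq k t ht x).le.trans ?_
  unfold TT
  have hG : BM (fun y => Fk f Ω k y (U k y)) := (hN k).BM ((h.cont k).measurable) (h.mem k)
  have : Av (kB n) t (fun _ => -C) x ≤ Av (kB n) t (fun y => Fk f Ω k y (U k y)) x := by
    refine av_mono (BM.const _) hG (fun y => ?_) _ _ _
    have h1 := hC _ (h.mem k y)
    have h2 := (h.mem k y).1
    unfold Fk
    split_ifs
    · linarith
    · have : (0:ℝ) ≤ k * U k y := by positivity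
      linarith
  nlinarith [sq_nonneg t]

set_option maxHeartbeats 1000000 in
theorem Fam.barrier {f : ℝ → ℝ} (hf : Continuous f) {M l C : ℝ} {Ω : Set (En n)} {U : ℕ → En n → ℝ} {u : En n → ℝ} (h : Fam f M l Ω U u)
    (hN : ∀ k, Nonl (Fk f Ω k) M (l + k)) (hM : 0 < M)
    (hC0 : 0 ≤ C) (hC : ∀ s ∈ Icc 0 M, -C ≤ f s) {y0 : En n} {R : ℝ} (hR : 0 < R) (hb : ∀ x ∈ ball y0 R, x ∉ Ω)
    : ∃ K γ : ℝ, 0 < γ ∧ 0 < K ∧ ∀ x, R ≤ dist x y0 → dist x y0 ≤ 2 * R → u x ≤ K * (Real.exp (- γ * R ^ 2) - Real.exp (- γ * dist x y0 ^ 2)) := by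
  set γ : ℝ := (2 * n + 1) / R ^ 2 with hγ
  have γ0 : 0 < γ := by positivity
  have γR : γ * R ^ 2 = 2 * n + 1 := by rw [hγ]; field_simp
  set e1 : ℝ := Real.exp (- γ * R ^ 2) - Real.exp (- γ * (2 * R) ^ 2) with he1
  have e1p : 0 < e1 := by
    rw [he1, sub_pos]; apply Real.exp_lt_exp.2
    nlinarith [mul_pos γ0 (pow_pos hR 2)]
  set e2 : ℝ := γ * Real.exp (- γ * (2 * R) ^ 2) with he2
  have e2p : 0 < e2 := by positivity
  set K : ℝ := M / e1 + (C + 1) / e2 with hK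
  have K0 : 0 < K := by positivity
  have Ke1 : M ≤ K * e1 := by
    rw [hK, add_mul, div_mul_cancel₀ _ e1p.ne']
    have : 0 ≤ (C + 1) / e2 * e1 := by positivity
    linarith
  have Ke2 : C < K * e2 := by
    rw [hK, add_mul, div_mul_cancel₀ _ e2p.ne']
    have : 0 ≤ M / e1 * e2 := by positivity
    linarith
  refine ⟨K, γ, γ0, K0, ?_⟩
  -- step: for `R'`
  have step : ∀ R' ∈ Ioo (R * (3/4)) R, ∀ x, R ≤ dist x y0 → dist x y0 ≤ 2 * R →
      u x ≤ K * (Real.exp (- γ * R' ^ 2) - Real.exp (- γ * dist x y0 ^ 2)) := by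
    intro R' hR' x hx1 hx2
    have hRR : 0 < R - R' := sub_pos.2 hR'.2
    have R'0 : 0 < R' := lt_trans (by positivity) hR'.1
    set c0 : ℝ := C + 2 * n * M / (R - R') ^ 2
    have key : ∀ k : ℕ, 0 < k → U k x ≤ c0 / k + K * (Real.exp (- γ * R' ^ 2) - Real.exp (- γ * dist x y0 ^ 2)) := by
      intro k hk
      have hin : ∀ y, dist y y0 ≤ R' → U k y ≤ c0 / k := by
        intro y hy
        refine h.ext_bound hf hN hM hC0 hC hRR (fun z hz => hb z ?_) k hk
        rw [mem_ball] at *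
        linarith [dist_triangle z y y0]
      set b : En n → ℝ := fun x => (fun s => K * (Real.exp (- γ * R' ^ 2) - Real.exp (- γ * s))) (‖x - y0‖ ^ 2) with hbdef
      have hbc : ContDiff ℝ 2 b := by
        simp only [hbdef]
        exact contDiff_const.mul (contDiff_const.sub (Real.contDiff_exp.comp (contDiff_const.mul ((contDiff_id.sub contDiff_const).norm_sq ℝ))))
      have hKc : IsCompact (closedBall y0 (2 * R) \ ball y0 R') := (isCompact_closedBall _ _).diff isOpen_ball
      have hxK : x ∈ closedBall y0 (2 * R) \ ball y0 R' := ⟨hx2, by rw [mem_ball]; linarith [hR'.2]⟩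
      obtain ⟨p, hpK, hp⟩ := hKc.exists_isMaxOn ⟨x, hxK⟩ (f := fun x => U k x - b x)
        ((h.cont k).sub hbc.continuous).continuousOn
      have hc0k : 0 ≤ c0 / k := by positivity
      by_contra hcon
      push Not at hcon
      have hxp : U k x - b x ≤ U k p - b p := hp hxK
      have hbx : b x = K * (Real.exp (- γ * R' ^ 2) - Real.exp (- γ * dist x y0 ^ 2)) := by simp only [hbdef, dist_eq_norm]
      rw [← hbx] at hcon
      have hp1 : R' < dist p y0 := by
        refine lt_of_le_of_ne (not_lt.1 hpK.2) fun he => ?_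
        have := hin p he.symm.le
        have hbp : b p = 0 := by simp only [hbdef, ← dist_eq_norm, ← he]; simp
        linarith
      have hp2 : dist p y0 < 2 * R := by
        refine lt_of_le_of_ne hpK.1 fun he => ?_
        have hbp : M ≤ b p := by
          simp only [hbdef, ← dist_eq_norm, he]
          refine Ke1.trans (mul_le_mul_of_nonneg_left ?_ K0.le)
          rw [he1]
          have : Real.exp (- γ * R ^ 2) ≤ Real.exp (- γ * R' ^ 2) := by
            apply Real.exp_le_exp.2
            have : R' ^ 2 ≤ R ^ 2 := pow_le_pow_left₀ R'0.le hR'.2.le 2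
            nlinarith
          linarith
        have := (h.mem k p).2
        linarith
      have hlap : lap b p = K * γ * Real.exp (- γ * ‖p - y0‖ ^ 2) * (2 * n - 4 * γ * ‖p - y0‖ ^ 2) := by
        have hd : ∀ s : ℝ, HasDerivAt (fun s => Real.exp (- γ * s)) (-γ * Real.exp (- γ * s)) s := fun s => by
          have := ((hasDerivAt_id s).const_mul (-γ)).exp
          simpa [mul_comm] using! this
        have := lap_radial (g := fun s => K * (Real.exp (- γ * R' ^ 2) - Real.exp (- γ * s))) (g1 := fun s => K * (γ * Real.exp (- γ * s)))
          (g2 := K * (γ * (-γ * Real.exp (- γ * ‖p - y0‖ ^ 2)))) (x := p) (y0 := y0)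
          (Eventually.of_forall fun s => by convert! ((hd s).const_sub (Real.exp (- γ * R' ^ 2))).const_mul K using 1; ring) (((hd _).const_mul _).const_mul _)
        rw [this]; ring
      have ht := touch (w := U k) (G := fun _ => -C) (b := b) (x := p) (O := univ) (BM.of_Icc (h.cont k).measurable (h.mem k)) (BM.const _) continuousAt_const isOpen_univ (mem_univ _)
        hbc.contDiffOn ?_ ?_
      · rw [hlap, ← dist_eq_norm] at ht
        set d := dist p y0
        have hd2 : (R * (3/4)) ^ 2 ≤ d ^ 2 := pow_le_pow_left₀ (by positivity) (hR'.1.trans hp1).le 2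
        have hd3 : d ^ 2 ≤ (2 * R) ^ 2 := pow_le_pow_left₀ dist_nonneg hp2.le 2
        have h1 : 2 * n - 4 * γ * d ^ 2 ≤ -1 := by
          have : γ * (R * (3/4)) ^ 2 ≤ γ * d ^ 2 := mul_le_mul_of_nonneg_left hd2 γ0.le
          have h3 : (0:ℝ) ≤ n := by positivity
          have h5 : γ * (R * (3/4)) ^ 2 = 9 / 16 * (2 * n + 1) := by rw [← γR]; ring
          linarith
        have h2 : Real.exp (- γ * (2 * R) ^ 2) ≤ Real.exp (- γ * d ^ 2) := by
          apply Real.exp_le_exp.2; nlinarith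
        have h3 : K * e2 ≤ K * γ * Real.exp (- γ * d ^ 2) := by
          rw [he2, ← mul_assoc]
          exact mul_le_mul_of_nonneg_left h2 (by positivity)
        have h4 : 0 ≤ K * γ * Real.exp (- γ * d ^ 2) := by positivity
        nlinarith
      · have : ball y0 (2 * R) \ closedBall y0 R' ∈ 𝓝 p := (isOpen_ball.sdiff isClosed_closedBall).mem_nhds ⟨hp2, by rw [mem_closedBall]; linarith⟩
        filter_upwards [this] with q hq
        exact hp ⟨ball_subset_closedBall hq.1, fun h => hq.2 (ball_subset_closedBall h)⟩
      · filter_upwards [self_mem_nhdsWithin] with t ht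
        exact h.subC hN hC k p t ht
    have l2 : Tendsto (fun k : ℕ => c0 / k + K * (Real.exp (- γ * R' ^ 2) - Real.exp (- γ * dist x y0 ^ 2))) atTop (𝓝 (0 + K * (Real.exp (- γ * R' ^ 2) - Real.exp (- γ * dist x y0 ^ 2)))) :=
      (tendsto_const_div_atTop_nhds_zero_nat c0).add_const _
    rw [zero_add] at l2
    refine le_of_tendsto_of_tendsto (h.tend x) l2 ?_
    filter_upwards [eventually_gt_atTop 0] with k hk
    exact key k hk
  intro x hx1 hx2
  have hcont : Continuous (fun R' : ℝ => K * (Real.exp (- γ * R' ^ 2) - Real.exp (- γ * dist x y0 ^ 2))) := by fun_prop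
  have l : Tendsto (fun R' : ℝ => K * (Real.exp (- γ * R' ^ 2) - Real.exp (- γ * dist x y0 ^ 2))) (𝓝[<] R) (𝓝 (K * (Real.exp (- γ * R ^ 2) - Real.exp (- γ * dist x y0 ^ 2)))) :=
    (hcont.tendsto R).mono_left nhdsWithin_le_nhds
  refine ge_of_tendsto l ?_
  filter_upwards [Ioo_mem_nhdsLT (show R * (3/4) < R by linarith)] with R' hR'
  exact step R' hR' x hx1 hx2

theorem Fam.boundary {f : ℝ → ℝ} (hf : ContDiff ℝ 1 f) {M l : ℝ} {Ω : Set (En n)} {U : ℕ → En n → ℝ} {u : En n → ℝ} (h : Fam f M l Ω U u)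
    (hN : ∀ k, Nonl (Fk f Ω k) M (l + k)) (hM : 0 < M) (hΩ : IsOpen Ω) (hB : HasC2Boundary Ω) :
    (∀ x ∈ frontier Ω, u x = 0) ∧ ContinuousOn u (closure Ω) := by
  obtain ⟨C, hC⟩ := (isCompact_Icc (a := (0:ℝ)) (b := M)).exists_bound_of_continuousOn hf.continuous.continuousOn
  have hC' : ∀ s ∈ Icc 0 M, -C ≤ f s := fun s hs => (abs_le.1 (hC s hs)).1
  have hC0 : 0 ≤ C := (norm_nonneg _).trans (hC 0 ⟨le_rfl, hM.le⟩)
  have key : ∀ x0 ∈ frontier Ω, ∃ g : En n → ℝ, Continuous g ∧ g x0 = 0 ∧ u x0 ≤ 0 ∧ ∀ᶠ x in 𝓝 x0, x ∈ Ω → u x ≤ g x := by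
    intro x0 hx0
    obtain ⟨y0, R, hR, hd, hb⟩ := ext_ball hΩ hB hx0
    obtain ⟨K, γ, -, -, hbar⟩ := h.barrier hf.continuous hN hM hC0 hC' hR hb
    refine ⟨fun x => K * (Real.exp (- γ * R ^ 2) - Real.exp (- γ * dist x y0 ^ 2)), by fun_prop, by simp [hd], ?_, ?_⟩
    · have := hbar x0 hd.ge (by linarith)
      rw [hd] at this; simpa using this
    · have : ball y0 (2 * R) ∈ 𝓝 x0 := isOpen_ball.mem_nhds (by rw [mem_ball]; linarith)
      filter_upwards [this] with x hx hxΩ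
      refine hbar x ?_ (le_of_lt hx)
      by_contra hc
      exact hb x (not_le.1 hc) hxΩ
  have hz : ∀ x ∈ frontier Ω, u x = 0 := by
    intro x hx
    obtain ⟨g, -, -, h1, -⟩ := key x hx
    exact le_antisymm h1 (h.memu x).1
  refine ⟨hz, ?_⟩
  have hreg := regularity hf h.meas h.memu hΩ (h.equ hf.continuous)
  intro x hx
  by_cases hxΩ : x ∈ Ω
  · exact (hreg.1.continuousOn.continuousAt (hΩ.mem_nhds hxΩ)).continuousWithinAt
  · have hxf : x ∈ frontier Ω := by rw [hΩ.frontier_eq]; exact ⟨hx, hxΩ⟩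
    obtain ⟨g, hg, hg0, -, hev⟩ := key x hxf
    have hx0 := hz x hxf
    unfold ContinuousWithinAt
    rw [hx0]
    have hl : Tendsto (fun y => |g y|) (𝓝[closure Ω] x) (𝓝 0) := by
      have := (hg.abs.tendsto x).mono_left (nhdsWithin_le_nhds (s := closure Ω))
      simpa [hg0] using this
    refine tendsto_of_tendsto_of_tendsto_of_le_of_le' tendsto_const_nhds hl (Eventually.of_forall fun y => (h.memu y).1) ?_
    filter_upwards [self_mem_nhdsWithin, nhdsWithin_le_nhds hev] with y hy1 hy2
    by_cases hyΩ : y ∈ Ω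
    · exact (hy2 hyΩ).trans (le_abs_self _)
    · rw [hz y (by rw [hΩ.frontier_eq]; exact ⟨hy1, hyΩ⟩)]; exact abs_nonneg _

theorem smp {D : Set (En n)} (hD : IsOpen D) (hDc : IsPreconnected D) {w : En n → ℝ} {Λ : ℝ} (hΛ : 0 < Λ) (bw : BM w) (w0 : ∀ x, 0 ≤ w x)
    (hc : ContinuousOn w D)
    (h : ∀ x t, 0 < t → closedBall x t ⊆ D → Av (kA n) t w x - t ^ 2 * (Λ * Av (kB n) t w x) ≤ w x)
    (hz : ∃ x ∈ D, w x = 0) : ∀ x ∈ D, w x = 0 := by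
  set Z : Set (En n) := {x | x ∈ D ∧ w x = 0} with hZ
  have hZo : IsOpen Z := by
    rw [isOpen_iff_mem_nhds]
    rintro x ⟨hxD, hx0⟩
    obtain ⟨δ, hδ, hb⟩ := Metric.isOpen_iff.1 hD x hxD
    obtain ⟨t, ht0, ht1, ht2⟩ : ∃ t > 0, t < δ ∧ t ^ 2 * Λ ≤ 2 := by
      refine ⟨min (δ / 2) (Real.sqrt (2 / Λ)), lt_min (by positivity) (Real.sqrt_pos.2 (by positivity)), ?_, ?_⟩
      · exact (min_le_left _ _).trans_lt (by linarith)
      · have h0 : 0 ≤ min (δ / 2) (Real.sqrt (2 / Λ)) := le_min (by positivity) (Real.sqrt_nonneg _)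
        have : (min (δ / 2) (Real.sqrt (2 / Λ))) ^ 2 ≤ (Real.sqrt (2 / Λ)) ^ 2 := pow_le_pow_left₀ h0 (min_le_right _ _) 2
        rw [Real.sq_sqrt (by positivity)] at this
        calc _ ≤ 2 / Λ * Λ := mul_le_mul_of_nonneg_right this hΛ.le
          _ = 2 := by field_simp
    have hcb : closedBall x t ⊆ D := (closedBall_subset_ball ht1).trans hb
    have h1 := h x t ht0 hcb
    rw [hx0] at h1
    have h2 := avA_ge_avB bw w0 t x
    have hBn : 0 ≤ Av (kB n) t w x := integral_nonneg fun y => w0 _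
    have hA : Av (kA n) t w x ≤ 0 := by
      have : t ^ 2 * (Λ * Av (kB n) t w x) ≤ 2 * Av (kB n) t w x := by
        rw [← mul_assoc]; exact mul_le_mul_of_nonneg_right ht2 hBn
      linarith
    have hae : (fun y => w (x + t • y)) =ᵐ[kA n] 0 := by
      rw [← integral_eq_zero_iff_of_nonneg (fun y => w0 _) (bw.int _ _ _)]
      exact le_antisymm hA (integral_nonneg fun y => w0 _)
    filter_upwards [ball_mem_nhds x ht0] with y hy
    have hyD := hcb (ball_subset_closedBall hy)
    refine ⟨hyD, ?_⟩
    by_contra hne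
    have hpos : 0 < w y := lt_of_le_of_ne (w0 y) (Ne.symm hne)
    have hev : ∀ᶠ y' in 𝓝 y, 0 < w y' := (hc.continuousAt (hD.mem_nhds hyD)).eventually (lt_mem_nhds hpos)
    obtain ⟨O, hO, hOo, hyO⟩ := _root_.eventually_nhds_iff.1 hev
    have hpre : IsOpen ((fun z : En n => x + t • z) ⁻¹' O) := hOo.preimage (by fun_prop)
    have := kA_open_pos _ hpre (t⁻¹ • (y - x)) (by
      simp only [mem_preimage]; rw [smul_smul, mul_inv_cancel₀ ht0.ne', one_smul]; simpa using hyO) (by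
      rw [norm_smul, norm_inv, Real.norm_of_nonneg ht0.le, inv_mul_lt_iff₀ ht0, mul_one, ← dist_eq_norm]; exact hy)
    have hnull : kA n {z | ¬ (w (x + t • z) = 0)} = 0 := hae
    have hle : kA n ((fun z : En n => x + t • z) ⁻¹' O) ≤ kA n {z | ¬ (w (x + t • z) = 0)} :=
      measure_mono fun z hz => (hO _ hz).ne'
    rw [hnull] at hle
    exact absurd hle (not_le.2 this)
  have := hDc.subset_of_closure_inter_subset hZo ?_ ?_
  · exact fun x hx => (this hx).2
  · obtain ⟨x, hx, hx0⟩ := hz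
    exact ⟨x, hx, hx, hx0⟩
  · rintro x ⟨hxc, hxD⟩
    refine ⟨hxD, ?_⟩
    have hcx : ContinuousWithinAt w Z x := (hc x hxD).mono fun y hy => hy.1
    have : w x ∈ closure ({0} : Set ℝ) := hcx.mem_closure hxc fun y hy => hy.2
    simpa using this

theorem smp_diff {D : Set (En n)} (hD : IsOpen D) (hDc : IsPreconnected D) {v1 v2 G1 G2 : En n → ℝ} {Λ : ℝ} (hΛ : 0 < Λ) (b1 : BM v1)
    (b2 : BM v2) (bG1 : BM G1) (bG2 : BM G2) (hle : ∀ x, v1 x ≤ v2 x) (hc1 : ContinuousOn v1 D) (hc2 : ContinuousOn v2 D)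
    (h1 : ∀ x t, 0 < t → closedBall x t ⊆ D → v1 x ≤ Av (kA n) t v1 x - t ^ 2 * Av (kB n) t G1 x)
    (h2 : ∀ x t, 0 < t → closedBall x t ⊆ D → Av (kA n) t v2 x - t ^ 2 * Av (kB n) t G2 x ≤ v2 x)
    (hG : ∀ x ∈ D, G2 x - G1 x ≤ Λ * (v2 x - v1 x)) (hz : ∃ x ∈ D, v1 x = v2 x) : ∀ x ∈ D, v1 x = v2 x := by
  have := smp hD hDc hΛ (b2.sub b1) (fun x => sub_nonneg.2 (hle x)) (hc2.sub hc1) ?_ ?_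
  · intro x hx; linarith [this x hx]
  · intro x t ht hb
    have e1 := h1 x t ht hb
    have e2 := h2 x t ht hb
    rw [av_sub b2 b1]
    have e3 : Av (kB n) t (fun x => G2 x - G1 x) x ≤ Av (kB n) t (fun x => Λ * (v2 x - v1 x)) x :=
      av_mono_ball (bG2.sub bG1) ((b2.sub b1).const_mul Λ) kB_norm ht.le fun y hy => hG y (hb hy)
    rw [av_sub bG2 bG1, av_mul] at e3
    have := mul_le_mul_of_nonneg_left e3 (sq_nonneg t)
    linarith
  · obtain ⟨x, hx, he⟩ := hz
    exact ⟨x, hx, by simp [he]⟩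

theorem Fam.signs {f : ℝ → ℝ} (hf : ContDiff ℝ 1 f) {M l : ℝ} {Ω : Set (En n)} {U : ℕ → En n → ℝ} {u : En n → ℝ} (h : Fam f M l Ω U u)
    (hN : ∀ k, Nonl (Fk f Ω k) M (l + k)) (hl : 0 < l) (hM : 0 < M) (hΩ : IsOpen Ω) (hB : HasC2Boundary Ω)
    (hL : ∀ s ∈ Icc 0 M, ∀ s' ∈ Icc 0 M, |f s - f s'| ≤ l * |s - s'|) (f0 : f 0 ≤ 0) (fM : f M = 0)
    (hcon : IsConnected Ω) (hfr : (frontier Ω).Nonempty) (hpos : ∃ x ∈ Ω, 0 < u x) :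
    (∀ x ∈ Ω, 0 < u x ∧ u x < M) ∧ ∀ k, ∀ x ∈ Ω, u x < U k x := by
  have hreg := regularity hf h.meas h.memu hΩ (h.equ hf.continuous)
  obtain ⟨hb0, hbc⟩ := h.boundary hf hN hM hΩ hB
  have bu := BM.of_Icc h.meas h.memu
  have bfu := BM.comp_cont hf.continuous h.meas h.memu
  have hup : ∀ x ∈ Ω, 0 < u x := by
    intro x hx
    by_contra hc
    have hx0 : (0:ℝ) = u x := le_antisymm (h.memu x).1 (not_lt.1 hc)
    have := smp_diff hΩ hcon.isPreconnected hl (BM.const 0) bu (BM.const (f 0)) bfu (fun x => (h.memu x).1) continuousOn_const hreg.1.continuousOn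
      (fun x t ht hb => by
        rw [avA_const, avB_const]
        have := mul_nonneg (sq_nonneg t) (mul_nonneg BB_pos.le (neg_nonneg.2 f0) : 0 ≤ BB n * (- f 0))
        linarith) (fun x t ht hb => (h.equ hf.continuous x t ht hb).ge)
      (fun x hx => by
        have h1 := hL (u x) (h.memu x) 0 ⟨le_rfl, hM.le⟩
        have h2 := (abs_le.1 h1).2
        rwa [abs_of_nonneg (by simpa using (h.memu x).1)] at h2) ⟨x, hx, hx0⟩
    obtain ⟨y, hy, hy0⟩ := hpos
    linarith [this y hy]
  have cl : ∀ (g : En n → ℝ), ContinuousOn g (closure Ω) → (∀ x ∈ Ω, g x = 0) → ∀ x ∈ frontier Ω, g x = 0 := by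
    intro g hg h0 x hx
    have hxc : x ∈ closure Ω := frontier_subset_closure hx
    have hcx : ContinuousWithinAt g Ω x := (hg x hxc).mono subset_closure
    have : g x ∈ closure ({0} : Set ℝ) := hcx.mem_closure hxc fun y hy => h0 y hy
    simpa using this
  obtain ⟨z, hz⟩ := hfr
  refine ⟨fun x hx => ⟨hup x hx, ?_⟩, ?_⟩
  · refine lt_of_le_of_ne (h.memu x).2 fun hxM => ?_
    have := smp_diff hΩ hcon.isPreconnected hl bu (BM.const M) bfu (BM.const 0) (fun x => (h.memu x).2) hreg.1.continuousOn continuousOn_const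
      (fun x t ht hb => (h.equ hf.continuous x t ht hb).le) (fun x t ht hb => by
        rw [avA_const, avB_const]; simp)
      (fun x hx => by
        have h1 := hL M ⟨hM.le, le_rfl⟩ (u x) (h.memu x)
        have h2 := (abs_le.1 h1).2
        rwa [abs_of_nonneg (by simpa using (h.memu x).2), fM] at h2) ⟨x, hx, hxM⟩
    have h3 := cl (fun x => u x - M) (hbc.sub continuousOn_const) (fun x hx => by simp [this x hx]) z hz
    have h4 := hb0 z hz
    simp only [h4] at h3
    linarith
  · intro k x hx
    refine lt_of_le_of_ne (h.le k x) fun hxe => ?_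
    have bU := BM.of_Icc (h.cont k).measurable (h.mem k)
    have bfU := BM.comp_cont hf.continuous (h.cont k).measurable (h.mem k)
    have h5 := smp_diff hΩ hcon.isPreconnected hl bu bU bfu bfU (h.le k) hreg.1.continuousOn (h.cont k).continuousOn
      (fun x t ht hb => (h.equ hf.continuous x t ht hb).le) (fun x t ht hb => (h.eqU k x t ht hb).ge)
      (fun x hx => by
        have h1 := hL (U k x) (h.mem k x) (u x) (h.memu x)
        have h2 := (abs_le.1 h1).2
        rwa [abs_of_nonneg (sub_nonneg.2 (h.le k x))] at h2) ⟨x, hx, hxe⟩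
    have h3 := cl (fun x => u x - U k x) (hbc.sub (h.cont k).continuousOn) (fun x hx => by simp [h5 x hx]) z hz
    have h4 := hb0 z hz
    have hUz : (0:ℝ) = U k z := by simp only [h4] at h3; linarith
    have hlk : 0 < l + k := (hN k).l0
    have h6 := smp_diff isOpen_univ isPreconnected_univ hlk (BM.const 0) bU (BM.const (f 0)) ((hN k).BM (h.cont k).measurable (h.mem k))
      (fun x => (h.mem k x).1) continuousOn_const (h.cont k).continuousOn
      (fun x t ht hb => by
        rw [avA_const, avB_const]
        have := mul_nonneg (sq_nonneg t) (mul_nonneg BB_pos.le (neg_nonneg.2 f0) : 0 ≤ BB n * (- f 0))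
        linarith) (fun x t ht hb => (h.eq k t ht x).ge)
      (fun x hx => by
        have h1 := (hN k).mono x 0 ⟨le_rfl, hM.le⟩ (U k x) (h.mem k x) (h.mem k x).1
        have h2 : Fk f Ω k x 0 = f 0 := by unfold Fk; simp
        rwa [h2] at h1) ⟨z, mem_univ _, hUz⟩
    have := h6 x (mem_univ _)
    linarith [hup x hx]

theorem Fam.strict {f : ℝ → ℝ} (hf : ContDiff ℝ 1 f) {M M' l : ℝ} {Ω : Set (En n)} {U U' : ℕ → En n → ℝ} {u u' : En n → ℝ} (h : Fam f M l Ω U u)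
    (h' : Fam f M' l Ω U' u')
    (hl : 0 < l) (hMM : M ≤ M') (hΩ : IsOpen Ω)
    (hL : ∀ s ∈ Icc 0 M', ∀ s' ∈ Icc 0 M', |f s - f s'| ≤ l * |s - s'|)
    (hcon : IsConnected Ω) (hlt : ∃ x ∈ Ω, u x < u' x) : ∀ x ∈ Ω, u x < u' x := by
  have hle : ∀ x, u x ≤ u' x := by
    intro x
    refine le_of_tendsto_of_tendsto' (h.tend x) (h'.tend x) fun k => ?_
    refine h'.max k (U k) (h.cont k).lowerSemicontinuous (fun x => ⟨(h.mem k x).1, (h.mem k x).2.trans hMM⟩) (fun t ht x => (h.eq k t ht x).le) x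
  have hreg := regularity hf h.meas h.memu hΩ (h.equ hf.continuous)
  have hreg' := regularity hf h'.meas h'.memu hΩ (h'.equ hf.continuous)
  intro x hx
  refine lt_of_le_of_ne (hle x) fun hxe => ?_
  have h5 := smp_diff hΩ hcon.isPreconnected hl (BM.of_Icc h.meas h.memu) (BM.of_Icc h'.meas h'.memu) (BM.comp_cont hf.continuous h.meas h.memu)
      (BM.comp_cont hf.continuous h'.meas h'.memu) hle hreg.1.continuousOn hreg'.1.continuousOn
      (fun x t ht hb => (h.equ hf.continuous x t ht hb).le) (fun x t ht hb => (h'.equ hf.continuous x t ht hb).ge)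
      (fun x hx => by
        have h1 := hL (u' x) (h'.memu x) (u x) ⟨(h.memu x).1, (h.memu x).2.trans hMM⟩
        have h2 := (abs_le.1 h1).2
        rwa [abs_of_nonneg (sub_nonneg.2 (hle x))] at h2) ⟨x, hx, hxe⟩
  obtain ⟨y, hy, hy2⟩ := hlt
  exact hy2.ne (h5 y hy)

theorem contDiffOn_pd {w : En n → ℝ} {O : Set (En n)} (hO : IsOpen O) (hw : ContDiffOn ℝ 2 w O) (e : En n) :
    ContDiffOn ℝ 1 (fun y => fderiv ℝ w y e) O := by
  intro x hx
  have : ContDiffAt ℝ 1 (fderiv ℝ w) x := (hw.contDiffAt (hO.mem_nhds hx)).fderiv_right (by norm_num)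
  exact (this.clm_apply contDiffAt_const).contDiffWithinAt

theorem lap_sub {u v : En n → ℝ} {O : Set (En n)} (hO : IsOpen O) (hu : ContDiffOn ℝ 2 u O) (hv : ContDiffOn ℝ 2 v O)
    {x : En n} (hx : x ∈ O) : lap (fun y => u y - v y) x = lap u x - lap v x := by
  unfold lap
  rw [← Finset.sum_sub_distrib]
  refine Finset.sum_congr rfl fun i _ => ?_
  have h1 : (fun y => fderiv ℝ (fun y => u y - v y) y (EuclideanSpace.single i 1)) =ᶠ[𝓝 x]
      fun y => fderiv ℝ u y (EuclideanSpace.single i 1) - fderiv ℝ v y (EuclideanSpace.single i 1) := by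
    filter_upwards [hO.mem_nhds hx] with y hy
    have d1 := ((hu.contDiffAt (hO.mem_nhds hy)).differentiableAt (by norm_num))
    have d2 := ((hv.contDiffAt (hO.mem_nhds hy)).differentiableAt (by norm_num))
    rw [fderiv_fun_sub d1 d2]; rfl
  rw [h1.fderiv_eq]
  have d1 := ((contDiffOn_pd hO hu (EuclideanSpace.single i 1)).contDiffAt (hO.mem_nhds hx)).differentiableAt (by norm_num)
  have d2 := ((contDiffOn_pd hO hv (EuclideanSpace.single i 1)).contDiffAt (hO.mem_nhds hx)).differentiableAt (by norm_num)
  rw [fderiv_fun_sub d1 d2]; rfl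

theorem norm_clm_sq (L : En n →L[ℝ] ℝ) : ‖L‖ ^ 2 = ∑ i, (L (EuclideanSpace.single i 1)) ^ 2 := by
  set a : En n := (InnerProductSpace.toDual ℝ (En n)).symm L
  have h1 : ‖L‖ = ‖a‖ := by simp [a]
  have h2 : ∀ i, L (EuclideanSpace.single i 1) = a i := fun i => by
    have : inner ℝ a (EuclideanSpace.single i 1) = L (EuclideanSpace.single i 1) := by rw [InnerProductSpace.toDual_symm_apply]
    rw [← this]; simp [EuclideanSpace.inner_single_right]
  rw [h1, EuclideanSpace.real_norm_sq_eq]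
  exact Finset.sum_congr rfl fun i _ => by rw [h2]

theorem integral_pd_zero {Y : En n → ℝ} (hY : ContDiff ℝ 1 Y) (hc : HasCompactSupport Y) (e : En n) :
    Integrable (fun x => fderiv ℝ Y x e) ∧ ∫ x, fderiv ℝ Y x e = 0 := by
  have hcont : Continuous (fun x => fderiv ℝ Y x e) := (hY.continuous_fderiv (by norm_num)).clm_apply continuous_const
  have hcs : HasCompactSupport (fun x => fderiv ℝ Y x e) := hc.fderiv_apply (𝕜 := ℝ) e
  have hi := hcont.integrable_of_hasCompactSupport hcs (μ := volume)
  refine ⟨hi, ?_⟩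
  have := integral_mul_fderiv_eq_neg_fderiv_mul_of_integrable (μ := (volume : Measure (En n))) (f := fun _ => (1:ℝ)) (g := Y) (v := e) (by simp)
    (by simpa using hi) (by simpa using hY.continuous.integrable_of_hasCompactSupport hc) (fun y _ => differentiableAt_const _) (fun y _ => hY.differentiable (by norm_num) y)
  simpa using this

theorem picone {w φ c : En n → ℝ} {O : Set (En n)} (hO : IsOpen O) (hw : ContDiffOn ℝ 2 w O) (wpos : ∀ x ∈ O, 0 < w x)
    (hc : ContinuousOn c O) (hlap : ∀ x ∈ O, lap w x = c x * w x) (hφ : ContDiff ℝ ∞ φ) (hφc : HasCompactSupport φ) (hs : tsupport φ ⊆ O) :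
    Integrable (fun x => ‖fderiv ℝ φ x‖ ^ 2 + c x * φ x ^ 2) ∧ 0 ≤ ∫ x, (‖fderiv ℝ φ x‖ ^ 2 + c x * φ x ^ 2) := by
  have hφ2 : ContDiff ℝ 2 φ := hφ.of_le two_le_infty
  have hφ1 : ContDiff ℝ 1 φ := hφ2.of_le (by norm_num)
  let e : Fin n → En n := fun i => EuclideanSpace.single i 1
  let X : Fin n → En n → ℝ := fun i x => φ x * (fderiv ℝ w x (e i) / w x)
  let Y : Fin n → En n → ℝ := fun i x => φ x * X i x
  have hX : ∀ i, ContDiffOn ℝ 1 (X i) O := fun i => hφ1.contDiffOn.mul ((contDiffOn_pd hO hw (e i)).div (hw.of_le (by norm_num)) fun x hx => (wpos x hx).ne')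
  have hY : ∀ i, ContDiff ℝ 1 (Y i) := fun i => cut_contDiff hO (hX i) hφ1 hs
  have hYc : ∀ i, HasCompactSupport (Y i) := fun i => hφc.mul_right
  have hcφ : Continuous (fun x => c x * φ x ^ 2) := by
    have : ContDiff ℝ 0 (fun x => φ x * (c x * φ x)) :=
      cut_contDiff hO (contDiffOn_zero.2 (hc.mul hφ.continuous.continuousOn)) (hφ1.of_le (by norm_num)) hs
    have h2 := this.continuous
    have h3 : (fun x => c x * φ x ^ 2) = fun x => φ x * (c x * φ x) := by ext; ring
    rw [h3]; exact h2
  have hcφs : HasCompactSupport (fun x => c x * φ x ^ 2) := by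
    have : (fun x => c x * φ x ^ 2) = fun x => φ x * (c x * φ x) := by ext; ring
    rw [this]; exact hφc.mul_right
  have hgr : Continuous (fun x => ‖fderiv ℝ φ x‖ ^ 2) := ((hφ1.continuous_fderiv (by norm_num)).norm).pow 2
  have hgrs : HasCompactSupport (fun x => ‖fderiv ℝ φ x‖ ^ 2) := by
    refine (hφc.fderiv (𝕜 := ℝ)).mono fun x hx => ?_
    simp only [Function.mem_support] at *
    intro h; apply hx; rw [h]; simp
  have hI : Integrable (fun x => ‖fderiv ℝ φ x‖ ^ 2 + c x * φ x ^ 2) :=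
    (hgr.integrable_of_hasCompactSupport hgrs).add (hcφ.integrable_of_hasCompactSupport hcφs)
  refine ⟨hI, ?_⟩
  have hz : ∫ x, ∑ i, fderiv ℝ (Y i) x (e i) = 0 := by
    rw [integral_finsetSum _ fun i _ => (integral_pd_zero (hY i) (hYc i) (e i)).1]
    exact Finset.sum_eq_zero fun i _ => (integral_pd_zero (hY i) (hYc i) (e i)).2
  rw [← hz]
  refine integral_mono (integrable_finsetSum _ fun i _ => (integral_pd_zero (hY i) (hYc i) (e i)).1) hI fun x => ?_
  by_cases hx : x ∈ O
  · have hwx := wpos x hx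
    have dY : ∀ i, fderiv ℝ (Y i) x (e i) = 2 * φ x * fderiv ℝ φ x (e i) * (fderiv ℝ w x (e i) / w x)
        + φ x ^ 2 * (fderiv ℝ (fun y => fderiv ℝ w y (e i)) x (e i) / w x - (fderiv ℝ w x (e i) / w x) ^ 2) := by
      intro i
      have dφ : HasFDerivAt φ (fderiv ℝ φ x) x := (hφ1.differentiable (by norm_num) x).hasFDerivAt
      have dw : HasFDerivAt w (fderiv ℝ w x) x := ((hw.contDiffAt (hO.mem_nhds hx)).differentiableAt (by norm_num)).hasFDerivAt
      have dp : HasFDerivAt (fun y => fderiv ℝ w y (e i)) (fderiv ℝ (fun y => fderiv ℝ w y (e i)) x) x :=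
        (((contDiffOn_pd hO hw (e i)).contDiffAt (hO.mem_nhds hx)).differentiableAt (by norm_num)).hasFDerivAt
      have dd := dφ.fun_mul (dφ.fun_mul (dp.fun_mul (((hasDerivAt_inv hwx.ne').comp_hasFDerivAt x dw))))
      have he : Y i = fun y => φ y * (φ y * (fderiv ℝ w y (e i) * (Inv.inv ∘ w) y)) := by
        ext y; simp only [Y, X, Function.comp, div_eq_mul_inv]
      rw [he, dd.fderiv]
      simp
      field_simp
      ring
    show ∑ i, fderiv ℝ (Y i) x (e i) ≤ ‖fderiv ℝ φ x‖ ^ 2 + c x * φ x ^ 2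
    have hcx : c x = lap w x / w x := by rw [hlap x hx]; field_simp
    rw [hcx, norm_clm_sq]
    unfold lap
    rw [div_mul_eq_mul_div, Finset.sum_mul, Finset.sum_div, ← Finset.sum_add_distrib]
    refine Finset.sum_le_sum fun i _ => ?_
    rw [dY i]
    have := sq_nonneg (fderiv ℝ φ x (e i) - φ x * (fderiv ℝ w x (e i) / w x))
    simp only [e] at *
    have h2 : fderiv ℝ (fun y => fderiv ℝ w y (EuclideanSpace.single i 1)) x (EuclideanSpace.single i 1) * φ x ^ 2 / w x
      = φ x ^ 2 * (fderiv ℝ (fun y => fderiv ℝ w y (EuclideanSpace.single i 1)) x (EuclideanSpace.single i 1) / w x) := by ring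
    rw [h2]
    nlinarith
  · have hφ0 : φ =ᶠ[𝓝 x] fun _ => 0 := notMem_tsupport_iff_eventuallyEq.1 fun h => hx (hs h)
    have h1 : ∀ i, fderiv ℝ (Y i) x (e i) = 0 := by
      intro i
      have : Y i =ᶠ[𝓝 x] fun _ => 0 := by
        filter_upwards [hφ0] with y hy; simp [Y, hy]
      rw [this.fderiv_eq]; simp
    show ∑ i, fderiv ℝ (Y i) x (e i) ≤ ‖fderiv ℝ φ x‖ ^ 2 + c x * φ x ^ 2
    rw [Finset.sum_eq_zero fun i _ => h1 i, hφ0.self_of_nhds]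
    simp

theorem Fam.stable {W : ℝ → ℝ} (hW : ContDiff ℝ 2 W) {M l : ℝ} {Ω : Set (En n)} {U : ℕ → En n → ℝ} {u : En n → ℝ} (h : Fam (deriv W) M l Ω U u)
    (hl : 0 < l) (hΩ : IsOpen Ω)
    (hL : ∀ s ∈ Icc 0 M, ∀ s' ∈ Icc 0 M, |deriv W s - deriv W s'| ≤ l * |s - s'|)
    (hlt : ∀ k, ∀ x ∈ Ω, u x < U k x) : IsStable W Ω u := by
  intro φ hφ hφc hs
  set f := deriv W with hfdef
  have hf : ContDiff ℝ 1 f := by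
    have : ContDiff ℝ (1 + 1) W := by norm_num; exact hW
    exact (contDiff_succ_iff_deriv.1 this).2.2
  have hreg := regularity hf h.meas h.memu hΩ (h.equ hf.continuous)
  let c : ℕ → En n → ℝ := fun k x => (f (U k x) - f (u x)) / (U k x - u x)
  have key : ∀ k, Integrable (fun x => ‖fderiv ℝ φ x‖ ^ 2 + c k x * φ x ^ 2) ∧ 0 ≤ ∫ x, (‖fderiv ℝ φ x‖ ^ 2 + c k x * φ x ^ 2) := by
    intro k
    have hregk := regularity hf (h.cont k).measurable (h.mem k) hΩ (h.eqU k)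
    refine picone (w := fun x => U k x - u x) hΩ (hregk.1.sub hreg.1) (fun x hx => sub_pos.2 (hlt k x hx)) ?_ ?_ hφ hφc hs
    · refine ContinuousOn.div ?_ ((h.cont k).continuousOn.sub hreg.1.continuousOn) fun x hx => (sub_pos.2 (hlt k x hx)).ne'
      exact (hf.continuous.comp (h.cont k)).continuousOn.sub (hf.continuous.comp_continuousOn hreg.1.continuousOn)
    · intro x hx
      have : U k x - u x ≠ 0 := (sub_pos.2 (hlt k x hx)).ne'
      rw [lap_sub hΩ hregk.1 hreg.1 hx, hregk.2 x hx, hreg.2 x hx]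
      simp only [c]; field_simp
  have φ0 : ∀ x, x ∉ Ω → φ x = 0 ∧ fderiv ℝ φ x = 0 := by
    intro x hx
    have hφ0 : φ =ᶠ[𝓝 x] fun _ => 0 := notMem_tsupport_iff_eventuallyEq.1 fun h => hx (hs h)
    refine ⟨hφ0.self_of_nhds, by rw [hφ0.fderiv_eq]; simp⟩
  rw [setIntegral_eq_integral_of_forall_compl_eq_zero (fun x hx => by simp [φ0 x hx])]
  have hφ1 : ContDiff ℝ 1 φ := (hφ.of_le two_le_infty).of_le (by norm_num)
  have hgr : Continuous (fun x => ‖fderiv ℝ φ x‖ ^ 2) := ((hφ1.continuous_fderiv (by norm_num)).norm).pow 2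
  have hgrs : HasCompactSupport (fun x => ‖fderiv ℝ φ x‖ ^ 2) := by
    refine (hφc.fderiv (𝕜 := ℝ)).mono fun x hx => ?_
    simp only [Function.mem_support] at *
    intro h; apply hx; rw [h]; simp
  have hsq : Continuous (fun x => l * φ x ^ 2) := by have := hφ.continuous; fun_prop
  have hsqs : HasCompactSupport (fun x => l * φ x ^ 2) := by
    refine hφc.mono fun x hx => ?_
    simp only [Function.mem_support] at *
    intro h; apply hx; rw [h]; simp
  have hlim : Tendsto (fun k => ∫ x, (‖fderiv ℝ φ x‖ ^ 2 + c k x * φ x ^ 2)) atTop (𝓝 (∫ x, (‖fderiv ℝ φ x‖ ^ 2 + deriv f (u x) * φ x ^ 2))) := by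
    refine tendsto_integral_of_dominated_convergence (fun x => ‖fderiv ℝ φ x‖ ^ 2 + l * φ x ^ 2) (fun k => (key k).1.aestronglyMeasurable)
      ((hgr.integrable_of_hasCompactSupport hgrs).add (hsq.integrable_of_hasCompactSupport hsqs)) (fun k => Eventually.of_forall fun x => ?_) (Eventually.of_forall fun x => ?_)
    · refine (norm_add_le _ _).trans ?_
      rw [Real.norm_of_nonneg (by positivity : (0:ℝ) ≤ ‖fderiv ℝ φ x‖ ^ 2), norm_mul, Real.norm_of_nonneg (by positivity : (0:ℝ) ≤ φ x ^ 2)]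
      gcongr
      simp only [c]
      rw [norm_div]
      exact div_le_of_le_mul₀ (norm_nonneg _) hl.le (hL _ (h.mem k x) _ (h.memu x))
    · by_cases hx : x ∈ Ω
      · refine tendsto_const_nhds.add (Tendsto.mul_const _ ?_)
        have hd : HasDerivAt f (deriv f (u x)) (u x) := (hf.differentiable (by norm_num) _).hasDerivAt
        have h1 := hasDerivAt_iff_tendsto_slope.1 hd
        have h2 : Tendsto (fun k => U k x) atTop (𝓝[≠] (u x)) :=
          tendsto_nhdsWithin_iff.2 ⟨h.tend x, Eventually.of_forall fun k => (hlt k x hx).ne'⟩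
        refine (h1.comp h2).congr fun k => ?_
        simp only [Function.comp, slope_def_field, c]
      · simp [φ0 x hx]
  exact ge_of_tendsto' hlim fun k => (key k).2

theorem null_preimage {S : Set (En n)} (hS : volume S = 0) (x : En n) {t : ℝ} (ht : 0 < t) :
    ∀ᵐ y ∂(kB n), x + t • y ∉ S := by
  refine (kB_ac (n := n)).ae_le ?_
  change ∀ᵐ y : En n, x + t • y ∉ S
  rw [ae_iff]
  simp only [not_not]
  have : {y : En n | x + t • y ∈ S} = (fun y => t • y) ⁻¹' ((fun y => x + y) ⁻¹' S) := rfl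
  rw [this, Measure.addHaar_preimage_smul _ ht.ne', measure_preimage_add, hS, mul_zero]

theorem localToGlobal {v H : En n → ℝ} {K : ℝ} {S : Set (En n)} (hv : Continuous v) (bv : BM v) (hH : Continuous H) (bH : BM H)
    (hlow : ∀ x, ∀ t > 0, -(K * t ^ 2) ≤ Av (kA n) t v x - v x) (hS : volume S = 0)
    (hloc : ∀ x ∉ S, ∀ᶠ t in 𝓝[>] (0:ℝ), t ^ 2 * Av (kB n) t H x ≤ Av (kA n) t v x - v x) :
    ∀ τ > 0, ∀ x, v x ≤ Av (kA n) τ v x - τ ^ 2 * Av (kB n) τ H x := by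
  intro τ hτ x
  obtain ⟨CH, hCH⟩ := bH.2
  have hBp := BB_pos (n := n)
  have avH : ∀ t y, |Av (kB n) t H y| ≤ BB n * CH := by
    intro t y
    rw [abs_le]
    constructor
    · have := av_mono (BM.const (-CH)) bH (fun y => (abs_le.1 (hCH y)).1) (kB n) t y
      rw [avB_const] at this; linarith
    · have := av_mono bH (BM.const (CH)) (fun y => (abs_le.1 (hCH y)).2) (kB n) t y
      rwa [avB_const] at this
  let e : ℝ → En n → ℝ := fun t y => (Av (kA n) t v y - v y) / t ^ 2
  let g : ℝ → En n → ℝ := fun t y => min (e t y) (Av (kB n) t H y)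
  have be : ∀ t, BM (e t) := fun t => by
    have := ((bv.av (kA n) t).sub bv).const_mul (1 / t ^ 2)
    have h2 : e t = fun x => 1 / t ^ 2 * (Av (kA n) t v x - v x) := by ext; simp only [e]; ring
    rw [h2]; exact this
  have hgb : ∀ t > 0, ∀ y, |g t y| ≤ |K| + BB n * CH := by
    intro t ht y
    have h1 := avH t y
    have h0 : 0 ≤ BB n * CH := (abs_nonneg _).trans h1
    have h2 : -K ≤ e t y := by
      simp only [e]; rw [le_div_iff₀ (by positivity)]; have := hlow y t ht; linarith
    have h3 := neg_abs_le K
    have h4 := le_abs_self K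
    have h5 := abs_nonneg K
    rw [abs_le] at h1 ⊢
    refine ⟨le_min (by linarith) (by linarith), (min_le_right _ _).trans (by linarith)⟩
  have gm : ∀ t, Measurable (g t) := fun t => (be t).1.min (bH.av (kB n) t).1
  have l1 : Tendsto (fun t => Av (kB n) τ (g t) x) (𝓝[>] (0:ℝ)) (𝓝 (Av (kB n) τ (fun y => BB n * H y) x)) := by
    unfold Av
    refine tendsto_integral_filter_of_dominated_convergence (fun _ => |K| + BB n * CH) (Eventually.of_forall fun t => ((gm t).comp (by fun_prop)).aestronglyMeasurable) ?_ (integrable_const _) ?_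
    · filter_upwards [self_mem_nhdsWithin] with t ht
      exact Eventually.of_forall fun y => hgb t ht _
    · filter_upwards [null_preimage hS x hτ] with y hy
      refine (avB_tendsto bH hH.continuousAt (x := x + τ • y)).congr' ?_
      filter_upwards [hloc _ hy, self_mem_nhdsWithin] with t h1 ht
      have ht2 : 0 < t ^ 2 := pow_pos ht 2
      refine (min_eq_right ?_).symm
      simp only [e]
      rw [le_div_iff₀ ht2]; linarith
  have hA : Continuous (Av (kA n) τ v) := by
    obtain ⟨C, hC⟩ := bv.2
    refine continuous_of_dominated (bound := fun _ => C) (fun x => (bv.1.comp (by fun_prop)).aestronglyMeasurable) (fun x => Eventually.of_forall fun y => hC _) (integrable_const _)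
      (Eventually.of_forall fun y => by fun_prop)
  have l2 := avB_tendsto ((bv.av (kA n) τ).sub bv) (hA.sub hv).continuousAt (x := x)
  have hle : ∀ᶠ t in 𝓝[>] (0:ℝ), τ ^ 2 * Av (kB n) τ (g t) x ≤ Av (kB n) t (fun y => Av (kA n) τ v y - v y) x := by
    filter_upwards [self_mem_nhdsWithin] with t ht
    have ht2 : 0 < t ^ 2 := pow_pos ht 2
    have ht0 : t ≠ 0 := ne_of_gt ht
    have h6 := A6 bv τ t x
    rw [av_sub (bv.av _ _) bv]
    have h7 : Av (kB n) τ (g t) x ≤ Av (kB n) τ (e t) x :=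
      av_mono ⟨gm t, _, hgb t ht⟩ (be t) (fun y => min_le_left _ _) _ _ _
    have h8 : t ^ 2 * Av (kB n) τ (e t) x = Av (kB n) τ (Av (kA n) t v) x - Av (kB n) τ v x := by
      rw [← av_mul, ← av_sub (bv.av _ _) bv]
      congr 1; ext y; simp only [e]; field_simp
    have h9 : t ^ 2 * (τ ^ 2 * Av (kB n) τ (g t) x) ≤ t ^ 2 * (Av (kB n) t (Av (kA n) τ v) x - Av (kB n) t v x) := by
      have : t ^ 2 * (Av (kB n) t (Av (kA n) τ v) x - Av (kB n) t v x) = τ ^ 2 * (t ^ 2 * Av (kB n) τ (e t) x) := by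
        rw [h8]; linarith
      rw [this]
      have := mul_le_mul_of_nonneg_left h7 (by positivity : 0 ≤ t ^ 2 * τ ^ 2)
      linarith
    exact le_of_mul_le_mul_left h9 ht2
  have := le_of_tendsto_of_tendsto (l1.const_mul (τ ^ 2)) l2 hle
  rw [av_mul] at this
  have h3 : BB n * (τ ^ 2 * Av (kB n) τ H x) ≤ BB n * (Av (kA n) τ v x - v x) := by linarith
  have := le_of_mul_le_mul_left h3 hBp
  linarith

theorem kA_lin (a : En n) : ∫ y, inner ℝ a y ∂(kA n) = 0 := by
  have hc : ContDiff ℝ 2 (fun y : En n => inner ℝ a y) := contDiff_const.inner ℝ contDiff_id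
  have := A3 (φ := fun y : En n => inner ℝ a y) isOpen_univ hc.contDiffOn (x := 0) (t := 1) (by norm_num) (subset_univ _)
  have hl : ∀ z, lap (fun y : En n => inner ℝ a y) z = 0 := by
    intro z
    unfold lap
    refine Finset.sum_eq_zero fun i _ => ?_
    have : (fun y => fderiv ℝ (fun y : En n => inner ℝ a y) y (EuclideanSpace.single i 1)) = fun y => innerSL ℝ a (EuclideanSpace.single i 1) := by
      ext y
      have h : HasFDerivAt (fun y : En n => inner ℝ a y) (innerSL ℝ a) y := (innerSL ℝ a).hasFDerivAt
      rw [h.fderiv]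
    rw [this]; simp
  simp only [hl] at this
  simpa using this

theorem low_of_quad {v : En n → ℝ} (bv : BM v) {K : ℝ} (hK : 0 ≤ K) {x : En n} (h : ∃ a : En n, ∀ y, v x + inner ℝ a y - K * ‖y‖ ^ 2 ≤ v (x + y)) (t : ℝ) (ht : 0 < t) :
    -(K * t ^ 2) ≤ Av (kA n) t v x - v x := by
  obtain ⟨a, ha⟩ := h
  have hi : Integrable (fun y => inner ℝ a y) (kA n) := by
    refine Integrable.mono' (g := fun _ => ‖a‖) (integrable_const _) (by fun_prop) ?_
    filter_upwards [kA_norm (n := n)] with y hy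
    exact (norm_inner_le_norm a y).trans (by nlinarith [norm_nonneg a])
  have h1 : ∫ y, (v x - K * t ^ 2 + t * inner ℝ a y) ∂(kA n) = v x - K * t ^ 2 := by
    rw [integral_add (integrable_const _) (hi.const_mul _), integral_const_mul, kA_lin]
    simp
  have h2 : ∫ y, (v x - K * t ^ 2 + t * inner ℝ a y) ∂(kA n) ≤ Av (kA n) t v x := by
    refine integral_mono_ae ((integrable_const _).add (hi.const_mul _)) (bv.int _ _ _) ?_
    filter_upwards [kA_norm (n := n)] with y hy
    have h3 := ha (t • y)
    rw [inner_smul_right, norm_smul, Real.norm_of_nonneg ht.le, mul_pow] at h3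
    have h4 : K * (t ^ 2 * ‖y‖ ^ 2) ≤ K * t ^ 2 := by
      have : ‖y‖ ^ 2 ≤ 1 := by nlinarith [norm_nonneg y]
      have h5 : t ^ 2 * ‖y‖ ^ 2 ≤ t ^ 2 * 1 := mul_le_mul_of_nonneg_left this (by positivity)
      rw [mul_one] at h5
      exact mul_le_mul_of_nonneg_left h5 hK
    linarith
  linarith

structure Prof (f : ℝ → ℝ) (c κ B N L : ℝ) (p q : ℝ → ℝ) : Prop where
  hp : ∀ s, HasDerivAt p (q s) s
  hq : ∀ a b, |q a - q b| ≤ N * |a - b|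
  q0 : ∀ s, q s ≤ 0
  qB : ∀ s, -B ≤ q s
  left : ∀ s ≤ 0, q s = 0 ∧ p s = c
  right : ∀ s ≥ L, p s ≤ 0
  mid : ∀ s ∈ Ioo 0 L, HasDerivAt q (f (p s) + κ / 2) s ∧ 0 < p s
  L0 : 0 < L

theorem Prof.anti {f : ℝ → ℝ} {c κ B N L : ℝ} {p q : ℝ → ℝ} (h : Prof f c κ B N L p q) : Antitone p :=
  antitone_of_deriv_nonpos (fun s => (h.hp s).differentiableAt) fun s => by rw [(h.hp s).deriv]; exact h.q0 s

theorem Prof.quad {f : ℝ → ℝ} {c κ B N L : ℝ} {p q : ℝ → ℝ} (h : Prof f c κ B N L p q) (hN : 0 ≤ N) (a b : ℝ) :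
    p a + q a * (b - a) - N * (b - a) ^ 2 ≤ p b := by
  have hc : Continuous p := continuous_iff_continuousAt.2 fun s => (h.hp s).continuousAt
  rcases lt_trichotomy a b with hab | hab | hab
  · obtain ⟨ξ, hξ, he⟩ := exists_hasDerivAt_eq_slope p q hab hc.continuousOn fun s _ => h.hp s
    have hba : 0 < b - a := sub_pos.2 hab
    rw [eq_div_iff hba.ne'] at he
    have h1 := (abs_le.1 (h.hq ξ a)).1
    rw [abs_of_nonneg (by linarith [hξ.1])] at h1
    have h2 : N * (ξ - a) ≤ N * (b - a) := mul_le_mul_of_nonneg_left (by linarith [hξ.2]) hN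
    nlinarith
  · subst hab; simp
  · obtain ⟨ξ, hξ, he⟩ := exists_hasDerivAt_eq_slope p q hab hc.continuousOn fun s _ => h.hp s
    have hba : 0 < a - b := sub_pos.2 hab
    rw [eq_div_iff hba.ne'] at he
    have h1 := (abs_le.1 (h.hq ξ a)).2
    rw [abs_of_nonpos (by linarith [hξ.2])] at h1
    have h2 : N * (a - ξ) ≤ N * (a - b) := mul_le_mul_of_nonneg_left (by linarith [hξ.1]) hN
    nlinarith

def radv (p : ℝ → ℝ) (r0 : ℝ) (x : En n) : ℝ := max (p (‖x‖ - r0)) 0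

theorem norm_add_le_lin {x : En n} (hx : 0 < ‖x‖) (y : En n) : ‖x + y‖ - ‖x‖ ≤ inner ℝ x y / ‖x‖ + ‖y‖ ^ 2 / (2 * ‖x‖) := by
  have h1 := norm_add_sq_real x y
  have h2 : 0 ≤ (‖x + y‖ - ‖x‖) ^ 2 := sq_nonneg _
  have : inner ℝ x y / ‖x‖ + ‖y‖ ^ 2 / (2 * ‖x‖) = (2 * inner ℝ x y + ‖y‖ ^ 2) / (2 * ‖x‖) := by field_simp
  rw [this, le_div_iff₀ (by positivity)]
  nlinarith

theorem Prof.contDiffOn {f : ℝ → ℝ} (hf : Continuous f) {c κ B N L : ℝ} {p q : ℝ → ℝ} (h : Prof f c κ B N L p q) : ContDiffOn ℝ 2 p (Ioo 0 L) := by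
  have hc : Continuous p := continuous_iff_continuousAt.2 fun s => (h.hp s).continuousAt
  have hd : deriv p = q := funext fun s => (h.hp s).deriv
  have h1 : ContDiffOn ℝ 1 q (Ioo 0 L) := by
    rw [show (1 : WithTop ℕ∞) = 0 + 1 by norm_num, contDiffOn_succ_iff_deriv_of_isOpen isOpen_Ioo]
    refine ⟨fun s hs => (h.mid s hs).1.differentiableAt.differentiableWithinAt, by simp, ?_⟩
    rw [contDiffOn_zero]
    refine ContinuousOn.congr (f := fun s => f (p s) + κ / 2) (by fun_prop) fun s hs => (h.mid s hs).1.deriv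
  rw [show (2 : WithTop ℕ∞) = 1 + 1 by norm_num, contDiffOn_succ_iff_deriv_of_isOpen isOpen_Ioo]
  refine ⟨fun s hs => (h.hp s).differentiableAt.differentiableWithinAt, by simp, ?_⟩
  rw [hd]; exact h1

theorem lap_prof {f : ℝ → ℝ} {c κ B N L r0 : ℝ} (hr0 : 0 < r0) {p q : ℝ → ℝ} (h : Prof f c κ B N L p q)
    {x : En n} (hx : ‖x‖ - r0 ∈ Ioo 0 L) :
    lap (fun y : En n => p (‖y‖ - r0)) x = f (p (‖x‖ - r0)) + κ / 2 + (n - 1) * q (‖x‖ - r0) / ‖x‖ := by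
  have hxp : 0 < ‖x‖ := by have := hx.1; linarith
  have hx2 : 0 < ‖x‖ ^ 2 := by positivity
  have hfun : (fun y : En n => p (‖y‖ - r0)) = fun y => (fun s => p (Real.sqrt s - r0)) (‖y - 0‖ ^ 2) := by
    ext y; simp [Real.sqrt_sq (norm_nonneg y)]
  rw [hfun]
  have hsq : Real.sqrt (‖x‖ ^ 2) = ‖x‖ := Real.sqrt_sq (norm_nonneg x)
  have ds : ∀ s : ℝ, 0 < s → HasDerivAt (fun s => Real.sqrt s - r0) (1 / (2 * Real.sqrt s)) s := fun s hs =>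
    (Real.hasDerivAt_sqrt hs.ne').sub_const r0
  have d1 : ∀ᶠ s in 𝓝 (‖x - 0‖ ^ 2), HasDerivAt (fun s => p (Real.sqrt s - r0)) (q (Real.sqrt s - r0) * (1 / (2 * Real.sqrt s))) s := by
    rw [sub_zero]
    filter_upwards [lt_mem_nhds hx2] with s hs
    exact (h.hp _).comp s (ds s hs)
  have d2 : HasDerivAt (fun s => q (Real.sqrt s - r0) * (1 / (2 * Real.sqrt s)))
      ((f (p (‖x‖ - r0)) + κ / 2) * (1 / (2 * ‖x‖)) * (1 / (2 * ‖x‖)) + q (‖x‖ - r0) * (-(2 * (1 / (2 * ‖x‖))) / (2 * ‖x‖) ^ 2)) (‖x - 0‖ ^ 2) := by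
    rw [sub_zero]
    have e1 : HasDerivAt (fun s => q (Real.sqrt s - r0)) ((f (p (‖x‖ - r0)) + κ / 2) * (1 / (2 * ‖x‖))) (‖x‖ ^ 2) := by
      have := ds _ hx2
      rw [hsq] at this
      refine HasDerivAt.comp (‖x‖ ^ 2) ?_ this
      rw [hsq]; exact (h.mid _ hx).1
    have e2 : HasDerivAt (fun s => 1 / (2 * Real.sqrt s)) (-(2 * (1 / (2 * ‖x‖))) / (2 * ‖x‖) ^ 2) (‖x‖ ^ 2) := by
      have := ((Real.hasDerivAt_sqrt hx2.ne').const_mul 2).inv (by rw [hsq]; positivity)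
      rw [hsq] at this
      have h0 : (fun s => 1 / (2 * Real.sqrt s)) = (fun y => 2 * Real.sqrt y)⁻¹ := by
        funext s; simp [one_div]
      rw [h0]
      exact this
    have e3 := e1.mul e2
    rw [hsq] at e3
    exact e3
  rw [lap_radial d1 d2, sub_zero, hsq]
  field_simp
  ring

theorem radv_sub {f : ℝ → ℝ} (hf : Continuous f) {c κ B N L r0 : ℝ} (hr0 : 0 < r0) {p q : ℝ → ℝ} (h : Prof f c κ B N L p q)
    (hN : 0 ≤ N) (hB : 0 ≤ B) (hc : 0 < c) (fc : f c ≤ 0) (f0 : f 0 ≤ 0) (hr : n * B / r0 ≤ κ / 2) :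
    Continuous (radv (n := n) p r0) ∧ (∀ x : En n, radv p r0 x ∈ Icc 0 c) ∧
    ∀ τ > 0, ∀ x : En n, radv p r0 x ≤ Av (kA n) τ (radv p r0) x - τ ^ 2 * Av (kB n) τ (fun y => f (radv p r0 y)) x := by
  have hpc : Continuous p := continuous_iff_continuousAt.2 fun s => (h.hp s).continuousAt
  have hcont : Continuous (radv (n := n) p r0) := by unfold radv; fun_prop
  have hmem : ∀ x : En n, radv p r0 x ∈ Icc 0 c := by
    intro x
    refine ⟨le_max_right _ _, max_le ?_ hc.le⟩
    rcases le_total (‖x‖ - r0) 0 with h1 | h1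
    · exact (h.left _ h1).2.le
    · rw [← (h.left 0 le_rfl).2]; exact h.anti h1
  have bv := BM.of_Icc hcont.measurable hmem
  have bH := BM.comp_cont hf hcont.measurable hmem
  refine ⟨hcont, hmem, ?_⟩
  set K : ℝ := N + B / (2 * r0) with hK
  have hK0 : 0 ≤ K := by positivity
  refine localToGlobal (K := K) (S := sphere (0 : En n) r0 ∪ sphere (0 : En n) (r0 + L)) hcont bv (hf.comp hcont) bH ?_ ?_ ?_
  · intro x t ht
    refine low_of_quad bv hK0 ?_ t ht
    by_cases hv0 : p (‖x‖ - r0) ≤ 0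
    · refine ⟨0, fun y => ?_⟩
      have : radv p r0 x = 0 := max_eq_right hv0
      rw [this, inner_zero_left]
      have h1 := (hmem (x + y)).1
      have : 0 ≤ K * ‖y‖ ^ 2 := by positivity
      linarith
    · push Not at hv0
      have hvx : radv p r0 x = p (‖x‖ - r0) := max_eq_left hv0.le
      refine ⟨(q (‖x‖ - r0) / ‖x‖) • x, fun y => ?_⟩
      rw [hvx]
      refine le_trans ?_ (le_max_left _ _)
      have h1 := h.quad hN (‖x‖ - r0) (‖x + y‖ - r0)
      have h2 : (‖x + y‖ - r0 - (‖x‖ - r0)) = ‖x + y‖ - ‖x‖ := by ring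
      rw [h2] at h1
      have h3 : (‖x + y‖ - ‖x‖) ^ 2 ≤ ‖y‖ ^ 2 := by
        have := abs_norm_sub_norm_le (x + y) x
        rw [add_sub_cancel_left] at this
        rw [← sq_abs]; exact pow_le_pow_left₀ (abs_nonneg _) this 2
      have h4 : N * (‖x + y‖ - ‖x‖) ^ 2 ≤ N * ‖y‖ ^ 2 := mul_le_mul_of_nonneg_left h3 hN
      rw [real_inner_smul_left]
      rcases le_total ‖x‖ r0 with hxr | hxr
      · have hq := (h.left (‖x‖ - r0) (by linarith)).1
        rw [hq] at h1 ⊢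
        have : 0 ≤ B / (2 * r0) * ‖y‖ ^ 2 := by positivity
        rw [hK, add_mul]; simp only [zero_mul, zero_div] at *; linarith
      · have hxp : 0 < ‖x‖ := lt_of_lt_of_le hr0 hxr
        have h5 := norm_add_le_lin hxp y
        have hq0 := h.q0 (‖x‖ - r0)
        have hqB := h.qB (‖x‖ - r0)
        have h6 := mul_le_mul_of_nonpos_left h5 hq0
        have h7 : q (‖x‖ - r0) * (inner ℝ x y / ‖x‖ + ‖y‖ ^ 2 / (2 * ‖x‖)) = q (‖x‖ - r0) / ‖x‖ * inner ℝ x y + q (‖x‖ - r0) * (‖y‖ ^ 2 / (2 * ‖x‖)) := by ring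
        have h8 : -(B / (2 * r0) * ‖y‖ ^ 2) ≤ q (‖x‖ - r0) * (‖y‖ ^ 2 / (2 * ‖x‖)) := by
          have h9 : ‖y‖ ^ 2 / (2 * ‖x‖) ≤ ‖y‖ ^ 2 / (2 * r0) := by gcongr
          have h10 : 0 ≤ ‖y‖ ^ 2 / (2 * ‖x‖) := by positivity
          have h11 : B / (2 * r0) * ‖y‖ ^ 2 = B * (‖y‖ ^ 2 / (2 * r0)) := by ring
          rw [h11]
          have h12 := mul_le_mul_of_nonneg_left h9 hB
          nlinarith
        rw [hK, add_mul]
        linarith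
  · refine measure_union_null ?_ ?_
    · exact Measure.addHaar_sphere_of_ne_zero _ _ hr0.ne'
    · exact Measure.addHaar_sphere_of_ne_zero _ _ (by have := h.L0; positivity)
  · intro x hx
    simp only [mem_union, mem_sphere, dist_zero_right, not_or] at hx
    have const_case : ∀ d : ℝ, f d ≤ 0 → (∀ᶠ y in 𝓝 x, radv p r0 y = d) →
        ∀ᶠ t in 𝓝[>] (0:ℝ), t ^ 2 * Av (kB n) t (f ∘ radv p r0) x ≤ Av (kA n) t (radv p r0) x - radv p r0 x := by
      intro d hd hev
      obtain ⟨δ, hδ, hb⟩ := Metric.eventually_nhds_iff_ball.1 hev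
      filter_upwards [Ioo_mem_nhdsGT hδ] with t ht
      have hsub : closedBall x t ⊆ ball x δ := closedBall_subset_ball ht.2
      rw [av_congr_ball (w := fun _ => f d) kB_norm ht.1.le fun y hy => by simp [hb y (hsub hy)], av_congr_ball (w := fun _ => d) kA_norm ht.1.le fun y hy => hb y (hsub hy),
        avA_const, avB_const, hb x (mem_ball_self hδ)]
      have := mul_nonneg (sq_nonneg t) (mul_nonneg BB_pos.le (neg_nonneg.2 hd) : 0 ≤ BB n * (- f d))
      linarith
    have hnc : ContinuousAt (fun y : En n => ‖y‖) x := continuous_norm.continuousAt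
    rcases lt_or_gt_of_ne hx.1 with h1 | h1
    · refine const_case c fc ?_
      filter_upwards [hnc.eventually (gt_mem_nhds h1)] with y hy
      unfold radv
      rw [(h.left _ (by linarith)).2]; exact max_eq_left hc.le
    · rcases lt_or_gt_of_ne hx.2 with h2 | h2
      · set O : Set (En n) := {y | ‖y‖ - r0 ∈ Ioo 0 L} with hO
        have hOo : IsOpen O := isOpen_Ioo.preimage (by fun_prop : Continuous fun y : En n => ‖y‖ - r0)
        have hxO : x ∈ O := ⟨by linarith, by linarith⟩
        have hV : ContDiffOn ℝ 2 (fun y : En n => p (‖y‖ - r0)) O := by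
          refine (h.contDiffOn hf).comp (t := Ioo 0 L) (f := fun y : En n => ‖y‖ - r0) ?_ fun y hy => hy
          intro y hy
          have : y ≠ 0 := by
            rintro rfl; have := hy.1; simp at this; linarith
          exact ((contDiffAt_norm ℝ this).sub contDiffAt_const).contDiffWithinAt
        obtain ⟨δ, hδ, hb⟩ := Metric.isOpen_iff.1 hOo x hxO
        have hveq : ∀ y ∈ O, radv p r0 y = p (‖y‖ - r0) := fun y hy => max_eq_left (h.mid _ hy).2.le
        filter_upwards [Ioo_mem_nhdsGT hδ] with t ht
        have hsub : closedBall x t ⊆ O := (closedBall_subset_ball ht.2).trans hb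
        have e1 := A3 hOo hV ht.1.le hsub
        have e2 : Av (kA n) t (radv p r0) x = ∫ y, p (‖x + t • y‖ - r0) ∂(kA n) :=
          av_congr_ball (w := fun y => p (‖y‖ - r0)) kA_norm ht.1.le fun y hy => hveq y (hsub hy)
        rw [e2, e1, hveq x hxO, add_sub_cancel_left]
        refine mul_le_mul_of_nonneg_left ?_ (sq_nonneg t)
        have hmemO : ∀ y : En n, ‖y‖ ≤ 1 → x + t • y ∈ O := fun y hy => hsub (by
          rw [mem_closedBall, dist_eq_norm, add_sub_cancel_left, norm_smul, Real.norm_of_nonneg ht.1.le]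
          nlinarith [ht.1])
        have hqc : Continuous q := by
          refine (LipschitzWith.of_dist_le_mul (K := ⟨N, hN⟩) fun a b => ?_).continuous
          rw [Real.dist_eq, Real.dist_eq]; exact h.hq a b
        have hint : Integrable (fun y => lap (fun y : En n => p (‖y‖ - r0)) (x + t • y)) (kB n) := by
          have hG : BM (fun z : En n => (n - 1) * (q (‖z‖ - r0) / max ‖z‖ r0)) := by
            refine BM.const_mul (v := fun z : En n => q (‖z‖ - r0) / max ‖z‖ r0) ⟨?_, B / r0, fun z => ?_⟩ _
            · have : Continuous (fun z : En n => q (‖z‖ - r0) / max ‖z‖ r0) := by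
                refine Continuous.div (by fun_prop) (by fun_prop) fun z => ?_
                exact (lt_of_lt_of_le hr0 (le_max_right _ _)).ne'
              exact this.measurable
            · have h1 : r0 ≤ max ‖z‖ r0 := le_max_right _ _
              rw [abs_div, abs_of_pos (lt_of_lt_of_le hr0 h1)]
              have h2 : |q (‖z‖ - r0)| ≤ B := by
                rw [abs_le]; exact ⟨h.qB _, (h.q0 _).trans hB⟩
              gcongr
          have hG2 := (bH.add (BM.const (κ / 2))).add hG
          refine (hG2.int (kB n) x t).congr ?_
          filter_upwards [kB_norm (n := n)] with y hy
          have hyO := hmemO y hy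
          have hz : r0 < ‖x + t • y‖ := by have := hyO.1; linarith
          rw [lap_prof hr0 h hyO, hveq _ hyO, max_eq_left hz.le]
          ring
        · refine integral_mono_ae (bH.int _ _ _) hint ?_
          filter_upwards [kB_norm (n := n)] with y hy
          have hyO : x + t • y ∈ O := hsub (by
            rw [mem_closedBall, dist_eq_norm, add_sub_cancel_left, norm_smul, Real.norm_of_nonneg ht.1.le]
            nlinarith [ht.1])
          rw [lap_prof hr0 h hyO, hveq _ hyO]
          set z := x + t • y
          have hz : r0 < ‖z‖ := by have := hyO.1; linarith
          have hz0 : 0 < ‖z‖ := hr0.trans hz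
          have hq0 := h.q0 (‖z‖ - r0)
          have hqB := h.qB (‖z‖ - r0)
          have h5 : -(n * B / r0) ≤ (n - 1) * q (‖z‖ - r0) / ‖z‖ := by
            have h6 : (n - 1) * q (‖z‖ - r0) / ‖z‖ = (n * q (‖z‖ - r0)) / ‖z‖ + (- q (‖z‖ - r0)) / ‖z‖ := by ring
            have h7 : 0 ≤ (- q (‖z‖ - r0)) / ‖z‖ := div_nonneg (by linarith) hz0.le
            have h8 : n * B / ‖z‖ ≤ n * B / r0 := by gcongr
            have h9 : -(n * B / ‖z‖) ≤ (n * q (‖z‖ - r0)) / ‖z‖ := by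
              rw [← neg_div]; gcongr
              have : (0:ℝ) ≤ n := by positivity
              nlinarith
            linarith
          linarith
      · refine const_case 0 f0 ?_
        filter_upwards [hnc.eventually (lt_mem_nhds h2)] with y hy
        unfold radv
        exact max_eq_right (h.right _ (by linarith))

theorem ode2 {g : ℝ → ℝ} {K : NNReal} (hK : LipschitzWith K g) {N : ℝ} (hN : ∀ t, |g t| ≤ N) (c : ℝ) {T : ℝ} (hT : 0 < T) :
    ∃ p q : ℝ → ℝ, p 0 = c ∧ q 0 = 0 ∧ ∀ s ∈ Ioo (-T) T, HasDerivAt p (q s) s ∧ HasDerivAt q (g (p s)) s := by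
  have hN0 : 0 ≤ N := (abs_nonneg _).trans (hN 0)
  set B := N * T with hB
  have hB0 : 0 ≤ B := by positivity
  let cl : ℝ → ℝ := fun q => max (-B) (min q B)
  have hcl : LipschitzWith 1 cl := (LipschitzWith.id.min_const B).const_max (-B)
  have hclB : ∀ q, |cl q| ≤ B := fun q => abs_le.2 ⟨le_max_left _ _, max_le (by linarith) (min_le_right _ _)⟩
  have hcli : ∀ q, |q| ≤ B → cl q = q := fun q hq => by
    have := abs_le.1 hq
    simp only [cl]; rw [min_eq_left this.2, max_eq_right this.1]
  let G : ℝ × ℝ → ℝ × ℝ := fun z => (cl z.2, g z.1)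
  have hG : LipschitzWith (max (1 * 1) (K * 1)) G := (hcl.comp LipschitzWith.prod_snd).prodMk (hK.comp LipschitzWith.prod_fst)
  have hb : ∀ z, ‖G z‖ ≤ B + N := fun z => by
    rw [Prod.norm_def]
    exact max_le ((hclB _).trans (by linarith)) ((hN _).trans (by linarith))
  have hpl : IsPicardLindelof (fun _ => G) (tmin := -T) (tmax := T) ⟨0, by constructor <;> linarith⟩ (c, (0:ℝ)) ⟨(B + N) * T, by positivity⟩ 0 ⟨B + N, by positivity⟩ (max (1 * 1) (K * 1)) := by
    refine IsPicardLindelof.of_time_independent (fun z _ => hb z) hG.lipschitzOnWith ?_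
    simp
    exact le_rfl
  obtain ⟨α, h0, hα⟩ := hpl.exists_eq_forall_mem_Icc_hasDerivWithinAt₀
  have hd : ∀ s ∈ Ioo (-T) T, HasDerivAt α (G (α s)) s := fun s hs =>
    (hα s (Ioo_subset_Icc_self hs)).hasDerivAt (Icc_mem_nhds hs.1 hs.2)
  have hd1 : ∀ s ∈ Ioo (-T) T, HasDerivAt (fun s => (α s).1) (cl (α s).2) s := fun s hs => (hd s hs).fst
  have hd2 : ∀ s ∈ Ioo (-T) T, HasDerivAt (fun s => (α s).2) (g (α s).1) s := fun s hs => (hd s hs).snd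
  have h01 : (α 0).1 = c := by rw [show α 0 = (c, 0) from h0]
  have h02 : (α 0).2 = 0 := by rw [show α 0 = (c, 0) from h0]
  refine ⟨fun s => (α s).1, fun s => (α s).2, h01, h02, fun s hs => ⟨?_, hd2 s hs⟩⟩
  have hq : |(α s).2| ≤ B := by
    have := (convex_Ioo (-T) T).norm_image_sub_le_of_norm_hasDerivWithin_le (f := fun s => (α s).2) (f' := fun s => g (α s).1) (C := N)
      (fun x hx => (hd2 x hx).hasDerivWithinAt) (fun x hx => hN _) (x := 0) (y := s) (by constructor <;> linarith) hs
    simp only [h02, sub_zero, Real.norm_eq_abs] at this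
    refine this.trans ?_
    exact mul_le_mul_of_nonneg_left (abs_le.2 ⟨hs.1.le, hs.2.le⟩) hN0
  have := hd1 s hs
  rwa [hcli _ hq] at this

theorem prof_exists {f g V : ℝ → ℝ} {K : NNReal} (hK : LipschitzWith K g) {N c κ : ℝ} (hN : ∀ t, |g t| ≤ N) (hc : 0 < c) (hκ : 0 < κ)
    (hgf : ∀ t ∈ Icc 0 c, g t = f t + κ / 2) (hgc : g c < 0) (hV : ∀ t, HasDerivAt V (g t) t) (hVc : V c = 0)
    (hVl : ∀ t ∈ Icc 0 c, κ / 2 * (c - t) ≤ V t) :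
    ∃ B L p q, 0 ≤ B ∧ Prof f c κ B N L p q ∧ p L = 0 ∧ ∀ s ∈ Ioo 0 L, q s ^ 2 = 2 * V (p s) := by
  have hN0 : 0 ≤ N := (abs_nonneg _).trans (hN 0)
  set T : ℝ := 2 * (Real.sqrt c / Real.sqrt κ) + 1 with hTd
  have hsκ : 0 < Real.sqrt κ := Real.sqrt_pos.2 hκ
  have hT : 0 < T := by positivity
  obtain ⟨p, q, hp0, hq0, hd⟩ := ode2 hK hN c hT
  have hin : ∀ s ∈ Ico 0 T, s ∈ Ioo (-T) T := fun s hs => ⟨by linarith [hs.1], hs.2⟩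
  have hz : (0:ℝ) ∈ Ioo (-T) T := ⟨by linarith, hT⟩
  have pc : ContinuousOn p (Ioo (-T) T) := fun s hs => (hd s hs).1.continuousAt.continuousWithinAt
  have qc : ContinuousOn q (Ioo (-T) T) := fun s hs => (hd s hs).2.continuousAt.continuousWithinAt
  -- energy
  have hE : ∀ s ∈ Ioo (-T) T, q s ^ 2 = 2 * V (p s) := by
    intro s hs
    have hdE : ∀ s ∈ Ioo (-T) T, HasDerivWithinAt (fun s => q s ^ 2 - 2 * V (p s)) 0 (Ioo (-T) T) s := by
      intro s hs
      have h1 := ((hd s hs).2.pow 2).sub (((hV (p s)).comp s (hd s hs).1).const_mul 2)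
      refine (h1.congr_deriv ?_).hasDerivWithinAt
      simp; ring
    have := (convex_Ioo (-T) T).norm_image_sub_le_of_norm_hasDerivWithin_le hdE (C := 0) (fun x hx => by simp) hz hs
    simp only [zero_mul, norm_le_zero_iff, hq0, hp0, hVc] at this
    linarith
  -- sign of q
  have hX : ∀ S ∈ Ioo 0 T, (∀ s ∈ Icc 0 S, 0 ≤ p s) → ∀ s ∈ Ioc 0 S, q s < 0 ∧ p s < c := by
    intro S hS hpos
    obtain ⟨δ, hδ, hqδ⟩ : ∃ δ > 0, ∀ s ∈ Ioo 0 δ, q s < 0 := by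
      have h1 := (hd 0 hz).2
      rw [hp0] at h1
      have h2 := (hasDerivAt_iff_tendsto_slope.1 h1).eventually (gt_mem_nhds hgc)
      rw [eventually_nhdsWithin_iff, Metric.eventually_nhds_iff_ball] at h2
      obtain ⟨δ, hδ, h3⟩ := h2
      refine ⟨δ, hδ, fun s hs => ?_⟩
      have h4 := h3 s (by rw [mem_ball, Real.dist_eq, sub_zero, abs_of_pos hs.1]; exact hs.2) (ne_of_gt hs.1)
      rw [slope_def_field, hq0, sub_zero, sub_zero] at h4
      by_contra hcon
      push Not at hcon
      exact absurd (div_nonneg hcon hs.1.le) (not_le.2 h4)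
    have hdec : ∀ a ∈ Ioc 0 S, (∀ s ∈ Ioo 0 a, q s < 0) → p a < c := by
      intro a ha hq
      have : StrictAntiOn p (Icc 0 a) := by
        refine strictAntiOn_of_deriv_neg (convex_Icc 0 a) (pc.mono fun s hs => hin s ⟨hs.1, by linarith [hs.2, ha.2, hS.2]⟩) fun s hs => ?_
        rw [interior_Icc] at hs
        rw [(hd s (hin s ⟨hs.1.le, by linarith [hs.2, ha.2, hS.2]⟩)).1.deriv]
        exact hq s hs
      have := this (left_mem_Icc.2 ha.1.le) (right_mem_Icc.2 ha.1.le) ha.1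
      rwa [hp0] at this
    have hall : ∀ s ∈ Ioc 0 S, q s < 0 := by
      by_contra hcon
      push Not at hcon
      obtain ⟨s, hs, hqs⟩ := hcon
      set A := Icc (min (δ / 2) s) S ∩ q ⁻¹' (Ici 0) with hA
      have hmin : 0 < min (δ / 2) s := lt_min (by linarith) hs.1
      have hAcl : IsClosed A := ContinuousOn.preimage_isClosed_of_isClosed (qc.mono fun r hr => hin r ⟨by linarith [hr.1], by linarith [hr.2, hS.2]⟩) isClosed_Icc isClosed_Ici
      have hAc : IsCompact A := isCompact_Icc.of_isClosed_subset hAcl inter_subset_left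
      obtain ⟨a, haA, hal⟩ := hAc.exists_isLeast ⟨s, ⟨min_le_right _ _, hs.2⟩, hqs⟩
      have ha0 : 0 < a := lt_of_lt_of_le hmin haA.1.1
      have hneg : ∀ r ∈ Ioo 0 a, q r < 0 := by
        intro r hr
        by_contra hr2
        push Not at hr2
        rcases lt_or_ge r (min (δ / 2) s) with h1 | h1
        · exact absurd (hqδ r ⟨hr.1, by have := min_le_left (δ / 2) s; linarith⟩) (not_lt.2 hr2)
        · have := hal ⟨⟨h1, by linarith [hr.2, haA.1.2]⟩, hr2⟩
          linarith [hr.2]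
      have hpa := hdec a ⟨ha0, haA.1.2⟩ hneg
      have haT : a ∈ Ioo (-T) T := hin a ⟨ha0.le, by linarith [haA.1.2, hS.2]⟩
      have hqa : q a ≤ 0 := by
        have h1 : Tendsto q (𝓝[<] a) (𝓝 (q a)) := ((hd a haT).2.continuousAt.tendsto).mono_left nhdsWithin_le_nhds
        refine le_of_tendsto h1 ?_
        filter_upwards [Ioo_mem_nhdsLT ha0] with r hr using (hneg r hr).le
      have hqa0 : q a = 0 := le_antisymm hqa haA.2
      have h1 := hE a haT
      rw [hqa0] at h1
      have h2 := hVl (p a) ⟨hpos a ⟨ha0.le, haA.1.2⟩, hpa.le⟩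
      nlinarith
    exact fun s hs => ⟨hall s hs, hdec s hs fun r hr => hall r ⟨hr.1, by linarith [hr.2, hs.2]⟩⟩
  -- hitting
  have hhit : ∃ s ∈ Ico 0 T, p s ≤ 0 := by
    by_contra hcon
    push Not at hcon
    set S := 2 * (Real.sqrt c / Real.sqrt κ) with hSd
    have hSp : 0 < S := by have := Real.sqrt_pos.2 hc; positivity
    have hS : S ∈ Ioo 0 T := ⟨hSp, by linarith⟩
    have hXS := hX S hS fun s hs => (hcon s ⟨hs.1, by linarith [hs.2, hS.2]⟩).le
    have hsub : Icc 0 S ⊆ Ioo (-T) T := fun s hs => hin s ⟨hs.1, by linarith [hs.2, hS.2]⟩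
    have hdφ : ∀ s ∈ Ioo 0 S, HasDerivAt (fun s => Real.sqrt (c - p s)) (-(q s) / (2 * Real.sqrt (c - p s))) s := by
      intro s hs
      have h1 := (hXS s ⟨hs.1, hs.2.le⟩).2
      have h2 := ((hd s (hsub ⟨hs.1.le, hs.2.le⟩)).1.const_sub c).sqrt (by linarith)
      exact h2
    have hmv := (convex_Icc 0 S).mul_sub_le_image_sub_of_le_deriv (f := fun s => Real.sqrt (c - p s)) (C := Real.sqrt κ / 2)
      ((continuousOn_const.sub (pc.mono hsub)).sqrt) (by
        rw [interior_Icc]; exact fun s hs => (hdφ s hs).differentiableAt.differentiableWithinAt) (by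
        rw [interior_Icc]; intro s hs
        rw [(hdφ s hs).deriv]
        have h1 := hXS s ⟨hs.1, hs.2.le⟩
        have h2 : 0 < Real.sqrt (c - p s) := Real.sqrt_pos.2 (by linarith)
        rw [div_le_div_iff₀ (by norm_num) (by positivity)]
        have h3 := hE s (hsub ⟨hs.1.le, hs.2.le⟩)
        have h4 := hVl (p s) ⟨(hcon s ⟨hs.1.le, by linarith [hs.2, hS.2]⟩).le, h1.2.le⟩
        have h5 : Real.sqrt κ * Real.sqrt (c - p s) ≤ - q s := by
          rw [← Real.sqrt_mul hκ.le]
          refine Real.sqrt_le_iff.2 ⟨by linarith, ?_⟩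
          rw [neg_sq, h3]; linarith
        nlinarith) 0 (left_mem_Icc.2 hSp.le) S (right_mem_Icc.2 hSp.le) hSp.le
    simp only [hp0, sub_self, Real.sqrt_zero, sub_zero] at hmv
    have h1 : Real.sqrt κ / 2 * S = Real.sqrt c := by rw [hSd]; field_simp
    rw [h1] at hmv
    have h2 : Real.sqrt (c - p S) < Real.sqrt c := Real.sqrt_lt_sqrt (by have := (hXS S ⟨hSp, le_rfl⟩).2; linarith) (by have := hcon S ⟨hSp.le, hS.2⟩; linarith)
    linarith
  obtain ⟨s1, hs1, hps1⟩ := hhit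
  obtain ⟨L, hLA, hLl⟩ : ∃ L, IsLeast (Icc 0 s1 ∩ p ⁻¹' (Iic 0)) L := by
    have hcl : IsClosed (Icc 0 s1 ∩ p ⁻¹' (Iic 0)) := ContinuousOn.preimage_isClosed_of_isClosed (pc.mono fun r hr => hin r ⟨hr.1, by linarith [hr.2, hs1.2]⟩) isClosed_Icc isClosed_Iic
    exact (isCompact_Icc.of_isClosed_subset hcl inter_subset_left).exists_isLeast ⟨s1, ⟨hs1.1, le_rfl⟩, hps1⟩
  have hL0 : 0 < L := by
    rcases eq_or_lt_of_le hLA.1.1 with h | h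
    · have := hLA.2; rw [← h] at this; change p 0 ≤ 0 at this; rw [hp0] at this; linarith
    · exact h
  have hLT : L < T := lt_of_le_of_lt hLA.1.2 hs1.2
  have hsub : Icc 0 L ⊆ Ioo (-T) T := fun s hs => hin s ⟨hs.1, by linarith [hs.2]⟩
  have hppos : ∀ s ∈ Ico 0 L, 0 < p s := by
    intro s hs
    by_contra hcon
    push Not at hcon
    have := hLl ⟨⟨hs.1, by linarith [hs.2, hLA.1.2]⟩, hcon⟩
    linarith [hs.2]
  have hpL : p L = 0 := by
    refine le_antisymm hLA.2 ?_
    have h1 : Tendsto p (𝓝[<] L) (𝓝 (p L)) := ((hd L (hsub ⟨hL0.le, le_rfl⟩)).1.continuousAt.tendsto).mono_left nhdsWithin_le_nhds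
    refine ge_of_tendsto h1 ?_
    filter_upwards [Ioo_mem_nhdsLT hL0] with r hr using (hppos r ⟨hr.1.le, hr.2⟩).le
  have hXL := hX L ⟨hL0, hLT⟩ (fun s hs => by
    rcases eq_or_lt_of_le hs.2 with h | h
    · rw [h, hpL]
    · exact (hppos s ⟨hs.1, h⟩).le)
  -- the extended profile
  let cl : ℝ → ℝ := fun s => max 0 (min s L)
  have hcl : ∀ s, cl s ∈ Icc 0 L := fun s => ⟨le_max_left _ _, max_le hL0.le (min_le_right _ _)⟩
  have hcli : ∀ s ∈ Icc 0 L, cl s = s := fun s hs => by simp only [cl]; rw [min_eq_left hs.2, max_eq_right hs.1]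
  have hclL : LipschitzWith 1 cl := (LipschitzWith.id.min_const L).const_max 0
  let qt : ℝ → ℝ := fun s => q (cl s)
  have hqt : Continuous qt := continuousOn_univ.1 ((qc.mono hsub).comp hclL.continuous.continuousOn fun s _ => hcl s)
  let pt : ℝ → ℝ := fun s => c + ∫ r in (0:ℝ)..s, qt r
  have hpt : ∀ s, HasDerivAt pt (qt s) s := fun s => (hqt.integral_hasStrictDerivAt 0 s).hasDerivAt.const_add c
  have hpteq : ∀ s ∈ Icc 0 L, pt s = p s := by
    intro s hs
    have h1 : ∫ r in (0:ℝ)..s, qt r = p s - p 0 := by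
      refine intervalIntegral.integral_eq_sub_of_hasDerivAt (fun r hr => ?_) (hqt.intervalIntegrable _ _)
      rw [uIcc_of_le hs.1] at hr
      have hr' : r ∈ Icc 0 L := ⟨hr.1, hr.2.trans hs.2⟩
      simp only [qt]; rw [hcli r hr']
      exact (hd r (hsub hr')).1
    simp only [pt]; rw [h1, hp0]; ring
  have hlip : ∀ a ∈ Icc 0 L, ∀ b ∈ Icc 0 L, |q a - q b| ≤ N * |a - b| := by
    intro a ha b hb
    exact (convex_Ioo (-T) T).norm_image_sub_le_of_norm_hasDerivWithin_le (fun x hx => (hd x hx).2.hasDerivWithinAt) (fun x hx => hN _) (hsub hb) (hsub ha)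
  have hq0' : ∀ s, qt s ≤ 0 := by
    intro s
    rcases eq_or_lt_of_le (hcl s).1 with h | h
    · simp only [qt]; rw [← h, hq0]
    · exact (hXL _ ⟨h, (hcl s).2⟩).1.le
  have hmid : ∀ s ∈ Ioo 0 L, HasDerivAt qt (f (pt s) + κ / 2) s ∧ 0 < pt s := by
    intro s hs
    have hsI : s ∈ Icc 0 L := Ioo_subset_Icc_self hs
    rw [hpteq s hsI]
    refine ⟨?_, hppos s ⟨hs.1.le, hs.2⟩⟩
    rw [← hgf (p s) ⟨(hppos s ⟨hs.1.le, hs.2⟩).le, (hXL s ⟨hs.1, hs.2.le⟩).2.le⟩]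
    refine (hd s (hsub hsI)).2.congr_of_eventuallyEq ?_
    filter_upwards [Ioo_mem_nhds hs.1 hs.2] with r hr
    simp only [qt]; rw [hcli r (Ioo_subset_Icc_self hr)]
  have hLL : L ∈ Icc 0 L := ⟨hL0.le, le_rfl⟩
  have hanti : Antitone pt := antitone_of_deriv_nonpos (fun s => (hpt s).differentiableAt) fun s => by rw [(hpt s).deriv]; exact hq0' s
  refine ⟨N * L, L, pt, qt, by positivity, ⟨hpt, ?_, hq0', ?_, ?_, ?_, hmid, hL0⟩, ?_, ?_⟩
  · intro a b
    refine (hlip _ (hcl a) _ (hcl b)).trans (mul_le_mul_of_nonneg_left ?_ hN0)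
    have := hclL.dist_le_mul a b
    simpa [Real.dist_eq] using this
  · intro s
    have h1 := hlip _ (hcl s) 0 ⟨le_rfl, hL0.le⟩
    rw [hq0, sub_zero, sub_zero, abs_of_nonneg (hcl s).1] at h1
    have h2 := mul_le_mul_of_nonneg_left (hcl s).2 hN0
    have h3 := (abs_le.1 h1).1
    simp only [qt]; linarith
  · intro s hs
    have hzero : ∀ r ≤ 0, qt r = 0 := by
      intro r hr
      have : cl r = 0 := max_eq_left ((min_le_left _ _).trans hr)
      simp only [qt]; rw [this, hq0]
    refine ⟨hzero s hs, ?_⟩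
    have : ∫ r in (0:ℝ)..s, qt r = ∫ r in (0:ℝ)..s, (0:ℝ) := intervalIntegral.integral_congr fun r hr => by
      rw [uIcc_of_ge hs] at hr
      exact hzero r hr.2
    simp only [pt]; rw [this]; simp
  · intro s hs
    refine (hanti hs).trans ?_
    rw [hpteq L hLL, hpL]
  · rw [hpteq L hLL, hpL]
  · intro s hs
    have hsI : s ∈ Icc 0 L := Ioo_subset_Icc_self hs
    rw [hpteq s hsI]
    simp only [qt]; rw [hcli s hsI]
    exact hE s (hsub hsI)

theorem het_energy {W U : ℝ → ℝ} {μ : ℝ} (hW : ContDiff ℝ 2 W) (hU2 : ContDiffOn ℝ 2 U (Ici 0))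
    (hode : ∀ s > (0:ℝ), deriv (deriv U) s = deriv W (U s)) (hlim : Tendsto U atTop (𝓝 μ)) :
    ∀ s > 0, HasDerivAt U (deriv U s) s ∧ deriv U s ^ 2 = 2 * (W (U s) - W μ) := by
  have hWd : ∀ t, HasDerivAt W (deriv W t) t := fun t => (hW.differentiable (by norm_num) t).hasDerivAt
  have hU : ContDiffOn ℝ 2 U (Ioi 0) := hU2.mono Ioi_subset_Ici_self
  have hU' := hU
  rw [show (2 : WithTop ℕ∞) = 1 + 1 by norm_num, contDiffOn_succ_iff_deriv_of_isOpen isOpen_Ioi] at hU'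
  have hd1 : ∀ s > 0, HasDerivAt U (deriv U s) s := fun s hs =>
    ((hU'.1 s hs).differentiableAt (Ioi_mem_nhds hs)).hasDerivAt
  have hd2 : ∀ s > 0, HasDerivAt (deriv U) (deriv W (U s)) s := fun s hs => by
    rw [← hode s hs]
    exact ((hU'.2.2.differentiableOn (by norm_num) s hs).differentiableAt (Ioi_mem_nhds hs)).hasDerivAt
  have hE : ∀ a > 0, ∀ b > 0, deriv U a ^ 2 - 2 * W (U a) = deriv U b ^ 2 - 2 * W (U b) := by
    intro a ha b hb
    have hdE : ∀ s ∈ Ioi (0:ℝ), HasDerivWithinAt (fun s => deriv U s ^ 2 - 2 * W (U s)) 0 (Ioi 0) s := by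
      intro s hs
      have h1 := ((hd2 s hs).pow 2).sub (((hWd (U s)).comp s (hd1 s hs)).const_mul 2)
      refine (h1.congr_deriv ?_).hasDerivWithinAt
      simp; ring
    have := (convex_Ioi (0:ℝ)).norm_image_sub_le_of_norm_hasDerivWithin_le hdE (C := 0) (fun x hx => by simp) hb ha
    simp only [zero_mul, norm_le_zero_iff] at this
    linarith
  intro s hs
  refine ⟨hd1 s hs, ?_⟩
  have hmv : ∀ k : ℕ, ∃ ξ : ℝ, (k:ℝ) + 1 < ξ ∧ deriv U ξ = U (k + 2) - U (k + 1) := by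
    intro k
    have hk : (0:ℝ) ≤ k := by positivity
    obtain ⟨ξ, hξ, he⟩ := exists_hasDerivAt_eq_slope U (deriv U) (a := (k:ℝ) + 1) (b := k + 2) (by linarith)
      (fun r hr => (hd1 r (by linarith [hr.1])).continuousAt.continuousWithinAt) fun r hr => hd1 r (by linarith [hr.1])
    refine ⟨ξ, hξ.1, ?_⟩
    rw [he]; norm_num
  choose ξ hξ1 hξ2 using hmv
  have hka : Tendsto (fun k : ℕ => (k:ℝ)) atTop atTop := tendsto_natCast_atTop_atTop
  have hξ : Tendsto ξ atTop atTop := tendsto_atTop_mono (fun k => by linarith [hξ1 k]) hka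
  have l1 : Tendsto (fun k => deriv U (ξ k)) atTop (𝓝 (μ - μ)) := by
    have e : (fun k => deriv U (ξ k)) = fun k : ℕ => U (k + 2) - U (k + 1) := funext hξ2
    rw [e]
    exact (hlim.comp (tendsto_atTop_add_const_right _ _ hka)).sub (hlim.comp (tendsto_atTop_add_const_right _ _ hka))
  have l2 : Tendsto (fun k => deriv U (ξ k) ^ 2 - 2 * W (U (ξ k))) atTop (𝓝 ((μ - μ) ^ 2 - 2 * W μ)) :=
    (l1.pow 2).sub (((hW.continuous.tendsto μ).comp (hlim.comp hξ)).const_mul 2)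
  have l3 : Tendsto (fun k => deriv U (ξ k) ^ 2 - 2 * W (U (ξ k))) atTop (𝓝 (deriv U s ^ 2 - 2 * W (U s))) := by
    refine tendsto_const_nhds.congr fun k => hE s hs (ξ k) ?_
    have := hξ1 k; have hk : (0:ℝ) ≤ k := by positivity
    linarith
  have := tendsto_nhds_unique l2 l3
  simp only [sub_self] at this
  linarith

/-- the inverse speed -/
def hsp (W : ℝ → ℝ) (μ b : ℝ) (t : ℝ) : ℝ := 1 / Real.sqrt (2 * (W (max 0 (min t b)) - W μ))

def Ysp (W : ℝ → ℝ) (μ b : ℝ) (t : ℝ) : ℝ := ∫ r in (0:ℝ)..t, hsp W μ b r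

theorem hsp_props {W : ℝ → ℝ} {μ b : ℝ} (hW : Continuous W) (hb : 0 ≤ b) (hpos : ∀ t ∈ Icc 0 b, W μ < W t) :
    Continuous (hsp W μ b) ∧ (∀ t, 0 < hsp W μ b t) ∧ (∀ t, HasDerivAt (Ysp W μ b) (hsp W μ b t) t) ∧ Monotone (Ysp W μ b) := by
  have h1 : ∀ t, 0 < Real.sqrt (2 * (W (max 0 (min t b)) - W μ)) := fun t => by
    have := hpos (max 0 (min t b)) ⟨le_max_left _ _, max_le hb (min_le_right _ _)⟩
    exact Real.sqrt_pos.2 (by linarith)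
  have hc : Continuous (hsp W μ b) := by
    unfold hsp
    exact continuous_const.div (by fun_prop) fun t => (h1 t).ne'
  have hp : ∀ t, 0 < hsp W μ b t := fun t => one_div_pos.2 (h1 t)
  have hd : ∀ t, HasDerivAt (Ysp W μ b) (hsp W μ b t) t := fun t => (hc.integral_hasStrictDerivAt 0 t).hasDerivAt
  exact ⟨hc, hp, hd, monotone_of_deriv_nonneg (fun t => (hd t).differentiableAt) fun t => by rw [(hd t).deriv]; exact (hp t).le⟩

theorem cross_time {W U : ℝ → ℝ} {μ b D' : ℝ} (hW : ContDiff ℝ 2 W) (hU2 : ContDiffOn ℝ 2 U (Ici 0)) (hU0 : U 0 = 0)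
    (hode : ∀ s > (0:ℝ), deriv (deriv U) s = deriv W (U s)) (hlim : Tendsto U atTop (𝓝 μ))
    (hb : 0 < b) (hpos : ∀ t ∈ Icc 0 b, W μ < W t) (hD0 : 0 ≤ D') (hD : U D' = b) : Ysp W μ b b ≤ D' := by
  have hen := het_energy hW hU2 hode hlim
  obtain ⟨hc, hp, hd, hm⟩ := hsp_props hW.continuous hb.le hpos
  have hUc : ContinuousOn U (Icc 0 D') := hU2.continuousOn.mono Icc_subset_Ici_self
  obtain ⟨s1, hs1, hs1g⟩ : ∃ s, IsGreatest (Icc 0 D' ∩ U ⁻¹' (Iic 0)) s :=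
    (isCompact_Icc.of_isClosed_subset (hUc.preimage_isClosed_of_isClosed isClosed_Icc isClosed_Iic) inter_subset_left).exists_isGreatest ⟨0, ⟨le_rfl, hD0⟩, hU0.le⟩
  obtain ⟨s2, hs2, hs2l⟩ : ∃ s, IsLeast (Icc s1 D' ∩ U ⁻¹' (Ici b)) s :=
    (isCompact_Icc.of_isClosed_subset ((hUc.mono (Icc_subset_Icc_left hs1.1.1)).preimage_isClosed_of_isClosed isClosed_Icc isClosed_Ici) inter_subset_left).exists_isLeast ⟨D', ⟨hs1.1.2, le_rfl⟩, hD.ge⟩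
  have hYc : Continuous (Ysp W μ b) := continuous_iff_continuousAt.2 fun t => (hd t).continuousAt
  have hder : ∀ s ∈ Ioo s1 s2, HasDerivAt (fun s => Ysp W μ b (U s)) (hsp W μ b (U s) * deriv U s) s := fun s hs =>
    (hd (U s)).comp s (hen s (lt_of_le_of_lt hs1.1.1 hs.1)).1
  have hmv := (convex_Icc s1 s2).image_sub_le_mul_sub_of_deriv_le (f := fun s => Ysp W μ b (U s)) (C := 1)
    (hYc.comp_continuousOn (hUc.mono fun s hs => ⟨hs1.1.1.trans hs.1, hs.2.trans hs2.1.2⟩)) (by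
      rw [interior_Icc]; exact fun s hs => (hder s hs).differentiableAt.differentiableWithinAt) (by
      rw [interior_Icc]; intro s hs
      rw [(hder s hs).deriv]
      have hsD : s ≤ D' := hs.2.le.trans hs2.1.2
      have h1 : 0 < U s := by
        by_contra hcon; push Not at hcon
        have := hs1g ⟨⟨hs1.1.1.trans hs.1.le, hsD⟩, hcon⟩
        linarith [hs.1]
      have h2 : U s < b := by
        by_contra hcon; push Not at hcon
        have := hs2l ⟨⟨hs.1.le, hsD⟩, hcon⟩
        linarith [hs.2]
      have h3 := (hen s (lt_of_le_of_lt hs1.1.1 hs.1)).2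
      have h4 : max 0 (min (U s) b) = U s := by rw [min_eq_left h2.le, max_eq_right h1.le]
      unfold hsp
      rw [h4, ← h3, Real.sqrt_sq_eq_abs]
      rw [one_div_mul_eq_div]
      exact div_le_one_of_le₀ (le_abs_self _) (abs_nonneg _)) s1 (left_mem_Icc.2 hs2.1.1) s2 (right_mem_Icc.2 hs2.1.1) hs2.1.1
  have h5 : Ysp W μ b b ≤ Ysp W μ b (U s2) := hm hs2.2
  have h6 : Ysp W μ b (U s1) ≤ 0 := by
    have := hm (show U s1 ≤ 0 from hs1.2)
    simpa [Ysp] using this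
  have := hs1.1.1; have := hs2.1.2
  linarith

theorem lip_Icc {f : ℝ → ℝ} (hf : ContDiff ℝ 1 f) (M : ℝ) :
    ∃ l : NNReal, LipschitzOnWith l f (Icc 0 M) := by
  have hc : Continuous (deriv f) := hf.continuous_deriv (by norm_num)
  obtain ⟨C, hC⟩ := isCompact_Icc.exists_bound_of_continuousOn (s := Icc 0 M) hc.continuousOn
  refine ⟨Real.toNNReal C, (convex_Icc 0 M).lipschitzOnWith_of_nnnorm_deriv_le (fun x _ => hf.differentiable (by norm_num) x) fun x hx => ?_⟩
  rw [← NNReal.coe_le_coe, coe_nnnorm]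
  exact (hC x hx).trans (Real.le_coe_toNNReal C)

theorem profile {W U : ℝ → ℝ} {μ ε D D' : ℝ} (hW : ContDiff ℝ 2 W) (hμ : 0 < μ) (hf0 : deriv W 0 ≤ 0) (hfμ : deriv W μ = 0)
    (hmin : ∀ t ∈ Ico 0 μ, W μ < W t) (hU2 : ContDiffOn ℝ 2 U (Ici 0)) (hU0 : U 0 = 0)
    (hode : ∀ s > (0:ℝ), deriv (deriv U) s = deriv W (U s)) (hlim : Tendsto U atTop (𝓝 μ))
    (hε : 0 < ε) (hεμ : ε < μ) (hD0 : 0 ≤ D') (hD' : U D' = μ - ε) (hDD : D' < D) :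
    ∃ c κ B N L p q, 0 < κ ∧ 0 ≤ B ∧ 0 ≤ N ∧ 0 < c ∧ c ≤ μ ∧ deriv W c ≤ 0 ∧ Prof (deriv W) c κ B N L p q ∧ ∀ s < L - D, μ - ε < p s := by
  have hf : ContDiff ℝ 1 (deriv W) := by
    have : ContDiff ℝ (1+1) W := by norm_num; exact hW
    exact (contDiff_succ_iff_deriv.1 this).2.2
  have hWd : ∀ t, HasDerivAt W (deriv W t) t := fun t => (hW.differentiable (by norm_num) t).hasDerivAt
  set b := μ - ε with hb
  have hb0 : 0 < b := by linarith
  have hbμ : b < μ := by linarith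
  have hD : 0 < D := lt_of_le_of_lt hD0 hDD
  have hposb : ∀ t ∈ Icc 0 b, W μ < W t := fun t ht => hmin t ⟨ht.1, lt_of_le_of_lt ht.2 hbμ⟩
  have hcr := cross_time hW hU2 hU0 hode hlim hb0 hposb hD0 hD'
  obtain ⟨hc1, hp1, hd1, hm1⟩ := hsp_props hW.continuous hb0.le hposb
  obtain ⟨tm, htm, htmin⟩ := (isCompact_Icc (a := (0:ℝ)) (b := b)).exists_isMinOn ⟨0, le_rfl, hb0.le⟩ hW.continuous.continuousOn
  set m := W tm - W μ with hm
  have hm0 : 0 < m := by have := hposb tm htm; linarith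
  have hmle : ∀ t ∈ Icc 0 b, m ≤ W t - W μ := fun t ht => by
    have : W tm ≤ W t := htmin ht
    linarith
  set ρ := (D' / D) ^ 2 with hρ
  have hρ1 : ρ < 1 := by
    have h1 : D' / D < 1 := (div_lt_one hD).2 hDD
    have h0 : 0 ≤ D' / D := div_nonneg hD0 hD.le
    rw [hρ]; nlinarith
  have hρ0 : 0 ≤ ρ := sq_nonneg _
  set κ := m / μ * ((1 - ρ) / 2) with hκ
  have hκ0 : 0 < κ := mul_pos (div_pos hm0 hμ) (by linarith)
  have hκμ : κ * μ = m * ((1 - ρ) / 2) := by rw [hκ]; field_simp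
  set θ := (1 + ρ) / 2 with hθ
  have hθ0 : 0 < θ := by linarith
  have hθD : D' < Real.sqrt θ * D := by
    have h1 : D' / D < Real.sqrt θ := Real.lt_sqrt_of_sq_lt (by linarith)
    rwa [div_lt_iff₀ hD] at h1
  have hκm : κ * μ < m := by rw [hκμ]; nlinarith
  obtain ⟨c, hcI, hcmin⟩ := (isCompact_Icc (a := (0:ℝ)) (b := μ)).exists_isMinOn ⟨0, le_rfl, hμ.le⟩ (f := fun t => W t + κ * t) (by have := hW.continuous; fun_prop)
  have hcm : ∀ t ∈ Icc 0 μ, W c + κ * c ≤ W t + κ * t := fun t ht => hcmin ht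
  have hcμ' := hcm μ ⟨hμ.le, le_rfl⟩
  have hbc : b < c := by
    by_contra hcon
    push Not at hcon
    have h1 := hmle c ⟨hcI.1, hcon⟩
    have h2 := mul_nonneg hκ0.le hcI.1
    linarith
  have hc0 : 0 < c := by linarith
  have hφd : ∀ t, HasDerivAt (fun t => W t + κ * t) (deriv W t + κ) t := fun t => by
    exact ((hWd t).add ((hasDerivAt_id t).const_mul κ)).congr_deriv (by simp)
  have hcμ : c < μ := by
    refine lt_of_le_of_ne hcI.2 fun he => ?_
    have h1 := hφd μ
    rw [hfμ, zero_add] at h1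
    have h2 := (hasDerivAt_iff_tendsto_slope.1 h1).eventually (lt_mem_nhds hκ0)
    have h3 : ∀ᶠ t in 𝓝[<] μ, 0 < slope (fun t => W t + κ * t) μ t := h2.filter_mono (nhdsWithin_mono _ fun t ht => ne_of_lt ht)
    obtain ⟨t, ht1, ht2⟩ := (h3.and (Ioo_mem_nhdsLT hμ)).exists
    have h4 := hcm t ⟨ht2.1.le, ht2.2.le⟩
    rw [slope_def_field] at ht1
    rw [he] at h4
    have h5 : (W t + κ * t - (W μ + κ * μ)) / (t - μ) ≤ 0 := div_nonpos_of_nonneg_of_nonpos (by linarith) (by linarith [ht2.2])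
    linarith
  have hfc : deriv W c = -κ := by
    have h1 : IsLocalMin (fun t => W t + κ * t) c := by
      filter_upwards [Ioo_mem_nhds hc0 hcμ] with t ht using hcm t ⟨ht.1.le, ht.2.le⟩
    have := h1.hasDerivAt_eq_zero (hφd c)
    linarith
  -- the truncated field
  let cl : ℝ → ℝ := fun s => max 0 (min s μ)
  have hcl : ∀ s, cl s ∈ Icc 0 μ := fun s => ⟨le_max_left _ _, max_le hμ.le (min_le_right _ _)⟩
  have hcli : ∀ s ∈ Icc 0 μ, cl s = s := fun s hs => by simp only [cl]; rw [min_eq_left hs.2, max_eq_right hs.1]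
  have hclL : LipschitzWith 1 cl := (LipschitzWith.id.min_const μ).const_max 0
  let g : ℝ → ℝ := fun t => deriv W (cl t) + κ / 2
  obtain ⟨l, hl⟩ := lip_Icc hf μ
  have hK : LipschitzWith l g := by
    refine LipschitzWith.of_dist_le_mul fun x y => ?_
    simp only [g]
    rw [dist_add_right]
    refine (hl.dist_le_mul _ (hcl x) _ (hcl y)).trans ?_
    have := hclL.dist_le_mul x y
    rw [NNReal.coe_one, one_mul] at this
    exact mul_le_mul_of_nonneg_left this l.2
  obtain ⟨C, hC⟩ := isCompact_Icc.exists_bound_of_continuousOn (s := Icc 0 μ) hf.continuous.continuousOn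
  have hN : ∀ t, |g t| ≤ C + κ / 2 := fun t => by
    have h1 := hC (cl t) (hcl t)
    rw [Real.norm_eq_abs] at h1
    refine (abs_add_le _ _).trans ?_
    rw [abs_of_pos (by linarith : 0 < κ / 2)]
    linarith
  have hgc : Continuous g := hK.continuous
  let V : ℝ → ℝ := fun t => ∫ r in c..t, g r
  have hV : ∀ t, HasDerivAt V (g t) t := fun t => (hgc.integral_hasStrictDerivAt c t).hasDerivAt
  have hVeq : ∀ t ∈ Icc 0 c, V t = W t - W c - κ / 2 * (c - t) := by
    intro t ht
    have : ∫ r in c..t, g r = (W t + κ / 2 * t) - (W c + κ / 2 * c) := by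
      refine intervalIntegral.integral_eq_sub_of_hasDerivAt (f := fun t => W t + κ / 2 * t) (fun r hr => ?_) (hgc.intervalIntegrable _ _)
      rw [uIcc_of_ge ht.2] at hr
      have hr' : r ∈ Icc 0 μ := ⟨ht.1.trans hr.1, hr.2.trans hcμ.le⟩
      simp only [g]; rw [hcli r hr']
      exact ((hWd r).add ((hasDerivAt_id r).const_mul (κ / 2))).congr_deriv (by simp)
    simp only [V]; rw [this]; ring
  obtain ⟨B, L, p, q, hB, hP, hpL, hE⟩ := prof_exists (f := deriv W) (V := V) hK hN hc0 hκ0 (fun t ht => by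
      simp only [g]; rw [hcli t ⟨ht.1, ht.2.trans hcμ.le⟩]) (by
      simp only [g]; rw [hcli c ⟨hc0.le, hcμ.le⟩, hfc]; linarith) hV (by simp [V]) (fun t ht => by
      rw [hVeq t ht]
      have := hcm t ⟨ht.1, ht.2.trans hcμ.le⟩
      linarith)
  refine ⟨c, κ, B, C + κ / 2, L, p, q, hκ0, hB, (abs_nonneg _).trans (hN 0), hc0, hcμ.le, by rw [hfc]; linarith, hP, ?_⟩
  intro s hs
  by_contra hcon
  push Not at hcon
  have hs0 : 0 < s := by
    by_contra h0
    push Not at h0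
    have := (hP.left s h0).2
    linarith
  have hsL : s < L := by linarith
  have hpc : Continuous p := continuous_iff_continuousAt.2 fun s => (hP.hp s).continuousAt
  have hYc : Continuous (Ysp W μ b) := continuous_iff_continuousAt.2 fun t => (hd1 t).continuousAt
  have hder : ∀ r, HasDerivAt (fun r => Ysp W μ b (p r)) (hsp W μ b (p r) * q r) r := fun r => (hd1 (p r)).comp r (hP.hp r)
  have hmv := (convex_Icc s L).image_sub_le_mul_sub_of_deriv_le (f := fun r => Ysp W μ b (p r)) (C := -Real.sqrt θ)
    (hYc.comp hpc).continuousOn (fun r hr => (hder r).differentiableAt.differentiableWithinAt) (by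
      rw [interior_Icc]; intro r hr
      rw [(hder r).deriv]
      have hr' : r ∈ Ioo 0 L := ⟨hs0.trans hr.1, hr.2⟩
      have h1 : 0 < p r := (hP.mid r hr').2
      have h2 : p r ≤ b := (hP.anti hr.1.le).trans hcon
      have h3 := hE r hr'
      rw [hVeq (p r) ⟨h1.le, by linarith⟩] at h3
      have h4 : max 0 (min (p r) b) = p r := by rw [min_eq_left h2, max_eq_right h1.le]
      have h5 := hmle (p r) ⟨h1.le, h2⟩
      have h6 : θ * (2 * (W (p r) - W μ)) ≤ q r ^ 2 := by
        rw [h3]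
        have h7 : κ * μ ≤ (1 - θ) * (W (p r) - W μ) := by
          rw [hκμ]
          have : (1 - ρ) / 2 = 1 - θ := by rw [hθ]; ring
          rw [this, mul_comm]
          exact mul_le_mul_of_nonneg_left h5 (by linarith)
        have h8 := mul_nonneg hκ0.le h1.le
        have h9 := mul_nonneg hκ0.le hc0.le
        nlinarith
      have h10 : Real.sqrt θ * Real.sqrt (2 * (W (p r) - W μ)) ≤ - q r := by
        rw [← Real.sqrt_mul hθ0.le]
        exact Real.sqrt_le_iff.2 ⟨by linarith [hP.q0 r], by rw [neg_sq]; exact h6⟩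
      have h11 : 0 < Real.sqrt (2 * (W (p r) - W μ)) := Real.sqrt_pos.2 (by linarith)
      unfold hsp
      rw [h4, one_div_mul_eq_div, div_le_iff₀ h11]
      linarith) s (left_mem_Icc.2 hsL.le) L (right_mem_Icc.2 hsL.le) hsL.le
  rw [hpL] at hmv
  have h1 : Ysp W μ b 0 = 0 := by simp [Ysp]
  have h2 := hm1 hcon
  have h3 : Real.sqrt θ * D < Real.sqrt θ * (L - s) := mul_lt_mul_of_pos_left (by linarith) (Real.sqrt_pos.2 hθ0)
  linarith

theorem one_profile (n : ℕ) {W U : ℝ → ℝ} {μ ε D D' : ℝ} (hW : ContDiff ℝ 2 W) (hμ : 0 < μ) (hf0 : deriv W 0 ≤ 0) (hfμ : deriv W μ = 0)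
    (hmin : ∀ t ∈ Ico 0 μ, W μ < W t) (hU2 : ContDiffOn ℝ 2 U (Ici 0)) (hU0 : U 0 = 0)
    (hode : ∀ s > (0:ℝ), deriv (deriv U) s = deriv W (U s)) (hlim : Tendsto U atTop (𝓝 μ))
    (hε : 0 < ε) (hεμ : ε < μ) (hD0 : 0 ≤ D') (hD' : U D' = μ - ε) (hDD : D' < D) :
    ∃ R, D < R ∧ ∃ v : En n → ℝ, Continuous v ∧ (∀ x, v x ∈ Icc 0 μ) ∧ (∀ x, R ≤ ‖x‖ → v x = 0) ∧ (∀ x, ‖x‖ < R - D → μ - ε < v x) ∧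
      ∀ τ > 0, ∀ x, v x ≤ Av (kA n) τ v x - τ ^ 2 * Av (kB n) τ (fun y => deriv W (v y)) x := by
  obtain ⟨c, κ, B, N, L, p, q, hκ, hB, hN, hc, hcμ, hfc, hP, hs⟩ := profile hW hμ hf0 hfμ hmin hU2 hU0 hode hlim hε hεμ hD0 hD' hDD
  have hD : 0 < D := lt_of_le_of_lt hD0 hDD
  have hL := hP.L0
  set r0 := 2 * (n * B / κ) + D + 1 with hr0
  have h1 : 0 ≤ n * B / κ := by positivity
  have hr0p : 0 < r0 := by linarith
  have hr : n * B / r0 ≤ κ / 2 := by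
    rw [div_le_iff₀ hr0p]
    have : κ / 2 * (2 * (n * B / κ)) = n * B := by field_simp
    have h2 : 0 ≤ κ / 2 * (D + 1) := by positivity
    rw [hr0]; linarith
  have hWc : Continuous (deriv W) := hW.continuous_deriv (by norm_num)
  obtain ⟨hv1, hv2, hv3⟩ := radv_sub (n := n) hWc hr0p hP hN hB hc hfc hf0 hr
  refine ⟨r0 + L, by linarith, radv p r0, hv1, fun x => ⟨(hv2 x).1, (hv2 x).2.trans hcμ⟩, fun x hx => max_eq_right (hP.right _ (by linarith)), fun x hx => ?_, hv3⟩
  exact lt_of_lt_of_le (hs _ (by linarith)) (le_max_left _ _)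

theorem Fam.sub_le {f : ℝ → ℝ} {M l : ℝ} {Ω : Set (En n)} {U : ℕ → En n → ℝ} {u : En n → ℝ} (h : Fam f M l Ω U u) {v : En n → ℝ} {R : ℝ}
    (hv : Continuous v) (hvM : ∀ x, v x ∈ Icc 0 M) (hv0 : ∀ x, R ≤ ‖x‖ → v x = 0)
    (hsub : ∀ τ > 0, ∀ x, v x ≤ Av (kA n) τ v x - τ ^ 2 * Av (kB n) τ (fun y => f (v y)) x) {y : En n} (hy : ball y R ⊆ Ω) (x : En n) :
    v (x - y) ≤ u x := by
  refine ge_of_tendsto' (h.tend x) fun k => ?_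
  have hc : Continuous (fun x => v (x - y)) := by fun_prop
  refine h.max k (fun x => v (x - y)) hc.lowerSemicontinuous (fun x => hvM _) (fun t ht x => ?_) x
  have h1 := hsub t ht (x - y)
  refine h1.trans (le_of_eq ?_)
  have hF : (fun z => Fk f Ω k z (v (z - y))) = fun z => f (v (z - y)) := by
    ext z
    unfold Fk
    split_ifs with hz
    · simp
    · have : v (z - y) = 0 := hv0 _ (by
        by_contra hcon
        push Not at hcon
        exact hz (hy (by rwa [mem_ball, dist_eq_norm])))
      rw [this]; simp
  unfold TT
  rw [hF]
  unfold Av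
  have hz : ∀ z : En n, x - y + t • z = x + t • z - y := fun z => by abel
  simp only [hz]

theorem ball_sub_of_infDist {Ω : Set (En n)} (hΩ : IsOpen Ω) {y : En n} (hy : y ∈ Ω) {R : ℝ} (hR0 : 0 < R) (hR : R < infDist y (frontier Ω)) : ball y R ⊆ Ω := by
  refine (convex_ball y R).isPreconnected.subset_of_closure_inter_subset hΩ ⟨y, mem_ball_self hR0, hy⟩ ?_
  rintro w ⟨hw1, hw2⟩
  by_contra hcon
  have hwf : w ∈ frontier Ω := by rw [hΩ.frontier_eq]; exact ⟨hw1, hcon⟩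
  have h1 := infDist_le_dist_of_mem (x := y) hwf
  have h2 : dist w y < R := hw2
  rw [dist_comm] at h2
  linarith

theorem stmt16_aux (n : ℕ) (m : ℕ) (hm : 2 ≤ m)
    (W : ℝ → ℝ) (hW : ContDiff ℝ 2 W)
    (μ : ℕ → ℝ) (hμ0 : μ 0 = 0)
    (hμpos : ∀ i ∈ Set.Icc 1 m, 0 < μ i)
    (hμmono : ∀ i ∈ Set.Icc 1 m, ∀ j ∈ Set.Icc 1 m, i < j → μ i < μ j ∧ W (μ j) < W (μ i))
    (hW0 : deriv W 0 ≤ 0)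
    (hcrit : ∀ i ∈ Set.Icc 1 m, deriv W (μ i) = 0)
    (hWmin : ∀ i ∈ Set.Icc 1 m, ∀ t ∈ Set.Ico (0:ℝ) (μ i), W (μ i) < W t)
    (U : ℕ → ℝ → ℝ)
    (hU : ∀ i ∈ Set.Icc 1 m, ContDiffOn ℝ 2 (U i) (Set.Ici 0) ∧ U i 0 = 0 ∧
      (∀ s > (0:ℝ), deriv (deriv (U i)) s = deriv W (U i s)) ∧
      Filter.Tendsto (U i) Filter.atTop (nhds (μ i)))
    (ε : ℝ) (hε : 0 < ε) (hεsmall : ∀ i ∈ Set.Icc 1 m, ε < μ i - μ (i - 1))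
    (D D' : ℕ → ℝ)
    (hD : ∀ i ∈ Set.Icc 1 m, 0 ≤ D' i ∧ U i (D' i) = μ i - ε ∧ D' i < D i) :
    ∃ R' : ℕ → ℝ, (∀ i ∈ Set.Icc 1 m, D i < R' i) ∧
      ∀ Ω : Set (EuclideanSpace ℝ (Fin n)),
        IsOpen Ω → IsConnected Ω → (frontier Ω).Nonempty → HasC2Boundary Ω →
        (∃ x₀, ∀ i ∈ Set.Icc 1 m, closedBall x₀ (R' i) ⊆ Ω) →
        ∃ u : ℕ → EuclideanSpace ℝ (Fin n) → ℝ,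
          (∀ i ∈ Set.Icc 1 m,
            ContDiffOn ℝ 2 (u i) Ω ∧ ContinuousOn (u i) (closure Ω) ∧
            (∀ x ∈ Ω, lap (u i) x = deriv W (u i x)) ∧
            (∀ x ∈ frontier Ω, u i x = 0) ∧
            IsStable W Ω (u i) ∧
            (∀ x ∈ Ω, 0 < u i x ∧ u i x < μ i) ∧
            (∀ x ∈ ({y ∈ Ω | R' i < infDist y (frontier Ω)} +
                ball (0 : EuclideanSpace ℝ (Fin n)) (R' i - D i)), μ i - ε < u i x)) ∧
          (∀ i ∈ Set.Icc 1 m, ∀ j ∈ Set.Icc 1 m, i < j → ∀ x ∈ Ω, u i x < u j x) := by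
  have hf : ContDiff ℝ 1 (deriv W) := by
    have : ContDiff ℝ (1+1) W := by norm_num; exact hW
    exact (contDiff_succ_iff_deriv.1 this).2.2
  have hpred : ∀ i ∈ Set.Icc 1 m, 0 ≤ μ (i - 1) := by
    intro i hi
    rcases Nat.eq_or_lt_of_le hi.1 with h | h
    · rw [← h]; exact hμ0.ge
    · exact (hμpos (i - 1) ⟨by omega, by have := hi.2; omega⟩).le
  have hεμ : ∀ i ∈ Set.Icc 1 m, ε < μ i := fun i hi => by
    have h1 := hpred i hi; have h2 := hεsmall i hi; linarith
  have hle : ∀ i ∈ Set.Icc 1 m, ∀ j ∈ Set.Icc 1 m, i ≤ j → μ i ≤ μ j := fun i hi j hj hij => by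
    rcases Nat.eq_or_lt_of_le hij with h | h
    · rw [h]
    · exact (hμmono i hi j hj h).1.le
  have key : ∀ i, ∃ R : ℝ, ∃ v : En n → ℝ, i ∈ Set.Icc 1 m → D i < R ∧ Continuous v ∧ (∀ x, v x ∈ Icc 0 (μ i)) ∧ (∀ x, R ≤ ‖x‖ → v x = 0) ∧ (∀ x, ‖x‖ < R - D i → μ i - ε < v x) ∧
      ∀ τ > 0, ∀ x, v x ≤ Av (kA n) τ v x - τ ^ 2 * Av (kB n) τ (fun y => deriv W (v y)) x := by
    intro i
    by_cases hi : i ∈ Set.Icc 1 m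
    · obtain ⟨h1, h2, h3, h4⟩ := hU i hi
      obtain ⟨h5, h6, h7⟩ := hD i hi
      obtain ⟨R, hR, v, hv⟩ := one_profile n hW (hμpos i hi) hW0 (hcrit i hi) (hWmin i hi) h1 h2 h3 h4 hε (hεμ i hi) h5 h6 h7
      exact ⟨R, v, fun _ => ⟨hR, hv⟩⟩
    · exact ⟨0, 0, fun h => absurd h hi⟩
  choose R v hRv using key
  refine ⟨R, fun i hi => (hRv i hi).1, ?_⟩
  intro Ω hΩ hcon hfr hC2 ⟨x₀, hx₀⟩
  obtain ⟨l0, hl0⟩ := lip_Icc hf (μ m)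
  set l : ℝ := l0 + 1 with hl
  have hlp : 0 < l := by positivity
  have hmm : m ∈ Set.Icc 1 m := ⟨by omega, le_rfl⟩
  have hL : ∀ i ∈ Set.Icc 1 m, ∀ s ∈ Icc 0 (μ i), ∀ s' ∈ Icc 0 (μ i), |deriv W s - deriv W s'| ≤ l * |s - s'| := by
    intro i hi s hs s' hs'
    have h1 := hle i hi m hmm hi.2
    have := hl0.dist_le_mul s ⟨hs.1, hs.2.trans h1⟩ s' ⟨hs'.1, hs'.2.trans h1⟩
    rw [Real.dist_eq, Real.dist_eq] at this
    have h2 := abs_nonneg (s - s')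
    rw [hl, add_mul]; linarith
  have hfam : ∀ i, ∃ V : ℕ → En n → ℝ, ∃ u : En n → ℝ, i ∈ Set.Icc 1 m → Fam (deriv W) (μ i) l Ω V u := by
    intro i
    by_cases hi : i ∈ Set.Icc 1 m
    · obtain ⟨V, u, h⟩ := exists_fam hf.continuous (hμpos i hi) hlp (hL i hi) hW0 (hcrit i hi) hΩ
      exact ⟨V, u, fun _ => h⟩
    · exact ⟨fun _ => 0, 0, fun h => absurd h hi⟩
  choose V u hF using hfam
  have hRpos : ∀ i ∈ Set.Icc 1 m, 0 < R i ∧ 0 < R i - D i := fun i hi => by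
    obtain ⟨h5, h6, h7⟩ := hD i hi
    have := (hRv i hi).1
    constructor <;> linarith
  have hx₀Ω : x₀ ∈ Ω := hx₀ m hmm (mem_closedBall_self (hRpos m hmm).1.le)
  have hbig : ∀ i ∈ Set.Icc 1 m, ∀ y : En n, ball y (R i) ⊆ Ω → ∀ x, ‖x - y‖ < R i - D i → μ i - ε < u i x := by
    intro i hi y hy x hx
    obtain ⟨h1, h2, h3, h4, h5, h6⟩ := hRv i hi
    exact lt_of_lt_of_le (h5 _ hx) ((hF i hi).sub_le h2 h3 h4 h6 hy x)
  have hbig0 : ∀ i ∈ Set.Icc 1 m, μ i - ε < u i x₀ := fun i hi =>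
    hbig i hi x₀ (ball_subset_closedBall.trans (hx₀ i hi)) x₀ (by rw [sub_self, norm_zero]; exact (hRpos i hi).2)
  refine ⟨u, fun i hi => ?_, fun i hi j hj hij => ?_⟩
  · have hNl := Fk_nonl hf.continuous (hμpos i hi) hlp (hL i hi) hW0 (hcrit i hi) hΩ
    obtain ⟨hr1, hr2⟩ := regularity hf (hF i hi).meas (hF i hi).memu hΩ ((hF i hi).equ hf.continuous)
    obtain ⟨hb1, hb2⟩ := (hF i hi).boundary hf hNl (hμpos i hi) hΩ hC2
    obtain ⟨hs1, hs2⟩ := (hF i hi).signs hf hNl hlp (hμpos i hi) hΩ hC2 (hL i hi) hW0 (hcrit i hi) hcon hfr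
      ⟨x₀, hx₀Ω, by have := hbig0 i hi; have := hεμ i hi; linarith⟩
    refine ⟨hr1, hb2, hr2, hb1, (hF i hi).stable hW hlp hΩ (hL i hi) hs2, hs1, ?_⟩
    intro x hx
    obtain ⟨y, hy, z, hz, rfl⟩ := Set.mem_add.1 hx
    refine hbig i hi y (ball_sub_of_infDist hΩ hy.1 (hRpos i hi).1 hy.2) _ ?_
    rw [add_sub_cancel_left]
    simpa using hz
  · refine (hF i hi).strict hf (hF j hj) hlp (hle i hi j hj hij.le) hΩ (hL j hj) hcon ⟨x₀, hx₀Ω, ?_⟩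
    have h1 := hbig0 j hj
    have h2 := hεsmall j hj
    have h3 := hle i hi (j - 1) ⟨by have := hi.1; omega, by have := hj.2; omega⟩ (by omega)
    have h4 := ((hF i hi).memu x₀).2
    linarith

end Helpers

theorem stmt16 (n : ℕ) (hn : 1 ≤ n) (m : ℕ) (hm : 2 ≤ m)
    (W : ℝ → ℝ) (hW : ContDiff ℝ 2 W)
    (μ : ℕ → ℝ) (hμ0 : μ 0 = 0)
    (hμpos : ∀ i ∈ Set.Icc 1 m, 0 < μ i)
    (hμmono : ∀ i ∈ Set.Icc 1 m, ∀ j ∈ Set.Icc 1 m, i < j → μ i < μ j ∧ W (μ j) < W (μ i))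
    (hW0 : deriv W 0 ≤ 0)
    (hcrit : ∀ i ∈ Set.Icc 1 m, deriv W (μ i) = 0)
    (hWmin : ∀ i ∈ Set.Icc 1 m, ∀ t ∈ Set.Ico (0:ℝ) (μ i), W (μ i) < W t)
    -- the heteroclinic profiles `𝐔ᵢ`
    (U : ℕ → ℝ → ℝ)
    (hU : ∀ i ∈ Set.Icc 1 m, ContDiffOn ℝ 2 (U i) (Set.Ici 0) ∧ U i 0 = 0 ∧
      (∀ s > (0:ℝ), deriv (deriv (U i)) s = deriv W (U i s)) ∧
      Filter.Tendsto (U i) Filter.atTop (nhds (μ i)))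
    (ε : ℝ) (hε : 0 < ε) (hεsmall : ∀ i ∈ Set.Icc 1 m, ε < μ i - μ (i - 1))
    (D D' : ℕ → ℝ)
    (hD : ∀ i ∈ Set.Icc 1 m, 0 ≤ D' i ∧ U i (D' i) = μ i - ε ∧ D' i < D i) :
    ∃ R' : ℕ → ℝ, (∀ i ∈ Set.Icc 1 m, D i < R' i) ∧
      ∀ Ω : Set (EuclideanSpace ℝ (Fin n)),
        IsOpen Ω → IsConnected Ω → (frontier Ω).Nonempty → HasC2Boundary Ω →
        -- `Ω` contains a closed ball of radius `R'' = max_i R'ᵢ`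
        (∃ x₀, ∀ i ∈ Set.Icc 1 m, closedBall x₀ (R' i) ⊆ Ω) →
        ∃ u : ℕ → EuclideanSpace ℝ (Fin n) → ℝ,
          (∀ i ∈ Set.Icc 1 m,
            ContDiffOn ℝ 2 (u i) Ω ∧ ContinuousOn (u i) (closure Ω) ∧
            (∀ x ∈ Ω, lap (u i) x = deriv W (u i x)) ∧
            (∀ x ∈ frontier Ω, u i x = 0) ∧
            IsStable W Ω (u i) ∧
            (∀ x ∈ Ω, 0 < u i x ∧ u i x < μ i) ∧
            (∀ x ∈ ({y ∈ Ω | R' i < infDist y (frontier Ω)} +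
                ball (0 : EuclideanSpace ℝ (Fin n)) (R' i - D i)), μ i - ε < u i x)) ∧
          (∀ i ∈ Set.Icc 1 m, ∀ j ∈ Set.Icc 1 m, i < j → ∀ x ∈ Ω, u i x < u j x) := by
  exact stmt16_aux n m hm W hW μ hμ0 hμpos hμmono hW0 hcrit hWmin U hU ε hε hεsmall D D' hD
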